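/- Let u_ε, for 0 < ε < ε₀, be solutions of Δu_ε = ε⁻²∇W(u_ε) in Ω with u_ε = g on ∂Ω, satisfying dist(u_ε(x),Γ) ≤ δ₁ for all x ∈ Ω, and let t_ε denote the signed distance of u_ε to Γ. Then t_ε → 0 uniformly on closure(Ω) as ε → 0. -/

import Mathlib

open Complex Metric MeasureTheory Filter Set Topology Bornology

noncomputable section

/-- The Laplacian of a map `u : ℂ → ℂ`, viewing `ℂ ≅ ℝ²`. -/
def lapC (u : ℂ → ℂ) (x : ℂ) : ℂ :=
  fderiv ℝ (fun y => fderiv ℝ u y 1) x 1 +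
    fderiv ℝ (fun y => fderiv ℝ u y Complex.I) x Complex.I

/-- The Laplacian of a function `h : ℂ → ℝ`. -/
def lapR (h : ℂ → ℝ) (x : ℂ) : ℝ :=
  fderiv ℝ (fun y => fderiv ℝ h y 1) x 1 +
    fderiv ℝ (fun y => fderiv ℝ h y Complex.I) x Complex.I

/-- `|∇u|²` for `u : ℂ → ℂ`. -/
def gradSq (u : ℂ → ℂ) (x : ℂ) : ℝ :=
  ‖fderiv ℝ u x 1‖ ^ 2 + ‖fderiv ℝ u x Complex.I‖ ^ 2

/-- The gradient `∇W` of a potential `W : ℂ → ℝ`, as a point of `ℂ ≅ ℝ²`. -/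
def gradW (W : ℂ → ℝ) (x : ℂ) : ℂ :=
  (fderiv ℝ W x 1 : ℂ) + (fderiv ℝ W x Complex.I : ℂ) * Complex.I

/-- The Ginzburg–Landau type energy `E_ε(u) = ∫_Ω [½|∇u|² + W(u)/ε²]`. -/
def energy (W : ℂ → ℝ) (Ω : Set ℂ) (ε : ℝ) (u : ℂ → ℂ) : ℝ :=
  ∫ x in Ω, ((1 / 2) * gradSq u x + W (u x) / ε ^ 2)

/-- `Γ` is a smooth simple closed curve of length `2π`, with (`2π`-periodic) arclength
parametrization `τ` (so that the point `τ(e^{is})` of the paper is `τ s` here). -/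
structure ArcParam (Γ : Set ℂ) (τ : ℝ → ℂ) : Prop where
  smooth : ContDiff ℝ (⊤ : ℕ∞) τ
  periodic : Function.Periodic τ (2 * Real.pi)
  arclength : ∀ s, ‖deriv τ s‖ = 1
  inj : ∀ s t : ℝ, τ s = τ t → ∃ k : ℤ, s - t = 2 * Real.pi * k
  srange : Set.range τ = Γ

/-- The hypotheses (h1)–(h5) on the potential `W`: smooth, nonnegative, vanishing exactly
on `Γ`, non-degenerate near `Γ`, and radially coercive outside `B_{R₀} ⊇ Γ`. -/
structure PotentialHyp (Γ : Set ℂ) (W : ℂ → ℝ) (R₀ : ℝ) : Prop where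
  smooth : ContDiff ℝ (⊤ : ℕ∞) W
  nonneg : ∀ z, 0 ≤ W z
  zeros : W ⁻¹' {0} = Γ
  nondeg : ∃ μ > 0, ∃ δ > 0, ∀ z : ℂ,
    Metric.infDist z Γ < δ → μ * Metric.infDist z Γ ^ 2 ≤ W z
  R0_large : ∀ z ∈ Γ, ‖z‖ < R₀
  coercive : ∀ z : ℂ, R₀ < ‖z‖ →
    0 ≤ (gradW W z).re * z.re + (gradW W z).im * z.im

/-- `u` is a (globally smooth) solution of `Δu = ε⁻² ∇W(u)` in `Ω`. -/
def SolvesGL (W : ℂ → ℝ) (Ω : Set ℂ) (ε : ℝ) (u : ℂ → ℂ) : Prop :=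
  ContDiff ℝ (⊤ : ℕ∞) u ∧ ∀ x ∈ Ω, lapC u x = (ε ^ 2)⁻¹ • gradW W (u x)

/-- The decomposition `u = τ(e^{iφ}) + t·n⃗(τ(e^{iφ}))` on the set `s`, where `t` is the
signed distance of `u` to `Γ` and `φ` is a (global) phase; the unit normal to `Γ` at `τ s`
is `i·τ'(s)`. -/
def PhaseDecomp (Γ : Set ℂ) (τ : ℝ → ℂ) (s : Set ℂ) (u : ℂ → ℂ) (t φ : ℂ → ℝ) : Prop :=
  ContinuousOn t s ∧ ContinuousOn φ s ∧
    ∀ x ∈ s, u x = τ (φ x) + (t x : ℂ) * (Complex.I * deriv τ (φ x)) ∧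
      |t x| = Metric.infDist (u x) Γ

/-- `γ` is an `L`-periodic arclength parametrization of the (smooth) boundary of `Ω`. -/
structure BoundaryParam (Ω : Set ℂ) (γ : ℝ → ℂ) (L : ℝ) : Prop where
  Lpos : 0 < L
  smooth : ContDiff ℝ (⊤ : ℕ∞) γ
  periodic : Function.Periodic γ L
  arclength : ∀ s, ‖deriv γ s‖ = 1
  inj : ∀ s t : ℝ, γ s = γ t → ∃ k : ℤ, s - t = L * k
  srange : Set.range γ = frontier Ω

/-- `n` is the outward unit normal field along the boundary parametrization `γ` of `Ω`. -/
structure OutwardNormal (Ω : Set ℂ) (γ : ℝ → ℂ) (n : ℝ → ℂ) : Prop where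
  unit : ∀ s, ‖n s‖ = 1
  orth : ∀ s, (n s).re * (deriv γ s).re + (n s).im * (deriv γ s).im = 0
  outward : ∀ s, ∀ᶠ r in nhdsWithin (0 : ℝ) (Set.Ioi (0 : ℝ)), γ s + Complex.ofReal r * n s ∉ closure Ω

/-- The maximum principle for the phase (Proposition 2.2) holds with constants `δ₁`, `m`:
for every critical point `u` of `E_ε` on a bounded simply connected domain `ω`, continuous on
`closure ω` and with `dist(u,Γ) ≤ δ₁` there, the functions `φ ∓ m t²/2` attain their
min/max on `∂ω`. -/
def MaxPrinciple (Γ : Set ℂ) (τ : ℝ → ℂ) (W : ℂ → ℝ) (δ₁ m : ℝ) : Prop :=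
  ∀ (ω : Set ℂ) (ε : ℝ) (u : ℂ → ℂ) (t φ : ℂ → ℝ),
    IsOpen ω → Bornology.IsBounded ω → ω.Nonempty → SimplyConnectedSpace ↥ω →
    0 < ε → ContDiffOn ℝ (⊤ : ℕ∞) u ω → ContinuousOn u (closure ω) →
    (∀ x ∈ ω, lapC u x = (ε ^ 2)⁻¹ • gradW W (u x)) →
    (∀ x ∈ closure ω, Metric.infDist (u x) Γ ≤ δ₁) →
    PhaseDecomp Γ τ (closure ω) u t φ →
    sInf ((fun x => φ x - m * t x ^ 2 / 2) '' closure ω) =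
        sInf ((fun x => φ x - m * t x ^ 2 / 2) '' frontier ω) ∧
      sSup ((fun x => φ x + m * t x ^ 2 / 2) '' closure ω) =
        sSup ((fun x => φ x + m * t x ^ 2 / 2) '' frontier ω)

section Preparation

open scoped Convolution ContDiff ComplexConjugate

lemma tendstoUniformly_convolution_of_tendsto_integral {E F : Type*} [NormedAddCommGroup E]
    [NormedSpace ℝ E] [NormedAddCommGroup F] [NormedSpace ℝ F]
    (L : E →L[ℝ] ℂ →L[ℝ] F) {K : ℝ → ℂ → E} {l : Filter ℝ} {f : ℂ → ℂ} (hf : Continuous f) {C : ℝ}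
    (hC : ∀ x, ‖f x‖ ≤ C) (hK : ∀ s, 0 ≤ s → Integrable (K s)) (hl : ∀ᶠ s in l, 0 ≤ s)
    (h : Tendsto (fun s => ∫ y, ‖K s y - K 0 y‖) l (𝓝 0)) :
    TendstoUniformly (fun s => K s ⋆[L, volume] f) (K 0 ⋆[L, volume] f) l := by
  have h_int : ∀ s, 0 ≤ s → ∀ x, Integrable (fun y => L (K s y) (f (x - y))) := by
    intro s hs x
    refine ((hK s hs).norm.mul_const (‖L‖ * C)).mono' ?_ ?_
    · exact L.aestronglyMeasurable_comp₂ (hK s hs).aestronglyMeasurable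
        (by fun_prop : Continuous fun y => f (x - y)).aestronglyMeasurable
    · refine Eventually.of_forall fun y => ?_
      calc _ ≤ ‖L‖ * ‖K s y‖ * ‖f (x - y)‖ := L.le_opNorm₂ _ _
        _ ≤ ‖L‖ * ‖K s y‖ * C := by gcongr; exact hC _
        _ = _ := by ring
  have hC0 : 0 ≤ C := (norm_nonneg _).trans (hC 0)
  rw [Metric.tendstoUniformly_iff]
  intro ε hε
  have h2 : Tendsto (fun s => (‖L‖ * C) * ∫ y, ‖K s y - K 0 y‖) l (𝓝 0) := by
    simpa using h.const_mul (‖L‖ * C)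
  filter_upwards [hl, h2.eventually (gt_mem_nhds hε)] with s hs hs2 x
  rw [dist_comm, dist_eq_norm]
  refine lt_of_le_of_lt ?_ hs2
  simp only [convolution]
  rw [← integral_sub (h_int s hs x) (h_int 0 le_rfl x), ← integral_const_mul]
  refine norm_integral_le_of_norm_le (((hK s hs).sub (hK 0 le_rfl)).norm.const_mul _) ?_
  refine Eventually.of_forall fun y => ?_
  calc ‖L (K s y) (f (x - y)) - L (K 0 y) (f (x - y))‖ = ‖L (K s y - K 0 y) (f (x - y))‖ := by simp
    _ ≤ ‖L‖ * ‖K s y - K 0 y‖ * ‖f (x - y)‖ := L.le_opNorm₂ _ _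
    _ ≤ ‖L‖ * ‖K s y - K 0 y‖ * C := by gcongr; exact hC _
    _ = _ := by ring

/-- A smooth cutoff of the plane, equal to one on `closedBall 0 6`. -/
def planeCutoff : ContDiffBump (0 : ℂ) := ⟨6, 7, by norm_num, by norm_num⟩

/-- The truncated regularised logarithmic kernel. -/
def logKer (s : ℝ) (y : ℂ) : ℝ := planeCutoff y * (1 / 2 * Real.log (‖y‖ ^ 2 + s))

/-- The derivative of the truncated regularised logarithmic kernel. -/
def logKerD (s : ℝ) (y : ℂ) : ℂ →L[ℝ] ℝ :=
  planeCutoff y • ((‖y‖ ^ 2 + s)⁻¹ • innerSL ℝ y) +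
    (1 / 2 * Real.log (‖y‖ ^ 2 + s)) • fderiv ℝ planeCutoff y

lemma hasFDerivAt_log_norm_sq_add {s : ℝ} {y : ℂ} (h : 0 < ‖y‖ ^ 2 + s) :
    HasFDerivAt (fun y : ℂ => 1 / 2 * Real.log (‖y‖ ^ 2 + s)) ((‖y‖ ^ 2 + s)⁻¹ • innerSL ℝ y) y := by
  have h1 : HasFDerivAt (fun y : ℂ => ‖y‖ ^ 2 + s) (2 • innerSL ℝ y) y :=
    ((hasStrictFDerivAt_norm_sq y).hasFDerivAt).add_const s
  refine ((h1.log h.ne').const_mul (1 / 2)).congr_fderiv ?_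
  ext v
  simp
  ring

lemma hasFDerivAt_logKer {s : ℝ} {y : ℂ} (h : 0 < ‖y‖ ^ 2 + s) :
    HasFDerivAt (logKer s) (logKerD s y) y := by
  have h2 : HasFDerivAt planeCutoff (fderiv ℝ planeCutoff y) y :=
    ((planeCutoff.contDiff (n := 1)).differentiable (by norm_num) y).hasFDerivAt
  exact h2.mul (hasFDerivAt_log_norm_sq_add h)

lemma contDiff_logKer {s : ℝ} (hs : 0 < s) : ContDiff ℝ ∞ (logKer s) := by
  refine planeCutoff.contDiff.mul (contDiff_const.mul ?_)
  refine ContDiff.log ?_ fun y => by positivity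
  exact (contDiff_norm_sq ℝ).add contDiff_const

lemma abs_log_norm_sq_add_le {s : ℝ} (hs : 0 ≤ s) (hs1 : s ≤ 1) {y : ℂ} (hy : y ≠ 0)
    (hy7 : ‖y‖ ≤ 7) : |1 / 2 * Real.log (‖y‖ ^ 2 + s)| ≤ 175 * ‖y‖⁻¹ := by
  have hp : 0 < ‖y‖ := norm_pos_iff.2 hy
  have h1 : 1 ≤ 7 * ‖y‖⁻¹ := by
    rw [← div_eq_mul_inv, le_div_iff₀ hp]; linarith
  have hinv : 0 < ‖y‖⁻¹ := inv_pos.2 hp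
  rw [abs_le]
  constructor
  · have := Real.log_le_log (by positivity : 0 < ‖y‖ ^ 2) (by linarith : ‖y‖ ^ 2 ≤ ‖y‖ ^ 2 + s)
    rw [Real.log_pow] at this
    have h3 := Real.log_le_sub_one_of_pos hinv
    rw [Real.log_inv] at h3
    push_cast at this
    linarith
  · have h3 := Real.log_le_sub_one_of_pos (by positivity : 0 < ‖y‖ ^ 2 + s)
    nlinarith

/-- The dominating function for the kernels. -/
lemma integrable_indicator_inv_norm (C : ℝ) :
    Integrable ((ball (0 : ℂ) 8).indicator fun y => C * ‖y‖⁻¹) := by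
  rw [integrable_indicator_iff measurableSet_ball]
  refine integrableOn_ball_of_norm_le_rpow (C := |C|) (α := 1) (by simp) (by simp) ?_ ?_
  · refine Eventually.of_forall fun y => ?_
    simp [Real.rpow_neg_one]
  · exact (measurable_const.mul (measurable_norm.inv)).aestronglyMeasurable

lemma planeCutoff_eq_zero {y : ℂ} (hy : 7 < ‖y‖) : planeCutoff y = 0 := by
  refine planeCutoff.zero_of_le_dist ?_
  simp only [planeCutoff, dist_zero_right]; exact hy.le

lemma fderiv_planeCutoff_eq_zero {y : ℂ} (hy : 7 < ‖y‖) : fderiv ℝ planeCutoff y = 0 := by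
  have : planeCutoff =ᶠ[𝓝 y] fun _ => (0 : ℝ) := by
    filter_upwards [(continuous_norm.tendsto y).eventually (lt_mem_nhds hy)] with z hz
    exact planeCutoff_eq_zero hz
  rw [this.fderiv_eq]; simp

lemma exists_bound_fderiv_planeCutoff : ∃ C, ∀ y, ‖fderiv ℝ planeCutoff y‖ ≤ C := by
  have h : Continuous (fderiv ℝ planeCutoff) :=
    (planeCutoff.contDiff (n := 1)).continuous_fderiv (by norm_num)
  exact (planeCutoff.hasCompactSupport.fderiv (𝕜 := ℝ)).exists_bound_of_continuous h

lemma exists_bound_logKer : ∃ C, (∀ s, 0 ≤ s → s ≤ 1 → ∀ y, y ≠ 0 →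
    ‖logKer s y‖ ≤ (ball (0 : ℂ) 8).indicator (fun y => C * ‖y‖⁻¹) y) ∧ ∀ s, 0 ≤ s → s ≤ 1 → ∀ y,
    y ≠ 0 → ‖logKerD s y‖ ≤ (ball (0 : ℂ) 8).indicator (fun y => C * ‖y‖⁻¹) y := by
  obtain ⟨D, hD⟩ := exists_bound_fderiv_planeCutoff
  have hD0 : 0 ≤ D := (norm_nonneg _).trans (hD 0)
  refine ⟨175 + 175 * D, fun s hs hs1 y hy => ?_, fun s hs hs1 y hy => ?_⟩
  all_goals
    by_cases h7 : 7 < ‖y‖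
    · simp only [logKer, logKerD, planeCutoff_eq_zero h7, fderiv_planeCutoff_eq_zero h7]
      simp only [zero_mul, zero_smul, smul_zero, add_zero, norm_zero]
      refine indicator_nonneg (fun y _ => by positivity) _
    have h7' : ‖y‖ ≤ 7 := not_lt.1 h7
    have hmem : y ∈ ball (0 : ℂ) 8 := by simp; linarith
    have hp : 0 < ‖y‖ := norm_pos_iff.2 hy
    rw [indicator_of_mem hmem]
    have h1 := abs_log_norm_sq_add_le hs hs1 hy h7'
    have h2 : |planeCutoff y| ≤ 1 := by
      rw [abs_of_nonneg planeCutoff.nonneg]; exact planeCutoff.le_one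
  · rw [logKer, Real.norm_eq_abs, abs_mul]
    calc _ ≤ 1 * (175 * ‖y‖⁻¹) := by gcongr
      _ ≤ _ := by nlinarith [mul_nonneg hD0 (inv_pos.2 hp).le]
  · have h3 : ‖(‖y‖ ^ 2 + s)⁻¹ • innerSL ℝ y‖ ≤ ‖y‖⁻¹ := by
      rw [norm_smul, innerSL_apply_norm, Real.norm_eq_abs, abs_of_pos (by positivity)]
      rw [inv_mul_eq_div, ← one_div, div_le_div_iff₀ (by positivity) hp]
      nlinarith
    calc ‖logKerD s y‖ ≤ |planeCutoff y| * ‖(‖y‖ ^ 2 + s)⁻¹ • innerSL ℝ y‖ +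
          |1 / 2 * Real.log (‖y‖ ^ 2 + s)| * ‖fderiv ℝ planeCutoff y‖ := by
          refine (norm_add_le _ _).trans ?_
          rw [norm_smul, norm_smul _ (fderiv ℝ planeCutoff y), Real.norm_eq_abs, Real.norm_eq_abs]
      _ ≤ 1 * ‖y‖⁻¹ + 175 * ‖y‖⁻¹ * D := by gcongr; exact hD y
      _ ≤ _ := by nlinarith [inv_pos.2 hp]

lemma measurable_logKer (s : ℝ) : AEStronglyMeasurable (logKer s) := by
  refine Measurable.aestronglyMeasurable ?_
  exact planeCutoff.continuous.measurable.mul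
    (((measurable_norm.pow_const 2).add_const s).log.const_mul _)

lemma measurable_logKerD (s : ℝ) : AEStronglyMeasurable (logKerD s) := by
  have h : Continuous (fderiv ℝ planeCutoff) :=
    (planeCutoff.contDiff (n := 1)).continuous_fderiv (by norm_num)
  refine AEStronglyMeasurable.add ?_ ?_
  · exact planeCutoff.continuous.aestronglyMeasurable.smul
      ((((measurable_norm.pow_const 2).add_const s).inv.aestronglyMeasurable).smul
        (innerSL ℝ).continuous.aestronglyMeasurable)
  · exact ((((measurable_norm.pow_const 2).add_const s).log.const_mul _).aestronglyMeasurable).smul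
      h.aestronglyMeasurable

lemma ae_ne_zero_complex : ∀ᵐ y : ℂ, y ≠ 0 := by
  simp [ae_iff]

lemma integrable_logKer {s : ℝ} (hs : 0 ≤ s) (hs1 : s ≤ 1) : Integrable (logKer s) := by
  obtain ⟨C, hC, -⟩ := exists_bound_logKer
  refine (integrable_indicator_inv_norm C).mono' (measurable_logKer s) ?_
  filter_upwards [ae_ne_zero_complex] with y hy using hC s hs hs1 y hy

lemma integrable_logKerD {s : ℝ} (hs : 0 ≤ s) (hs1 : s ≤ 1) : Integrable (logKerD s) := by
  obtain ⟨C, -, hC⟩ := exists_bound_logKer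
  refine (integrable_indicator_inv_norm C).mono' (measurable_logKerD s) ?_
  filter_upwards [ae_ne_zero_complex] with y hy using hC s hs hs1 y hy

lemma tendsto_integral_norm_sub_of_dominated {E : Type*} [NormedAddCommGroup E]
    {K : ℝ → ℂ → E} {C : ℝ} (hm : ∀ s, AEStronglyMeasurable (K s))
    (hC : ∀ s, 0 ≤ s → s ≤ 1 → ∀ y, y ≠ 0 →
      ‖K s y‖ ≤ (ball (0 : ℂ) 8).indicator (fun y => C * ‖y‖⁻¹) y)
    (hlim : ∀ y, y ≠ 0 → Tendsto (fun s => K s y) (𝓝[>] 0) (𝓝 (K 0 y))) :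
    Tendsto (fun s => ∫ y, ‖K s y - K 0 y‖) (𝓝[>] 0) (𝓝 0) := by
  have h := tendsto_integral_filter_of_dominated_convergence (μ := (volume : Measure ℂ))
    (l := 𝓝[>] (0 : ℝ)) (F := fun s y => ‖K s y - K 0 y‖) (f := fun _ => 0)
    (bound := fun y => 2 * (ball (0 : ℂ) 8).indicator (fun y => C * ‖y‖⁻¹) y)
    (Eventually.of_forall fun s => ((hm s).sub (hm 0)).norm) ?_ ?_ ?_
  · simpa using h
  · have : Ioc (0 : ℝ) 1 ∈ 𝓝[>] (0 : ℝ) := Ioc_mem_nhdsGT one_pos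
    filter_upwards [this] with s hs
    filter_upwards [ae_ne_zero_complex] with y hy
    rw [norm_norm]
    refine (norm_sub_le _ _).trans ?_
    have h1 := hC s hs.1.le hs.2 y hy
    have h2 := hC 0 le_rfl zero_le_one y hy
    linarith
  · exact (integrable_indicator_inv_norm C).const_mul 2
  · filter_upwards [ae_ne_zero_complex] with y hy
    have := ((hlim y hy).sub_const (K 0 y)).norm
    simpa using this

lemma continuousAt_log_reg {y : ℂ} (hy : y ≠ 0) :
    ContinuousAt (fun s : ℝ => 1 / 2 * Real.log (‖y‖ ^ 2 + s)) 0 := by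
  have hp : 0 < ‖y‖ := norm_pos_iff.2 hy
  have : ‖y‖ ^ 2 + 0 ≠ 0 := by positivity
  fun_prop (disch := assumption)

lemma tendsto_integral_logKer_sub :
    Tendsto (fun s => ∫ y, ‖logKer s y - logKer 0 y‖) (𝓝[>] 0) (𝓝 0) := by
  obtain ⟨C, hC, -⟩ := exists_bound_logKer
  refine tendsto_integral_norm_sub_of_dominated measurable_logKer hC fun y hy => ?_
  have h := continuousAt_log_reg hy
  exact (h.const_mul (planeCutoff y)).tendsto.mono_left nhdsWithin_le_nhds

lemma tendsto_integral_logKerD_sub :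
    Tendsto (fun s => ∫ y, ‖logKerD s y - logKerD 0 y‖) (𝓝[>] 0) (𝓝 0) := by
  obtain ⟨C, -, hC⟩ := exists_bound_logKer
  refine tendsto_integral_norm_sub_of_dominated measurable_logKerD hC fun y hy => ?_
  have hp : 0 < ‖y‖ := norm_pos_iff.2 hy
  have h := continuousAt_log_reg hy
  have h2 : ContinuousAt (fun s : ℝ => (‖y‖ ^ 2 + s)⁻¹) 0 := by
    have : ‖y‖ ^ 2 + 0 ≠ 0 := by positivity
    fun_prop (disch := assumption)
  refine Tendsto.mono_left ?_ nhdsWithin_le_nhds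
  unfold logKerD
  generalize (innerSL ℝ y : ℂ →L[ℝ] ℝ) = A
  generalize (fderiv ℝ planeCutoff y : ℂ →L[ℝ] ℝ) = B
  generalize planeCutoff y = c
  have e1 : Tendsto (fun s : ℝ => (‖y‖ ^ 2 + s)⁻¹ • A) (𝓝 0) (𝓝 ((‖y‖ ^ 2 + 0)⁻¹ • A)) :=
    h2.tendsto.smul_const A
  have e3 : Tendsto (fun s : ℝ => (1 / 2 * Real.log (‖y‖ ^ 2 + s)) • B) (𝓝 0)
      (𝓝 ((1 / 2 * Real.log (‖y‖ ^ 2 + 0)) • B)) := h.tendsto.smul_const B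
  exact (e1.const_smul c).add e3

/-- The truncated logarithmic potential of `f`. -/
def logPot (f : ℂ → ℂ) : ℂ → ℂ := logKer 0 ⋆[ContinuousLinearMap.lsmul ℝ ℝ, volume] f

lemma hasCompactSupport_logKer (s : ℝ) : HasCompactSupport (logKer s) :=
  planeCutoff.hasCompactSupport.mul_right

lemma hasFDerivAt_logPot {f : ℂ → ℂ} (hf : Continuous f) (hfc : HasCompactSupport f) (x : ℂ) :
    HasFDerivAt (logPot f)
      ((logKerD 0 ⋆[(ContinuousLinearMap.lsmul ℝ ℝ).precompL ℂ, volume] f) x) x := by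
  obtain ⟨C, hC⟩ := hfc.exists_bound_of_continuous hf
  have hI : ∀ᶠ s in 𝓝[>] (0 : ℝ), s ∈ Ioc (0 : ℝ) 1 := Ioc_mem_nhdsGT one_pos
  let K : ℝ → ℂ → ℝ := fun s => logKer (min s 1)
  let K' : ℝ → ℂ → ℂ →L[ℝ] ℝ := fun s => logKerD (min s 1)
  have hK0 : K 0 = logKer 0 := by simp [K]
  have hK0' : K' 0 = logKerD 0 := by simp [K']
  have hKt : Tendsto (fun s => ∫ y, ‖K s y - K 0 y‖) (𝓝[>] 0) (𝓝 0) := by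
    refine tendsto_integral_logKer_sub.congr' ?_
    filter_upwards [hI] with s hs
    simp [K, min_eq_left hs.2]
  have hKt' : Tendsto (fun s => ∫ y, ‖K' s y - K' 0 y‖) (𝓝[>] 0) (𝓝 0) := by
    refine tendsto_integral_logKerD_sub.congr' ?_
    filter_upwards [hI] with s hs
    simp [K', min_eq_left hs.2]
  have hle : ∀ᶠ s in 𝓝[>] (0 : ℝ), 0 ≤ s := hI.mono fun s hs => hs.1.le
  have h1 := tendstoUniformly_convolution_of_tendsto_integral
    ((ContinuousLinearMap.lsmul ℝ ℝ : ℝ →L[ℝ] ℂ →L[ℝ] ℂ)) (K := K) hf hC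
    (fun s hs => integrable_logKer (le_min hs zero_le_one) (min_le_right _ _)) hle hKt
  have h2 := tendstoUniformly_convolution_of_tendsto_integral
    ((ContinuousLinearMap.lsmul ℝ ℝ : ℝ →L[ℝ] ℂ →L[ℝ] ℂ).precompL ℂ) (K := K') hf hC
    (fun s hs => integrable_logKerD (le_min hs zero_le_one) (min_le_right _ _)) hle hKt'
  rw [hK0] at h1
  rw [hK0'] at h2
  refine hasFDerivAt_of_tendstoUniformlyOnFilter
    (h2.tendstoUniformlyOnFilter.mono_right le_top) ?_
    (Eventually.of_forall fun x => h1.tendsto_at x)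
  rw [eventually_prod_iff]
  refine ⟨_, hI, fun _ => True, Eventually.of_forall fun _ => trivial, ?_⟩
  intro s hs x _
  have hs' : min s 1 = s := min_eq_left hs.2
  simp only [K, K', hs']
  have h3 := (hasCompactSupport_logKer s).hasFDerivAt_convolution_left
    (ContinuousLinearMap.lsmul ℝ ℝ : ℝ →L[ℝ] ℂ →L[ℝ] ℂ)
    ((contDiff_logKer hs.1).of_le (by exact_mod_cast le_top)) (hf.locallyIntegrable (μ := volume)) x
  have h4 : fderiv ℝ (logKer s) = logKerD s := by
    ext1 y
    exact (hasFDerivAt_logKer (by have := hs.1; positivity)).fderiv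
  rwa [h4] at h3

lemma contDiff_logPot {f : ℂ → ℂ} {n : ℕ} (hf : ContDiff ℝ n f) (hfc : HasCompactSupport f) :
    ContDiff ℝ (n + 1) (logPot f) := by
  have h := hasFDerivAt_logPot hf.continuous hfc
  rw [contDiff_succ_iff_fderiv]
  refine ⟨fun x => (h x).differentiableAt, by simp, ?_⟩
  have h2 : fderiv ℝ (logPot f) =
      logKerD 0 ⋆[(ContinuousLinearMap.lsmul ℝ ℝ).precompL ℂ, volume] f := by
    ext1 x; exact (h x).fderiv
  rw [h2]
  exact hfc.contDiff_convolution_right (n := n) _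
    (integrable_logKerD le_rfl zero_le_one).locallyIntegrable hf

lemma norm_logPot_le : ∃ C, 0 ≤ C ∧ ∀ (f : ℂ → ℂ) (B : ℝ), (∀ x, ‖f x‖ ≤ B) →
    ∀ x, ‖logPot f x‖ ≤ C * B := by
  refine ⟨∫ y, ‖logKer 0 y‖, by positivity, fun f B hB x => ?_⟩
  rw [← integral_mul_const]
  refine norm_integral_le_of_norm_le
    ((integrable_logKer le_rfl zero_le_one).norm.mul_const B) ?_
  refine Eventually.of_forall fun y => ?_
  simp only [ContinuousLinearMap.lsmul_apply, norm_smul]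
  gcongr
  exact hB _

lemma logPot_sub {f g : ℂ → ℂ} (hf : Continuous f) (hfc : HasCompactSupport f)
    (hg : Continuous g) (hgc : HasCompactSupport g) (x : ℂ) :
    logPot f x - logPot g x = logPot (fun y => f y - g y) x := by
  have hi := (integrable_logKer (s := 0) le_rfl zero_le_one).locallyIntegrable
  have h1 := (hfc.convolutionExists_right (ContinuousLinearMap.lsmul ℝ ℝ) hi hf) x
  have h2 := (hgc.convolutionExists_right (ContinuousLinearMap.lsmul ℝ ℝ) hi hg) x
  simp only [logPot, convolution]
  rw [← integral_sub h1 h2]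
  simp [smul_sub]

lemma fderiv_convolution_right_apply {k : ℂ → ℝ} (hk : Integrable k) {f : ℂ → ℂ}
    (hf : ContDiff ℝ 1 f) (hfc : HasCompactSupport f) (x v : ℂ) :
    fderiv ℝ (k ⋆[ContinuousLinearMap.lsmul ℝ ℝ, volume] f) x v =
      (k ⋆[ContinuousLinearMap.lsmul ℝ ℝ, volume] fun y => fderiv ℝ f y v) x := by
  rw [(hfc.hasFDerivAt_convolution_right _ hk.locallyIntegrable hf x).fderiv]
  exact convolution_precompR_apply _ hk.locallyIntegrable (hfc.fderiv ℝ)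
    (hf.continuous_fderiv one_ne_zero) x v

lemma contDiff_fderiv_apply_const {F : Type*} [NormedAddCommGroup F] [NormedSpace ℝ F]
    {f : ℂ → F} {n m : WithTop ℕ∞} (hf : ContDiff ℝ n f) (h : m + 1 ≤ n) (v : ℂ) :
    ContDiff ℝ m fun y => fderiv ℝ f y v :=
  (hf.fderiv_right h).clm_apply contDiff_const

lemma lapC_convolution {k : ℂ → ℝ} (hk : Integrable k) {f : ℂ → ℂ}
    (hf : ContDiff ℝ 2 f) (hfc : HasCompactSupport f) (x : ℂ) :
    lapC (k ⋆[ContinuousLinearMap.lsmul ℝ ℝ, volume] f) x =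
      (k ⋆[ContinuousLinearMap.lsmul ℝ ℝ, volume] lapC f) x := by
  have hf1 : ContDiff ℝ 1 f := hf.of_le (by norm_num)
  have key : ∀ v, fderiv ℝ (fun y => fderiv ℝ (k ⋆[ContinuousLinearMap.lsmul ℝ ℝ, volume] f) y v) x v
      = (k ⋆[ContinuousLinearMap.lsmul ℝ ℝ, volume]
        fun y => fderiv ℝ (fun z => fderiv ℝ f z v) y v) x := by
    intro v
    have h1 : (fun y => fderiv ℝ (k ⋆[ContinuousLinearMap.lsmul ℝ ℝ, volume] f) y v) =
        (k ⋆[ContinuousLinearMap.lsmul ℝ ℝ, volume] fun y => fderiv ℝ f y v) := by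
      ext1 y; exact fderiv_convolution_right_apply hk hf1 hfc y v
    rw [h1]
    exact fderiv_convolution_right_apply hk (contDiff_fderiv_apply_const hf (by norm_num) v)
      (hfc.fderiv_apply (𝕜 := ℝ) v) x v
  have hc : ∀ v, ConvolutionExistsAt k (fun y => fderiv ℝ (fun z => fderiv ℝ f z v) y v) x
      (ContinuousLinearMap.lsmul ℝ ℝ) volume := by
    intro v
    have h2 : ContDiff ℝ 1 fun z => fderiv ℝ f z v := contDiff_fderiv_apply_const hf (by norm_num) v
    have h3 : ContDiff ℝ 0 fun y => fderiv ℝ (fun z => fderiv ℝ f z v) y v :=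
      contDiff_fderiv_apply_const h2 (by norm_num) v
    exact ((hfc.fderiv_apply (𝕜 := ℝ) v).fderiv_apply (𝕜 := ℝ) v).convolutionExists_right _
      hk.locallyIntegrable h3.continuous x
  unfold lapC
  rw [key, key]
  exact ((hc 1).distrib_add (hc Complex.I)).symm

lemma fderiv_convolution_left_apply {k : ℂ → ℝ} (hk : ContDiff ℝ 1 k) (hkc : HasCompactSupport k)
    {f : ℂ → ℂ} (hf : Continuous f) (x v : ℂ) :
    fderiv ℝ (k ⋆[ContinuousLinearMap.lsmul ℝ ℝ, volume] f) x v =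
      ((fun y => fderiv ℝ k y v) ⋆[ContinuousLinearMap.lsmul ℝ ℝ, volume] f) x := by
  rw [(hkc.hasFDerivAt_convolution_left _ hk hf.locallyIntegrable x).fderiv]
  have := (hkc.fderiv (𝕜 := ℝ)).convolutionExists_left
    ((ContinuousLinearMap.lsmul ℝ ℝ : ℝ →L[ℝ] ℂ →L[ℝ] ℂ).precompL ℂ)
    (hk.continuous_fderiv one_ne_zero) (hf.locallyIntegrable (μ := volume)) x
  simp_rw [convolution_def, ContinuousLinearMap.integral_apply this]
  rfl

lemma lapC_convolution_left {k : ℂ → ℝ} (hk : ContDiff ℝ 2 k) (hkc : HasCompactSupport k)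
    {f : ℂ → ℂ} (hf : Continuous f) (x : ℂ) :
    lapC (k ⋆[ContinuousLinearMap.lsmul ℝ ℝ, volume] f) x =
      (lapR k ⋆[ContinuousLinearMap.lsmul ℝ ℝ, volume] f) x := by
  have hk1 : ContDiff ℝ 1 k := hk.of_le (by norm_num)
  have key : ∀ v, fderiv ℝ (fun y => fderiv ℝ (k ⋆[ContinuousLinearMap.lsmul ℝ ℝ, volume] f) y v) x v
      = ((fun y => fderiv ℝ (fun z => fderiv ℝ k z v) y v)
        ⋆[ContinuousLinearMap.lsmul ℝ ℝ, volume] f) x := by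
    intro v
    have h1 : (fun y => fderiv ℝ (k ⋆[ContinuousLinearMap.lsmul ℝ ℝ, volume] f) y v) =
        ((fun y => fderiv ℝ k y v) ⋆[ContinuousLinearMap.lsmul ℝ ℝ, volume] f) := by
      ext1 y; exact fderiv_convolution_left_apply hk1 hkc hf y v
    rw [h1]
    exact fderiv_convolution_left_apply (contDiff_fderiv_apply_const hk (by norm_num) v)
      (hkc.fderiv_apply (𝕜 := ℝ) v) hf x v
  have hc : ∀ v, ConvolutionExistsAt (fun y => fderiv ℝ (fun z => fderiv ℝ k z v) y v) f x
      (ContinuousLinearMap.lsmul ℝ ℝ) volume := by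
    intro v
    have h2 : ContDiff ℝ 1 fun z => fderiv ℝ k z v := contDiff_fderiv_apply_const hk (by norm_num) v
    have h3 : ContDiff ℝ 0 fun y => fderiv ℝ (fun z => fderiv ℝ k z v) y v :=
      contDiff_fderiv_apply_const h2 (by norm_num) v
    exact ((hkc.fderiv_apply (𝕜 := ℝ) v).fderiv_apply (𝕜 := ℝ) v).convolutionExists_left _
      h3.continuous hf.locallyIntegrable x
  unfold lapC
  rw [key, key]
  exact ((hc 1).add_distrib (hc Complex.I)).symm

lemma lapR_logKer {s : ℝ} (hs : 0 < s) {y : ℂ} (hy : ‖y‖ < 6) :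
    lapR (logKer s) y = 2 * s / (‖y‖ ^ 2 + s) ^ 2 := by
  have hpos : ∀ z : ℂ, 0 < ‖z‖ ^ 2 + s := fun z => by positivity
  have hev : ∀ z : ℂ, ‖z‖ < 6 → fderiv ℝ (logKer s) z = (‖z‖ ^ 2 + s)⁻¹ • innerSL ℝ z := by
    intro z hz
    have : logKer s =ᶠ[𝓝 z] fun y => 1 / 2 * Real.log (‖y‖ ^ 2 + s) := by
      filter_upwards [(continuous_norm.tendsto z).eventually (gt_mem_nhds hz)] with w hw
      have : planeCutoff w = 1 := planeCutoff.one_of_mem_closedBall (by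
        simp only [planeCutoff, mem_closedBall, dist_zero_right]; exact hw.le)
      simp [logKer, this]
    rw [this.fderiv_eq]
    exact (hasFDerivAt_log_norm_sq_add (hpos z)).fderiv
  have key : ∀ v, fderiv ℝ (fun z => fderiv ℝ (logKer s) z v) y v =
      (‖y‖ ^ 2 + s)⁻¹ * inner ℝ v v - 2 * inner ℝ y v ^ 2 / (‖y‖ ^ 2 + s) ^ 2 := by
    intro v
    have h1 : (fun z => fderiv ℝ (logKer s) z v) =ᶠ[𝓝 y]
        fun z => (‖z‖ ^ 2 + s)⁻¹ * inner ℝ z v := by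
      filter_upwards [(continuous_norm.tendsto y).eventually (gt_mem_nhds hy)] with z hz
      rw [hev z hz]; simp
    rw [h1.fderiv_eq]
    have h2 : HasFDerivAt (fun y : ℂ => ‖y‖ ^ 2 + s) (2 • innerSL ℝ y) y :=
      ((hasStrictFDerivAt_norm_sq y).hasFDerivAt).add_const s
    have h3 := (hasDerivAt_inv (hpos y).ne').comp_hasFDerivAt y h2
    have h4 : HasFDerivAt (fun z : ℂ => inner ℝ z v) ((innerSL ℝ).flip v) y :=
      ((innerSL ℝ).flip v).hasFDerivAt
    have h5 := (h3.mul h4).fderiv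
    simp only [Function.comp_def] at h5
    erw [h5]
    have h6 : (innerSL ℝ) v v = ‖v‖ ^ 2 := real_inner_self_eq_norm_sq v
    have h7 : inner ℝ v v = ‖v‖ ^ 2 := real_inner_self_eq_norm_sq v
    simp only [add_apply, smul_apply,
      ContinuousLinearMap.flip_apply, innerSL_apply_apply, smul_eq_mul, nsmul_eq_mul]
    push_cast
    field_simp
    ring
  have hne := (hpos y).ne'
  unfold lapR
  rw [key, key]
  have e1 : inner ℝ (1 : ℂ) (1 : ℂ) = (1 : ℝ) := by simp
  have e2 : inner ℝ Complex.I Complex.I = (1 : ℝ) := by simp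
  have e3 : inner ℝ y (1 : ℂ) ^ 2 + inner ℝ y Complex.I ^ 2 = ‖y‖ ^ 2 := by
    rw [Complex.sq_norm, Complex.normSq_apply]; simp [Complex.inner]; ring
  rw [e1, e2]
  have : (‖y‖ ^ 2 + s)⁻¹ * 1 - 2 * inner ℝ y (1 : ℂ) ^ 2 / (‖y‖ ^ 2 + s) ^ 2 +
      ((‖y‖ ^ 2 + s)⁻¹ * 1 - 2 * inner ℝ y Complex.I ^ 2 / (‖y‖ ^ 2 + s) ^ 2) =
      2 * (‖y‖ ^ 2 + s)⁻¹ - 2 * (inner ℝ y (1 : ℂ) ^ 2 + inner ℝ y Complex.I ^ 2) /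
        (‖y‖ ^ 2 + s) ^ 2 := by ring
  rw [this, e3]
  field_simp
  ring

/-- The mass of the limiting kernel. -/
def logMass : ℝ := ∫ y : ℂ, 2 / (1 + ‖y‖ ^ 2) ^ 2

lemma integrable_logMass : Integrable fun y : ℂ => 2 / (1 + ‖y‖ ^ 2) ^ 2 := by
  have h := (integrable_rpow_neg_one_add_norm_sq (E := ℂ) (μ := volume) (r := 4)
    (by simp; norm_num)).const_mul 2
  refine h.congr (Eventually.of_forall fun y => ?_)
  have : (-4 / 2 : ℝ) = -((2 : ℕ) : ℝ) := by norm_num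
  simp only [this]
  rw [Real.rpow_neg (by positivity), Real.rpow_natCast, div_eq_mul_inv]

lemma logMass_pos : 0 < logMass := by
  unfold logMass
  rw [integral_pos_iff_support_of_nonneg (fun y => by positivity) integrable_logMass]
  have : (Function.support fun y : ℂ => 2 / (1 + ‖y‖ ^ 2) ^ 2) = univ := by
    ext y
    simp only [Function.mem_support, mem_univ, iff_true]
    positivity
  rw [this]
  simp

lemma tendsto_lapR_logKer_convolution {f : ℂ → ℂ} (hf : Continuous f)
    (hs : ∀ y, f y ≠ 0 → ‖y‖ < 3) {x : ℂ} (hx : ‖x‖ < 2) :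
    Tendsto (fun s => (lapR (logKer s) ⋆[ContinuousLinearMap.lsmul ℝ ℝ, volume] f) x) (𝓝[>] 0)
      (𝓝 (logMass • f x)) := by
  have hfc : HasCompactSupport f := HasCompactSupport.intro (isCompact_closedBall (0 : ℂ) 3)
    fun y hy => by
      by_contra h
      exact hy (by simpa using (hs y h).le)
  have hc := logMass_pos
  have h1 := tendsto_integral_comp_smul_smul_of_integrable' (μ := (volume : Measure ℂ))
    (φ := fun y : ℂ => logMass⁻¹ * (2 / (1 + ‖y‖ ^ 2) ^ 2)) (g := f) (x₀ := x)
    (fun y => by positivity) (by rw [integral_const_mul]; exact inv_mul_cancel₀ hc.ne') ?_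
    (hf.integrable_of_hasCompactSupport hfc) hf.continuousAt
  · have h2 : Tendsto (fun s : ℝ => (Real.sqrt s)⁻¹) (𝓝[>] 0) atTop := by
      refine tendsto_inv_nhdsGT_zero.comp (tendsto_nhdsWithin_iff.2 ⟨?_, ?_⟩)
      · have := (Real.continuous_sqrt.tendsto 0)
        rw [Real.sqrt_zero] at this
        exact this.mono_left nhdsWithin_le_nhds
      · filter_upwards [self_mem_nhdsWithin] with s hs
        exact Real.sqrt_pos.2 hs
    refine ((h1.comp h2).const_smul logMass).congr' ?_
    filter_upwards [self_mem_nhdsWithin] with s hs0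
    have hs0 : 0 < s := hs0
    rw [convolution_eq_swap]
    simp only [Function.comp_def]
    rw [← integral_smul]
    refine integral_congr_ae (Eventually.of_forall fun y => ?_)
    by_cases hy : f y = 0
    · simp [hy]
    have hxy : ‖x - y‖ < 6 := by
      have := norm_sub_le x y; have := hs y hy; linarith
    simp only [ContinuousLinearMap.lsmul_apply]
    rw [lapR_logKer hs0 hxy, smul_smul]
    congr 1
    have e1 : ‖(Real.sqrt s)⁻¹ • (x - y)‖ ^ 2 = ‖x - y‖ ^ 2 / s := by
      rw [norm_smul, mul_pow, norm_inv, inv_pow, Real.norm_eq_abs, sq_abs, Real.sq_sqrt hs0.le]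
      field_simp
    have e2 : ((Real.sqrt s)⁻¹) ^ 2 = s⁻¹ := by rw [inv_pow, Real.sq_sqrt hs0.le]
    rw [Complex.finrank_real_complex, e1, e2]
    have : ‖x - y‖ ^ 2 + s ≠ 0 := by positivity
    have : 1 + ‖x - y‖ ^ 2 / s ≠ 0 := by positivity
    field_simp
    ring
  · rw [Complex.finrank_real_complex]
    have h3 : Tendsto (fun x : ℂ => 2 * logMass⁻¹ * (‖x‖ ^ 2)⁻¹) (cobounded ℂ) (𝓝 0) := by
      have := ((tendsto_pow_atTop (α := ℝ) (n := 2) two_ne_zero).comp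
        (tendsto_norm_cobounded_atTop (E := ℂ))).inv_tendsto_atTop.const_mul (2 * logMass⁻¹)
      simpa using this
    refine squeeze_zero (fun y => by positivity) (fun y => ?_) h3
    rcases eq_or_ne y 0 with rfl | hy
    · simp
    have : 0 < ‖y‖ := norm_pos_iff.2 hy
    have h5 : (‖y‖ ^ 2) ^ 2 ≤ (1 + ‖y‖ ^ 2) ^ 2 := by gcongr; linarith
    calc ‖y‖ ^ 2 * (logMass⁻¹ * (2 / (1 + ‖y‖ ^ 2) ^ 2))
        ≤ ‖y‖ ^ 2 * (logMass⁻¹ * (2 / (‖y‖ ^ 2) ^ 2)) := by gcongr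
      _ = _ := by field_simp

lemma lapC_logPot {f : ℂ → ℂ} (hf : ContDiff ℝ 2 f) (hs : ∀ y, f y ≠ 0 → ‖y‖ < 3) {x : ℂ}
    (hx : ‖x‖ < 2) : lapC (logPot f) x = logMass • f x := by
  have hfc : HasCompactSupport f := HasCompactSupport.intro (isCompact_closedBall (0 : ℂ) 3)
    fun y hy => by
      by_contra h
      exact hy (by simpa using (hs y h).le)
  have hI : ∀ᶠ s in 𝓝[>] (0 : ℝ), s ∈ Ioc (0 : ℝ) 1 := Ioc_mem_nhdsGT one_pos
  have hcont : Continuous (lapC f) := by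
    have h2 : ∀ v, Continuous fun y => fderiv ℝ (fun z => fderiv ℝ f z v) y v := fun v =>
      (contDiff_fderiv_apply_const (m := 0) (n := 1)
        (contDiff_fderiv_apply_const hf (by norm_num) v) (by norm_num) v).continuous
    exact (h2 1).add (h2 Complex.I)
  have hsupp : HasCompactSupport (lapC f) :=
    ((hfc.fderiv_apply (𝕜 := ℝ) 1).fderiv_apply (𝕜 := ℝ) 1).add
      ((hfc.fderiv_apply (𝕜 := ℝ) Complex.I).fderiv_apply (𝕜 := ℝ) Complex.I)
  obtain ⟨C, hC⟩ := hsupp.exists_bound_of_continuous hcont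
  let K : ℝ → ℂ → ℝ := fun s => logKer (min s 1)
  have hKt : Tendsto (fun s => ∫ y, ‖K s y - K 0 y‖) (𝓝[>] 0) (𝓝 0) := by
    refine tendsto_integral_logKer_sub.congr' ?_
    filter_upwards [hI] with s hs
    simp [K, min_eq_left hs.2]
  have h1 := (tendstoUniformly_convolution_of_tendsto_integral
    ((ContinuousLinearMap.lsmul ℝ ℝ : ℝ →L[ℝ] ℂ →L[ℝ] ℂ)) (K := K) hcont hC
    (fun s hs => integrable_logKer (le_min hs zero_le_one) (min_le_right _ _))
    (hI.mono fun s hs => hs.1.le) hKt).tendsto_at x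
  have hK0 : K 0 = logKer 0 := by simp [K]
  rw [hK0, ← lapC_convolution (integrable_logKer le_rfl zero_le_one) hf hfc x] at h1
  refine tendsto_nhds_unique h1 ((tendsto_lapR_logKer_convolution hf.continuous hs hx).congr' ?_)
  filter_upwards [hI] with s hs
  have hs' : min s 1 = s := min_eq_left hs.2
  simp only [K, hs']
  rw [← lapC_convolution_left (contDiff_infty.1 (contDiff_logKer hs.1) 2)
    (hasCompactSupport_logKer s) hf.continuous x,
    lapC_convolution (integrable_logKer hs.1.le hs.2) hf hfc x]

lemma lapC_const_smul {u : ℂ → ℂ} (hu : ContDiff ℝ 2 u) (c : ℝ) (x : ℂ) :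
    lapC (fun y => c • u y) x = c • lapC u x := by
  have h1 : ∀ v y, fderiv ℝ (fun y => c • u y) y v = c • fderiv ℝ u y v := fun v y => by
    rw [fderiv_fun_const_smul (hu.differentiable (by norm_num) y)]; rfl
  have h2 : ∀ v, fderiv ℝ (fun y => c • fderiv ℝ u y v) x v = c • fderiv ℝ (fun y => fderiv ℝ u y v) x v :=
    fun v => by
      rw [fderiv_fun_const_smul]
      · rfl
      · exact (contDiff_fderiv_apply_const (m := 1) hu (by norm_num) v).differentiable
          (by norm_num) x
  simp only [lapC, h1, h2, smul_add]

lemma lapC_add {u w : ℂ → ℂ} (hu : ContDiff ℝ 2 u) (hw : ContDiff ℝ 2 w) (x : ℂ) :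
    lapC (fun y => u y + w y) x = lapC u x + lapC w x := by
  have h1 : ∀ v y, fderiv ℝ (fun y => u y + w y) y v = fderiv ℝ u y v + fderiv ℝ w y v := fun v y => by
    rw [fderiv_fun_add (hu.differentiable (by norm_num) y) (hw.differentiable (by norm_num) y)]; rfl
  have h2 : ∀ v, fderiv ℝ (fun y => fderiv ℝ u y v + fderiv ℝ w y v) x v =
      fderiv ℝ (fun y => fderiv ℝ u y v) x v + fderiv ℝ (fun y => fderiv ℝ w y v) x v :=
    fun v => by
      rw [fderiv_fun_add]
      · rfl
      · exact (contDiff_fderiv_apply_const (m := 1) hu (by norm_num) v).differentiable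
          (by norm_num) x
      · exact (contDiff_fderiv_apply_const (m := 1) hw (by norm_num) v).differentiable
          (by norm_num) x
  simp only [lapC, h1, h2]
  ring

lemma contDiff_lapC {u : ℂ → ℂ} {n : ℕ∞} (hu : ContDiff ℝ ∞ u) : ContDiff ℝ n (lapC u) := by
  have h2 : ∀ v, ContDiff ℝ ∞ fun y => fderiv ℝ (fun z => fderiv ℝ u z v) y v := fun v =>
    contDiff_fderiv_apply_const (n := ∞)
      (contDiff_fderiv_apply_const (m := ∞) (n := ∞) hu (by rfl) v) (by rfl) v
  exact ((h2 1).add (h2 Complex.I)).of_le (WithTop.coe_le_coe.2 le_top)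

lemma exists_potential : ∃ (N : (ℂ → ℂ) → ℂ → ℂ) (C : ℝ), 0 < C ∧
    (∀ (f : ℂ → ℂ) (n : ℕ), ContDiff ℝ n f → HasCompactSupport f → ContDiff ℝ (n + 1) (N f)) ∧
    (∀ f : ℂ → ℂ, ContDiff ℝ 2 f → (∀ y, f y ≠ 0 → ‖y‖ < 3) → ∀ x : ℂ, ‖x‖ < 2 →
      lapC (N f) x = f x) ∧
    (∀ (f g : ℂ → ℂ) (B : ℝ), Continuous f → HasCompactSupport f → Continuous g →
      HasCompactSupport g → (∀ x, ‖f x - g x‖ ≤ B) → ∀ x, ‖N f x - N g x‖ ≤ C * B) ∧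
    ∀ x, N (fun _ => 0) x = 0 := by
  obtain ⟨C, hC0, hC⟩ := norm_logPot_le
  have hM := logMass_pos
  refine ⟨fun f x => logMass⁻¹ • logPot f x, logMass⁻¹ * (C + 1), by positivity, ?_, ?_, ?_, ?_⟩
  · intro f n hf hfc
    exact (contDiff_logPot hf hfc).const_smul logMass⁻¹
  · intro f hf hs x hx
    have hfc : HasCompactSupport f := HasCompactSupport.intro (isCompact_closedBall (0 : ℂ) 3)
      fun y hy => by
        by_contra h
        exact hy (by simpa using (hs y h).le)
    rw [lapC_const_smul, lapC_logPot hf hs hx, smul_smul, inv_mul_cancel₀ hM.ne', one_smul]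
    exact (contDiff_logPot (n := 2) hf hfc).of_le (by norm_num)
  · intro f g B hf hfc hg hgc hB x
    have hB0 : 0 ≤ B := (norm_nonneg _).trans (hB 0)
    rw [← smul_sub, logPot_sub hf hfc hg hgc, norm_smul, norm_inv, Real.norm_eq_abs,
      abs_of_pos hM, mul_assoc]
    gcongr
    exact (hC _ B hB x).trans (by nlinarith)
  · intro x
    have := hC (fun _ => 0) 0 (by simp) x
    have h0 : logPot (fun _ => 0) x = 0 := by simpa using this
    simp [h0]

/-- A smooth cutoff equal to one on the closed unit disc, supported in the disc of radius two. -/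
def discCutoff : ContDiffBump (0 : ℂ) := ⟨1, 2, by norm_num, by norm_num⟩

lemma norm_lt_two_of_discCutoff_ne_zero {y : ℂ} (h : discCutoff y ≠ 0) : ‖y‖ < 2 := by
  have : y ∈ Function.support discCutoff := h
  rw [discCutoff.support_eq] at this
  simpa [discCutoff] using this

lemma discCutoff_eq_one {y : ℂ} (h : ‖y‖ ≤ 1) : discCutoff y = 1 :=
  discCutoff.one_of_mem_closedBall (by simpa [discCutoff] using h)

theorem exists_exact_solution {V : ℂ → ℂ} (hV : ContDiff ℝ ∞ V) {L : ℝ}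
    (hL : ∀ a b, ‖V a - V b‖ ≤ L * ‖a - b‖) :
    ∃ C : ℝ, 0 < C ∧ ∀ (u : ℂ → ℂ) (l r : ℝ), ContDiff ℝ ∞ u → 0 ≤ l → l * C ≤ 1 →
      (∀ x, ‖x‖ ≤ 2 → ‖l • V (u x) - lapC u x‖ ≤ r) →
      ∃ w : ℂ → ℂ, ContDiff ℝ ∞ w ∧ (∀ x, ‖w x‖ ≤ C * r) ∧
        ∀ x, ‖x‖ < 1 → lapC (fun y => u y + w y) x = l • V (u x + w x) := by
  obtain ⟨N, C, hC, hN1, hN2, hN3, hN0⟩ := exists_potential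
  have hL0 : 0 ≤ L := by
    have := (norm_nonneg _).trans (hL 1 0)
    simpa using this
  refine ⟨2 * C + 2 * L * C, by positivity, fun u l r hu hl hlC hr => ?_⟩
  have hr0 : 0 ≤ r := (norm_nonneg _).trans (hr 0 (by simp))
  have hlL : l * (L * C) ≤ 1 / 2 := by nlinarith [mul_nonneg hl hC.le]
  have hcut : Continuous fun y => discCutoff y := discCutoff.continuous
  have hNc : ∀ f : ℂ → ℂ, Continuous f → Continuous (N fun y => discCutoff y • f y) := by
    intro f hf
    have := hN1 (fun y => discCutoff y • f y) 0
      (contDiff_zero.2 (hcut.smul hf)) discCutoff.hasCompactSupport.smul_right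
    exact this.continuous
  have hlap : Continuous (lapC u) := (contDiff_lapC (n := 0) hu).continuous
  let F0 : (ℂ → ℂ) → ℂ → ℂ := fun f x =>
    discCutoff x • (l • V (u x + N (fun y => discCutoff y • f y) x) - lapC u x)
  have hF0c : ∀ f : ℂ → ℂ, Continuous f → Continuous (F0 f) := by
    intro f hf
    exact hcut.smul (((hV.continuous.comp (hu.continuous.add (hNc f hf))).const_smul l).sub hlap)
  have hF0s : ∀ f : ℂ → ℂ, HasCompactSupport (F0 f) := fun f =>
    discCutoff.hasCompactSupport.smul_right
  let F : BoundedContinuousFunction ℂ ℂ → BoundedContinuousFunction ℂ ℂ := fun f =>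
    BoundedContinuousFunction.ofNormedAddCommGroup (F0 f) (hF0c f f.continuous)
      ((hF0s f).exists_bound_of_continuous (hF0c f f.continuous)).choose
      ((hF0s f).exists_bound_of_continuous (hF0c f f.continuous)).choose_spec
  have hcut1 : ∀ x, |discCutoff x| ≤ 1 := fun x => by
    rw [abs_of_nonneg discCutoff.nonneg]; exact discCutoff.le_one
  have hdist : ∀ (f g : ℂ → ℂ) (B : ℝ), Continuous f → Continuous g →
      (∀ x, ‖f x - g x‖ ≤ B) → ∀ x, ‖F0 f x - F0 g x‖ ≤ 1 / 2 * B := by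
    intro f g B hf hg hB x
    have hB0 : 0 ≤ B := (norm_nonneg _).trans (hB 0)
    have h1 := hN3 (fun y => discCutoff y • f y) (fun y => discCutoff y • g y) B
      (hcut.smul hf) discCutoff.hasCompactSupport.smul_right
      (hcut.smul hg) discCutoff.hasCompactSupport.smul_right (fun y => by
        rw [← smul_sub, norm_smul, Real.norm_eq_abs]
        calc _ ≤ 1 * B := by gcongr; exacts [hcut1 y, hB y]
          _ = B := one_mul B) x
    set p := N (fun y => discCutoff y • f y) x
    set q := N (fun y => discCutoff y • g y) x
    have e : F0 f x - F0 g x = discCutoff x • l • (V (u x + p) - V (u x + q)) := by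
      simp only [F0, p, q, ← smul_sub]; congr 1
      rw [smul_sub]; abel
    rw [e, norm_smul, norm_smul, Real.norm_eq_abs, Real.norm_eq_abs, abs_of_nonneg hl]
    calc |discCutoff x| * (l * ‖V (u x + p) - V (u x + q)‖)
        ≤ 1 * (l * (L * (C * B))) := by
          gcongr
          · exact hcut1 x
          · refine (hL _ _).trans ?_
            gcongr
            simpa using h1
      _ = l * (L * C) * B := by ring
      _ ≤ 1 / 2 * B := by gcongr
  have hcontr : ContractingWith (1 / 2) F := by
    refine ⟨by rw [← NNReal.coe_lt_coe]; norm_num, LipschitzWith.of_dist_le_mul fun f g => ?_⟩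
    refine (BoundedContinuousFunction.dist_le (by positivity)).2 fun x => ?_
    rw [dist_eq_norm]
    have := hdist f g (dist f g) f.continuous g.continuous
      (fun x => by rw [← dist_eq_norm]; exact BoundedContinuousFunction.dist_coe_le_dist x) x
    exact this.trans (by simp)
  set f := ContractingWith.fixedPoint F hcontr
  have hfix : F f = f := hcontr.fixedPoint_isFixedPt
  have hfx : ∀ x, f x = F0 f x := fun x => by
    conv_lhs => rw [← hfix]
    rfl
  have hF00 : ∀ x, ‖F0 (fun _ => 0) x‖ ≤ r := by
    intro x
    simp only [F0, smul_zero, hN0, add_zero]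
    rw [norm_smul, Real.norm_eq_abs]
    by_cases hx : discCutoff x = 0
    · simpa [hx] using hr0
    · calc _ ≤ 1 * r := by
            gcongr
            · exact hcut1 x
            · exact hr x (norm_lt_two_of_discCutoff_ne_zero hx).le
        _ = r := one_mul r
  have hnf : ‖f‖ ≤ 2 * r := by
    have : ‖f‖ ≤ 1 / 2 * ‖f‖ + r := by
      refine (BoundedContinuousFunction.norm_le (by positivity)).2 fun x => ?_
      have h1 := hdist f (fun _ => 0) ‖f‖ f.continuous continuous_const
        (fun x => by simpa using f.norm_coe_le_norm x) x
      rw [hfx x]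
      calc ‖F0 f x‖ ≤ ‖F0 f x - F0 (fun _ => 0) x‖ + ‖F0 (fun _ => 0) x‖ := by
            simpa using norm_add_le (F0 f x - F0 (fun _ => 0) x) (F0 (fun _ => 0) x)
        _ ≤ _ := add_le_add h1 (hF00 x)
    linarith
  have hsm : ∀ n : ℕ, ContDiff ℝ n f := by
    intro n
    induction n with
    | zero => exact contDiff_zero.2 f.continuous
    | succ n ih =>
      have h1 := hN1 (fun y => discCutoff y • f y) n (discCutoff.contDiff.smul ih)
        discCutoff.hasCompactSupport.smul_right
      have h2 : (f : ℂ → ℂ) = F0 f := funext hfx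
      rw [h2]
      push_cast
      have hV' : ContDiff ℝ (n + 1) V := by exact_mod_cast contDiff_infty.1 hV (n + 1)
      have hu' : ContDiff ℝ (n + 1) u := by exact_mod_cast contDiff_infty.1 hu (n + 1)
      have hlap' : ContDiff ℝ (n + 1) (lapC u) := by exact_mod_cast contDiff_lapC (n := n + 1) hu
      exact discCutoff.contDiff.smul (((hV'.comp (hu'.add h1)).const_smul l).sub hlap')
  have hw : ContDiff ℝ ∞ (N fun y => discCutoff y • f y) := by
    refine contDiff_infty.2 fun n => ?_
    exact (hN1 (fun y => discCutoff y • f y) n (discCutoff.contDiff.smul (hsm n))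
      discCutoff.hasCompactSupport.smul_right).of_le (by exact_mod_cast Nat.le_succ n)
  refine ⟨N fun y => discCutoff y • f y, hw, fun x => ?_, fun x hx => ?_⟩
  · have h1 := hN3 (fun y => discCutoff y • f y) (fun _ => 0) (2 * r)
      (hcut.smul f.continuous) discCutoff.hasCompactSupport.smul_right
      continuous_const HasCompactSupport.zero (fun y => by
        rw [sub_zero, norm_smul, Real.norm_eq_abs]
        calc _ ≤ 1 * (2 * r) := by
              gcongr
              exacts [hcut1 y, (f.norm_coe_le_norm y).trans hnf]
          _ = 2 * r := one_mul _) x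
    rw [hN0, sub_zero] at h1
    refine h1.trans ?_
    nlinarith [mul_nonneg (mul_nonneg hL0 hC.le) hr0]
  · rw [lapC_add (contDiff_infty.1 hu 2) (contDiff_infty.1 hw 2),
      hN2 (fun y => discCutoff y • f y) (discCutoff.contDiff.smul (hsm 2)) (fun y hy => ?_) x (by linarith)]
    · rw [hfx x]
      simp [F0, discCutoff_eq_one hx.le]
    · have : discCutoff y ≠ 0 := fun h => hy (by simp [h])
      linarith [norm_lt_two_of_discCutoff_ne_zero this]

/-- Normal coordinates along the curve `τ`. -/
def tubePt (τ : ℝ → ℂ) (s t : ℝ) : ℂ := τ s + (t : ℂ) * (Complex.I * deriv τ s)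

/-- The signed curvature of a unit speed curve. -/
def curv (τ : ℝ → ℂ) (s : ℝ) : ℝ := (conj (deriv τ s) * deriv (deriv τ) s).im

/-- The Jacobian of the normal coordinates. -/
def tubeJac (τ : ℝ → ℂ) (s t : ℝ) : ℝ := 1 - curv τ s * t

lemma contDiff_deriv_of_infty {F : Type*} [NormedAddCommGroup F] [NormedSpace ℝ F] {f : ℝ → F}
    (h : ContDiff ℝ ∞ f) : ContDiff ℝ ∞ (deriv f) := (contDiff_infty_iff_deriv.1 h).2

lemma ContDiff.hasDerivAt_of_infty {F : Type*} [NormedAddCommGroup F] [NormedSpace ℝ F] {f : ℝ → F}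
    (h : ContDiff ℝ ∞ f) (s : ℝ) : HasDerivAt f (deriv f s) s :=
  ((h.differentiable (by simp)) s).hasDerivAt

section Curve

variable {Γ : Set ℂ} {τ : ℝ → ℂ}

lemma contDiff_curv (hτ : ArcParam Γ τ) : ContDiff ℝ ∞ (curv τ) := by
  have h1 := contDiff_deriv_of_infty hτ.smooth
  have h2 := contDiff_deriv_of_infty h1
  exact Complex.imCLM.contDiff.comp ((Complex.conjCLE.contDiff.comp h1).mul h2)

lemma conj_mul_tangent (hτ : ArcParam Γ τ) (s : ℝ) : conj (deriv τ s) * deriv τ s = 1 := by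
  rw [mul_comm, Complex.mul_conj, Complex.normSq_eq_norm_sq, hτ.arclength]; simp

lemma deriv_tangent (hτ : ArcParam Γ τ) (s : ℝ) :
    deriv (deriv τ) s = Complex.I * curv τ s * deriv τ s := by
  have h1 := contDiff_deriv_of_infty hτ.smooth
  have hd := h1.hasDerivAt_of_infty s
  have h2 : HasDerivAt (fun s => conj (deriv τ s)) (conj (deriv (deriv τ) s)) s :=
    Complex.conjCLE.hasFDerivAt.comp_hasDerivAt s hd
  have h3 := h2.mul hd
  have h4 : (fun s => conj (deriv τ s)) * deriv τ = fun _ => (1 : ℂ) := by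
    ext1 s; exact conj_mul_tangent hτ s
  rw [h4] at h3
  have h5 := h3.unique (hasDerivAt_const s (1 : ℂ))
  have h6 : (conj (deriv τ s) * deriv (deriv τ) s).re = 0 := by
    have := congrArg Complex.re h5
    simp at this ⊢
    linarith
  have h7 : conj (deriv τ s) * deriv (deriv τ) s = Complex.I * curv τ s := by
    apply Complex.ext
    · rw [h6]; simp
    · simp [curv]
  calc deriv (deriv τ) s = (conj (deriv τ s) * deriv τ s) * deriv (deriv τ) s := by
        rw [conj_mul_tangent hτ]; ring
    _ = (conj (deriv τ s) * deriv (deriv τ) s) * deriv τ s := by ring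
    _ = _ := by rw [h7]

lemma hasDerivAt_tangent (hτ : ArcParam Γ τ) (s : ℝ) :
    HasDerivAt (deriv τ) (Complex.I * curv τ s * deriv τ s) s := by
  rw [← deriv_tangent hτ s]
  exact (contDiff_deriv_of_infty hτ.smooth).hasDerivAt_of_infty s

lemma hasDerivAt_tubePt_comp (hτ : ArcParam Γ τ) {p q : ℝ → ℝ} {a b x : ℝ}
    (hp : HasDerivAt p a x) (hq : HasDerivAt q b x) :
    HasDerivAt (fun y => tubePt τ (p y) (q y))
      (deriv τ (p x) * ((tubeJac τ (p x) (q x) * a : ℝ) + Complex.I * b)) x := by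
  have h1 : HasDerivAt (fun y => τ (p y)) (a • deriv τ (p x)) x :=
    (hτ.smooth.hasDerivAt_of_infty (p x)).scomp x hp
  have h2 : HasDerivAt (fun y => deriv τ (p y)) (a • (Complex.I * curv τ (p x) * deriv τ (p x))) x :=
    (hasDerivAt_tangent hτ (p x)).scomp x hp
  have h3 : HasDerivAt (fun y => (q y : ℂ)) (b : ℂ) x := hq.ofReal_comp
  refine (h1.add (h3.mul (h2.const_mul Complex.I))).congr_deriv ?_
  simp only [tubeJac, Complex.real_smul]
  push_cast
  linear_combination (-(a : ℂ) * q x * curv τ (p x) * deriv τ (p x)) * (-Complex.I_mul_I)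

lemma contDiff_tubePt (hτ : ArcParam Γ τ) : ContDiff ℝ ∞ fun z : ℝ × ℝ => tubePt τ z.1 z.2 := by
  have h1 := contDiff_deriv_of_infty hτ.smooth
  unfold tubePt
  exact (hτ.smooth.comp contDiff_fst).add
    ((Complex.ofRealCLM.contDiff.comp contDiff_snd).mul
      (contDiff_const.mul (h1.comp contDiff_fst)))

lemma hasDerivAt_line {E F : Type*} [NormedAddCommGroup E] [NormedSpace ℝ E]
    [NormedAddCommGroup F] [NormedSpace ℝ F] {f : E → F} {x : E} (hf : DifferentiableAt ℝ f x)
    (v : E) : HasDerivAt (fun r : ℝ => f (x + r • v)) (fderiv ℝ f x v) 0 := by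
  have h1 : HasDerivAt (fun r : ℝ => x + r • v) v 0 := by
    simpa using ((hasDerivAt_id (0 : ℝ)).smul_const v).const_add x
  have h2 : HasFDerivAt f (fderiv ℝ f x) (x + (0 : ℝ) • v) := by simpa using hf.hasFDerivAt
  exact h2.comp_hasDerivAt 0 h1

lemma differentiableAt_fderiv_apply {F : Type*} [NormedAddCommGroup F] [NormedSpace ℝ F]
    {p : ℂ → F} {x : ℂ} (hp : ContDiffAt ℝ 2 p x) (v : ℂ) :
    DifferentiableAt ℝ (fun y => fderiv ℝ p y v) x :=
  ((hp.fderiv_right (m := 1) (by norm_num)).differentiableAt (by norm_num)).clm_apply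
    (differentiableAt_const v)

lemma eventually_contDiffAt_two {F : Type*} [NormedAddCommGroup F] [NormedSpace ℝ F]
    {p : ℂ → F} {x : ℂ} (hp : ContDiffAt ℝ 2 p x) : ∀ᶠ y in 𝓝 x, ContDiffAt ℝ 2 p y :=
  hp.eventually (by simp)

lemma contDiffAt_tubePt_comp (hτ : ArcParam Γ τ) {p q : ℂ → ℝ} {x : ℂ} {n : ℕ∞}
    (hp : ContDiffAt ℝ n p x) (hq : ContDiffAt ℝ n q x) :
    ContDiffAt ℝ n (fun y => tubePt τ (p y) (q y)) x :=
  ((contDiff_tubePt hτ).of_le (WithTop.coe_le_coe.2 le_top)).contDiffAt.comp x (hp.prodMk hq)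

lemma fderiv_tubePt_comp (hτ : ArcParam Γ τ) {p q : ℂ → ℝ} {x : ℂ}
    (hp : ContDiffAt ℝ 2 p x) (hq : ContDiffAt ℝ 2 q x) (v : ℂ) :
    fderiv ℝ (fun y => tubePt τ (p y) (q y)) x v = deriv τ (p x) *
      ((tubeJac τ (p x) (q x) * fderiv ℝ p x v : ℝ) + Complex.I * (fderiv ℝ q x v : ℝ)) := by
  have h1 := hasDerivAt_line (hp.differentiableAt (by norm_num)) v
  have h2 := hasDerivAt_line (hq.differentiableAt (by norm_num)) v
  have h3 := hasDerivAt_tubePt_comp hτ h1 h2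
  have h4 := hasDerivAt_line
    ((contDiffAt_tubePt_comp (n := 2) hτ hp hq).differentiableAt (by norm_num)) v
  simpa using h4.unique h3

lemma hasDerivAt_tangent_mul (hτ : ArcParam Γ τ) {p q v w : ℝ → ℝ} {a b c d x : ℝ}
    (hp : HasDerivAt p a x) (hq : HasDerivAt q b x) (hv : HasDerivAt v c x)
    (hw : HasDerivAt w d x) :
    HasDerivAt (fun y => deriv τ (p y) *
        ((tubeJac τ (p y) (q y) * v y : ℝ) + Complex.I * (w y : ℝ)))
      (deriv τ (p x) * ((tubeJac τ (p x) (q x) * c - curv τ (p x) * (a * w x + b * v x)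
        - q x * deriv (curv τ) (p x) * (a * v x) : ℝ)
        + Complex.I * (d + curv τ (p x) * tubeJac τ (p x) (q x) * (a * v x) : ℝ))) x := by
  have h5 : HasDerivAt (fun y => deriv τ (p y))
      (a • (Complex.I * curv τ (p x) * deriv τ (p x))) x :=
    (hasDerivAt_tangent hτ (p x)).scomp x hp
  have h6 : HasDerivAt (fun y => curv τ (p y)) (deriv (curv τ) (p x) * a) x :=
    ((contDiff_curv hτ).hasDerivAt_of_infty (p x)).comp x hp
  have h7 := (((h6.mul hq).const_sub 1).mul hv).ofReal_comp.add (hw.ofReal_comp.const_mul Complex.I)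
  refine (h5.mul h7).congr_deriv ?_
  simp only [Pi.mul_apply, Pi.add_apply, tubeJac, Complex.real_smul]
  push_cast
  linear_combination (deriv τ (p x) * a * w x * curv τ (p x)) * Complex.I_mul_I

lemma fderiv_fderiv_tubePt_comp (hτ : ArcParam Γ τ) {p q : ℂ → ℝ} {x : ℂ}
    (hp : ContDiffAt ℝ 2 p x) (hq : ContDiffAt ℝ 2 q x) (v : ℂ) :
    fderiv ℝ (fun y => fderiv ℝ (fun y => tubePt τ (p y) (q y)) y v) x v = deriv τ (p x) *
      ((tubeJac τ (p x) (q x) * fderiv ℝ (fun y => fderiv ℝ p y v) x v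
        - 2 * curv τ (p x) * fderiv ℝ p x v * fderiv ℝ q x v
        - q x * deriv (curv τ) (p x) * fderiv ℝ p x v ^ 2 : ℝ)
      + Complex.I * (fderiv ℝ (fun y => fderiv ℝ q y v) x v
        + curv τ (p x) * tubeJac τ (p x) (q x) * fderiv ℝ p x v ^ 2 : ℝ)) := by
  have hev : (fun y => fderiv ℝ (fun y => tubePt τ (p y) (q y)) y v) =ᶠ[𝓝 x] fun y =>
      deriv τ (p y) * ((tubeJac τ (p y) (q y) * fderiv ℝ p y v : ℝ) +
        Complex.I * (fderiv ℝ q y v : ℝ)) := by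
    filter_upwards [eventually_contDiffAt_two hp, eventually_contDiffAt_two hq] with y h1 h2
      using fderiv_tubePt_comp hτ h1 h2 v
  have hu := hasDerivAt_line
    (differentiableAt_fderiv_apply (contDiffAt_tubePt_comp (n := 2) hτ hp hq) v) v
  have hline : Tendsto (fun r : ℝ => x + r • v) (𝓝 0) (𝓝 x) := by
    have : Continuous fun r : ℝ => x + r • v := by fun_prop
    simpa using this.tendsto 0
  have hu' := hu.congr_of_eventuallyEq (hline.eventually hev.symm)
  have h1 := hasDerivAt_line (hp.differentiableAt (by norm_num)) v
  have h2 := hasDerivAt_line (hq.differentiableAt (by norm_num)) v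
  have h3 := hasDerivAt_line (differentiableAt_fderiv_apply hp v) v
  have h4 := hasDerivAt_line (differentiableAt_fderiv_apply hq v) v
  have h9 := hu'.unique (hasDerivAt_tangent_mul hτ h1 h2 h3 h4)
  simpa only [zero_smul, add_zero, mul_assoc, mul_comm, sq, mul_left_comm, two_mul, mul_add] using h9

lemma lapC_tubePt_comp (hτ : ArcParam Γ τ) {p q : ℂ → ℝ} {x : ℂ}
    (hp : ContDiffAt ℝ 2 p x) (hq : ContDiffAt ℝ 2 q x) :
    lapC (fun y => tubePt τ (p y) (q y)) x = deriv τ (p x) *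
      ((tubeJac τ (p x) (q x) * lapR p x
        - 2 * curv τ (p x) * (fderiv ℝ p x 1 * fderiv ℝ q x 1 +
            fderiv ℝ p x Complex.I * fderiv ℝ q x Complex.I)
        - q x * deriv (curv τ) (p x) * (fderiv ℝ p x 1 ^ 2 + fderiv ℝ p x Complex.I ^ 2) : ℝ)
      + Complex.I * (lapR q x + curv τ (p x) * tubeJac τ (p x) (q x) *
          (fderiv ℝ p x 1 ^ 2 + fderiv ℝ p x Complex.I ^ 2) : ℝ)) := by
  unfold lapC lapR
  rw [fderiv_fderiv_tubePt_comp hτ hp hq, fderiv_fderiv_tubePt_comp hτ hp hq]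
  push_cast
  ring

end Curve

lemma deriv_deriv_nonneg_of_isLocalMin {f : ℝ → ℝ} {x : ℝ} (hf : ContinuousAt f x)
    (hmin : IsLocalMin f x) : 0 ≤ deriv (deriv f) x := by
  by_contra! h
  have hmax := isLocalMax_of_deriv_deriv_neg h hmin.deriv_eq_zero hf
  have heq : f =ᶠ[𝓝 x] fun _ => f x := by
    filter_upwards [hmin, hmax] with y h1 h2 using le_antisymm h2 h1
  have h2 : deriv (deriv f) x = deriv (deriv fun _ => f x) x := heq.deriv.deriv_eq
  simp at h2
  exact h.ne h2

section Curve

variable {Γ : Set ℂ} {τ : ℝ → ℂ}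

lemma ArcParam.mem (hτ : ArcParam Γ τ) (s : ℝ) : τ s ∈ Γ := hτ.srange ▸ mem_range_self s

lemma ArcParam.isCompact (hτ : ArcParam Γ τ) : IsCompact Γ := by
  rw [← hτ.srange, ← hτ.periodic.image_Icc Real.two_pi_pos 0]
  exact isCompact_Icc.image hτ.smooth.continuous

lemma ArcParam.exists_nearest (hτ : ArcParam Γ τ) (s₀ : ℝ) (z : ℂ) :
    ∃ s ∈ Icc (s₀ - Real.pi) (s₀ + Real.pi), infDist z Γ = ‖τ s - z‖ := by
  obtain ⟨y, hy, h⟩ := hτ.isCompact.exists_infDist_eq_dist ⟨_, hτ.mem 0⟩ z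
  rw [← hτ.srange] at hy
  obtain ⟨s', rfl⟩ := hy
  obtain ⟨s, hs, hss⟩ := hτ.periodic.exists_mem_Ico Real.two_pi_pos s' (s₀ - Real.pi)
  refine ⟨s, ⟨hs.1, by linarith [hs.2]⟩, ?_⟩
  rw [h, hss, dist_comm, dist_eq_norm]

lemma ArcParam.infDist_le (hτ : ArcParam Γ τ) (s : ℝ) (z : ℂ) : infDist z Γ ≤ ‖τ s - z‖ := by
  rw [← dist_eq_norm, dist_comm]
  exact infDist_le_dist_of_mem (hτ.mem s)

lemma norm_tubePt_sub (hτ : ArcParam Γ τ) (s t : ℝ) : ‖τ s - tubePt τ s t‖ = |t| := by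
  simp [tubePt, hτ.arclength]

lemma hasDerivAt_normSq_curve (hτ : ArcParam Γ τ) (z : ℂ) (s : ℝ) :
    HasDerivAt (fun s => normSq (τ s - z)) (2 * (conj (deriv τ s) * (τ s - z)).re) s := by
  have h1 := (hτ.smooth.hasDerivAt_of_infty s).sub_const z
  have hre : HasDerivAt (fun s => (τ s - z).re) (deriv τ s).re s :=
    Complex.reCLM.hasFDerivAt.comp_hasDerivAt s h1
  have him : HasDerivAt (fun s => (τ s - z).im) (deriv τ s).im s :=
    Complex.imCLM.hasFDerivAt.comp_hasDerivAt s h1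
  refine ((hre.mul hre).add (him.mul him)).congr_deriv ?_
  simp [Complex.mul_re]
  ring

/-- Second order condition at a nearest point. -/
lemma curv_mul_le_one (hτ : ArcParam Γ τ) {s t : ℝ} (h : infDist (tubePt τ s t) Γ = |t|) :
    curv τ s * t ≤ 1 := by
  set y := tubePt τ s t with hy
  have hmin : IsLocalMin (fun s => normSq (τ s - y)) s := by
    refine Filter.Eventually.of_forall fun s' => ?_
    simp only [Complex.normSq_eq_norm_sq]
    have := hτ.infDist_le s' y
    rw [h, ← norm_tubePt_sub hτ s t] at this
    gcongr
  have h1 := deriv_deriv_nonneg_of_isLocalMin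
    (hasDerivAt_normSq_curve hτ y s).continuousAt hmin
  have h2 : deriv (fun s => normSq (τ s - y)) = fun s => 2 * (conj (deriv τ s) * (τ s - y)).re :=
    funext fun s => (hasDerivAt_normSq_curve hτ y s).deriv
  have h3 : HasDerivAt (fun s => conj (deriv τ s) * (τ s - y))
      (conj (Complex.I * curv τ s * deriv τ s) * (τ s - y) + conj (deriv τ s) * deriv τ s) s :=
    (Complex.conjCLE.hasFDerivAt.comp_hasDerivAt s (hasDerivAt_tangent hτ s)).mul
      ((hτ.smooth.hasDerivAt_of_infty s).sub_const y)
  have h4 : HasDerivAt (fun s => 2 * (conj (deriv τ s) * (τ s - y)).re)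
      (2 * (conj (Complex.I * curv τ s * deriv τ s) * (τ s - y) +
        conj (deriv τ s) * deriv τ s).re) s :=
    (Complex.reCLM.hasFDerivAt.comp_hasDerivAt s h3).const_mul 2
  rw [h2, h4.deriv] at h1
  have h5 : conj (Complex.I * curv τ s * deriv τ s) * (τ s - y) + conj (deriv τ s) * deriv τ s =
      ((1 - curv τ s * t : ℝ) : ℂ) := by
    have := conj_mul_tangent hτ s
    simp only [hy, tubePt, map_mul, Complex.conj_I, Complex.conj_ofReal]
    push_cast
    linear_combination (1 + Complex.I ^ 2 * curv τ s * t) * this + (curv τ s * t) * Complex.I_sq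
  rw [h5, Complex.ofReal_re] at h1
  linarith

/-- First order condition at a nearest point. -/
lemma tubePt_of_nearest (hτ : ArcParam Γ τ) {s : ℝ} {z : ℂ} (h : infDist z Γ = ‖τ s - z‖) :
    tubePt τ s (conj (Complex.I * deriv τ s) * (z - τ s)).re = z := by
  have hmin : IsLocalMin (fun s => normSq (τ s - z)) s := by
    refine Filter.Eventually.of_forall fun s' => ?_
    simp only [Complex.normSq_eq_norm_sq]
    have := hτ.infDist_le s' z
    rw [h] at this
    gcongr
  have h1 := hmin.hasDerivAt_eq_zero (hasDerivAt_normSq_curve hτ z s)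
  have h2 : conj (Complex.I * deriv τ s) * (z - τ s) =
      ((conj (Complex.I * deriv τ s) * (z - τ s)).re : ℂ) := by
    apply Complex.ext
    · simp
    · simp at h1 ⊢
      linarith
  have h3 := conj_mul_tangent hτ s
  unfold tubePt
  rw [← h2, map_mul, Complex.conj_I]
  linear_combination (z - τ s) * h3 - conj (deriv τ s) * (z - τ s) * deriv τ s * Complex.I_sq

lemma fderiv_tubePt (hτ : ArcParam Γ τ) (s t a b : ℝ) :
    fderiv ℝ (fun z : ℝ × ℝ => tubePt τ z.1 z.2) (s, t) (a, b) =
      deriv τ s * ((tubeJac τ s t * a : ℝ) + Complex.I * b) := by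
  have h1 := hasDerivAt_line (f := fun z : ℝ × ℝ => tubePt τ z.1 z.2) (x := (s, t))
    (((contDiff_tubePt hτ).differentiable (by simp)) _) (a, b)
  have h2 : HasDerivAt (fun r : ℝ => s + r * a) a 0 := by
    simpa using ((hasDerivAt_id (0 : ℝ)).mul_const a).const_add s
  have h3 : HasDerivAt (fun r : ℝ => t + r * b) b 0 := by
    simpa using ((hasDerivAt_id (0 : ℝ)).mul_const b).const_add t
  simpa using h1.unique (hasDerivAt_tubePt_comp hτ h2 h3)

/-- Normal coordinates are invertible near points of nonzero Jacobian. -/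
lemma exists_tubePt_inverse (hτ : ArcParam Γ τ) {s t : ℝ} (h : tubeJac τ s t ≠ 0) :
    ∃ G : ℂ → ℝ × ℝ, ContDiffAt ℝ ∞ G (tubePt τ s t) ∧ G (tubePt τ s t) = (s, t) ∧
      (∀ᶠ p in 𝓝 (s, t), G (tubePt τ p.1 p.2) = p) ∧
      ∀ᶠ z in 𝓝 (tubePt τ s t), tubePt τ (G z).1 (G z).2 = z := by
  set F : ℝ × ℝ → ℂ := fun z => tubePt τ z.1 z.2 with hF
  have hc : ContDiffAt ℝ ∞ F (s, t) := (contDiff_tubePt hτ).contDiffAt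
  have hT := conj_mul_tangent hτ s
  set A : ℂ →L[ℝ] ℂ := (ContinuousLinearMap.mul ℝ ℂ (conj (deriv τ s))) with hA
  set inv : ℂ →L[ℝ] ℝ × ℝ :=
    (((tubeJac τ s t)⁻¹ • Complex.reCLM.comp A).prod (Complex.imCLM.comp A)) with hinv
  have hder : ∀ p : ℝ × ℝ, fderiv ℝ F (s, t) p =
      deriv τ s * ((tubeJac τ s t * p.1 : ℝ) + Complex.I * p.2) :=
    fun p => fderiv_tubePt hτ s t p.1 p.2
  have hl : Function.LeftInverse inv (fderiv ℝ F (s, t)) := by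
    intro p
    have : A (fderiv ℝ F (s, t) p) = ((tubeJac τ s t * p.1 : ℝ) + Complex.I * p.2) := by
      rw [hder, hA]
      simp only [ContinuousLinearMap.mul_apply']
      rw [← mul_assoc, hT, one_mul]
    apply Prod.ext
    · simp [hinv, this, h]
    · simp [hinv, this]
  have hr : Function.RightInverse inv (fderiv ℝ F (s, t)) := by
    intro z
    have e1 : (tubeJac τ s t * (inv z).1 : ℝ) = (A z).re := by
      simp [hinv, h]
    have e2 : (inv z).2 = (A z).im := by simp [hinv]
    rw [hder, e1, e2, mul_comm Complex.I, Complex.re_add_im, hA]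
    simp only [ContinuousLinearMap.mul_apply']
    rw [← mul_assoc, mul_comm (deriv τ s), hT, one_mul]
  have hd : HasFDerivAt F
      ((ContinuousLinearEquiv.equivOfInverse (fderiv ℝ F (s, t)) inv hl hr :
        (ℝ × ℝ) ≃L[ℝ] ℂ) : (ℝ × ℝ) →L[ℝ] ℂ) (s, t) :=
    (hc.differentiableAt (by simp)).hasFDerivAt
  have hst := hc.hasStrictFDerivAt' hd (by simp)
  exact ⟨hc.localInverse hd (by simp), hc.to_localInverse hd (by simp),
    hc.localInverse_apply_image hd (by simp), hst.eventually_left_inverse,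
    hst.eventually_right_inverse⟩

lemma nearest_unique_of_lt (hτ : ArcParam Γ τ) {s t θ : ℝ} (h : infDist (tubePt τ s t) Γ = |t|)
    (hθ : 0 ≤ θ) (s' : ℝ) :
    (1 - θ) * ‖τ s' - τ s‖ ^ 2 + (θ * t) ^ 2 ≤ ‖τ s' - tubePt τ s (θ * t)‖ ^ 2 := by
  have h1 := hτ.infDist_le s' (tubePt τ s t)
  rw [h] at h1
  have h2 : t ^ 2 ≤ ‖τ s' - tubePt τ s t‖ ^ 2 := by
    rw [← sq_abs t]; gcongr
  have h3 := norm_tubePt_sub hτ s t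
  have h4 : t ^ 2 = normSq (τ s - tubePt τ s t) := by
    rw [Complex.normSq_eq_norm_sq, h3, sq_abs]
  simp only [← Complex.normSq_eq_norm_sq] at *
  have key : normSq (τ s' - tubePt τ s (θ * t)) = (1 - θ) * normSq (τ s' - τ s)
      + θ * normSq (τ s' - tubePt τ s t) - θ * (1 - θ) * normSq (τ s - tubePt τ s t) := by
    simp only [tubePt, Complex.normSq_apply]
    simp
    ring
  rw [key, ← h4]
  nlinarith

lemma infDist_tubePt_smul (hτ : ArcParam Γ τ) {s t θ : ℝ} (h : infDist (tubePt τ s t) Γ = |t|)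
    (hθ : 0 ≤ θ) (hθ1 : θ ≤ 1) : infDist (tubePt τ s (θ * t)) Γ = |θ * t| := by
  apply le_antisymm
  · rw [← norm_tubePt_sub hτ s]; exact hτ.infDist_le _ _
  · obtain ⟨s', -, hs'⟩ := hτ.exists_nearest 0 (tubePt τ s (θ * t))
    rw [hs']
    refine abs_le_of_sq_le_sq ?_ (norm_nonneg _)
    have := nearest_unique_of_lt hτ h hθ s'
    nlinarith [sq_nonneg ‖τ s' - τ s‖]

/-- Near an interior point of a normal segment, the nearest point projection stays close. -/
lemma eventually_exists_normal_coord (hτ : ArcParam Γ τ) {s t θ : ℝ}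
    (h : infDist (tubePt τ s t) Γ = |t|) (hθ : 0 ≤ θ) (hθ1 : θ < 1) {U : Set (ℝ × ℝ)}
    (hU : U ∈ 𝓝 (s, θ * t)) :
    ∀ᶠ z in 𝓝 (tubePt τ s (θ * t)), ∃ p ∈ U, tubePt τ p.1 p.2 = z ∧ |p.2| = infDist z Γ := by
  set z₀ := tubePt τ s (θ * t) with hz₀
  set N : ℂ × ℝ → ℝ × ℝ :=
    fun w => (w.2, (conj (Complex.I * deriv τ w.2) * (w.1 - τ w.2)).re) with hN
  have hNc : Continuous N := by
    have h1 := (contDiff_deriv_of_infty hτ.smooth).continuous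
    have h2 := hτ.smooth.continuous
    refine continuous_snd.prodMk (Complex.continuous_re.comp ?_)
    exact (Complex.continuous_conj.comp (continuous_const.mul (h1.comp continuous_snd))).mul
      (continuous_fst.sub (h2.comp continuous_snd))
  have hN0 : N (z₀, s) = (s, θ * t) := by
    have h3 := conj_mul_tangent hτ s
    have e : conj (Complex.I * deriv τ s) * (z₀ - τ s) = ((θ * t : ℝ) : ℂ) := by
      simp only [hz₀, tubePt, map_mul, Complex.conj_I]
      linear_combination ((θ * t : ℝ) : ℂ) * h3 -
        (conj (deriv τ s) * deriv τ s * (θ * t : ℝ)) * Complex.I_sq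
    simp only [hN, e, Complex.ofReal_re]
  have hpre : N ⁻¹' U ∈ 𝓝 (z₀, s) := hNc.continuousAt.preimage_mem_nhds (by rwa [hN0])
  rw [nhds_prod_eq, Filter.mem_prod_iff] at hpre
  obtain ⟨A, hA, B, hB, hAB⟩ := hpre
  obtain ⟨η, hη, hηB⟩ := Metric.mem_nhds_iff.1 hB
  set K : Set ℝ := Icc (s - Real.pi) (s + Real.pi) \ ball s η with hK
  have hKc : IsCompact K := isCompact_Icc.diff isOpen_ball
  have hgap : ∀ s' ∈ K, infDist z₀ Γ < ‖τ s' - z₀‖ := by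
    intro s' hs'
    rw [infDist_tubePt_smul hτ h hθ hθ1.le]
    apply abs_lt_of_sq_lt_sq _ (norm_nonneg _)
    have hne : τ s' ≠ τ s := by
      intro he
      obtain ⟨k, hk⟩ := hτ.inj _ _ he
      have h1 : |(k : ℝ)| < 1 := by
        have := hs'.1
        have h2 : |2 * Real.pi * k| ≤ Real.pi := by
          rw [← hk, abs_le]; constructor <;> linarith [this.1, this.2]
        rw [abs_mul, abs_of_pos Real.two_pi_pos] at h2
        nlinarith [Real.pi_pos]
      have hk0 : k = 0 := by
        rw [← Int.cast_abs] at h1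
        have : |k| < 1 := by exact_mod_cast h1
        exact Int.abs_lt_one_iff.1 this
      apply hs'.2
      rw [hk0] at hk
      simp at hk
      rw [mem_ball, Real.dist_eq, hk]
      simpa using hη
    have h5 : 0 < ‖τ s' - τ s‖ := norm_pos_iff.2 (sub_ne_zero.2 hne)
    have h6 := nearest_unique_of_lt hτ h hθ s'
    have h7 : 0 < (1 - θ) * ‖τ s' - τ s‖ ^ 2 := mul_pos (by linarith) (by positivity)
    linarith
  have hev : ∀ᶠ z in 𝓝 z₀, ∀ s' ∈ K, infDist z Γ < ‖τ s' - z‖ := by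
    apply hKc.eventually_forall_of_forall_eventually
    intro s' hs'
    have c1 : Continuous fun w : ℂ × ℝ => infDist w.1 Γ :=
      (continuous_infDist_pt Γ).comp continuous_fst
    have c2 : Continuous fun w : ℂ × ℝ => ‖τ w.2 - w.1‖ :=
      ((hτ.smooth.continuous.comp continuous_snd).sub continuous_fst).norm
    exact (isOpen_lt c1 c2).mem_nhds (hgap s' hs')
  filter_upwards [hev, hA] with z hz hzA
  obtain ⟨s', hs', hd⟩ := hτ.exists_nearest s z
  have hs'B : s' ∈ B := by
    by_contra hcon
    exact (hz s' ⟨hs', fun hb => hcon (hηB hb)⟩).ne hd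
  have hp := tubePt_of_nearest hτ hd
  refine ⟨N (z, s'), hAB (mk_mem_prod hzA hs'B), hp, ?_⟩
  rw [hd, ← norm_tubePt_sub hτ s']
  change ‖τ s' - tubePt τ s' (conj (Complex.I * deriv τ s') * (z - τ s')).re‖ = _
  rw [hp]

lemma tubeJac_pos_of_lt (hτ : ArcParam Γ τ) {s t θ : ℝ}
    (h : infDist (tubePt τ s t) Γ = |t|) (hθ : 0 ≤ θ) (hθ1 : θ < 1) :
    0 < tubeJac τ s (θ * t) := by
  have := curv_mul_le_one hτ h
  unfold tubeJac
  nlinarith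

end Curve

/-- The consequence of the maximum principle for the phase used below: `φ + m t² / 2` is
maximal on the boundary of the unit disc. -/
def HalfMax (Γ : Set ℂ) (τ : ℝ → ℂ) (W : ℂ → ℝ) (δ₁ m : ℝ) : Prop :=
  ∀ (ε : ℝ) (u : ℂ → ℂ) (t φ : ℂ → ℝ), 0 < ε → ContDiff ℝ ∞ u →
    (∀ x : ℂ, ‖x‖ < 1 → lapC u x = (ε ^ 2)⁻¹ • gradW W (u x)) →
    (∀ x ∈ closedBall (0 : ℂ) 1, infDist (u x) Γ ≤ δ₁) →
    PhaseDecomp Γ τ (closedBall 0 1) u t φ →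
    ∃ x : ℂ, ‖x‖ = 1 ∧ φ 0 + m * t 0 ^ 2 / 2 ≤ φ x + m * t x ^ 2 / 2

/-- The gradient of `W` in the moving frame of the curve. -/
def frameGrad (τ : ℝ → ℂ) (W : ℂ → ℝ) (s t : ℝ) : ℂ :=
  conj (deriv τ s) * gradW W (tubePt τ s t)

/-- The quadratic form controlling the Laplacian of `φ + m t² / 2`. -/
def phaseForm (τ : ℝ → ℂ) (W : ℂ → ℝ) (m β k s t : ℝ) : ℝ :=
  β ^ 2 * (m * tubeJac τ s t - 2 * curv τ s * m * t + deriv (curv τ) s * m ^ 2 * t ^ 3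
    - curv τ s * tubeJac τ s t ^ 2 * m ^ 3 * t ^ 3)
  + k * ((frameGrad τ W s t).re + m * t * tubeJac τ s t * (frameGrad τ W s t).im)

/-- Diagonal quadratic polynomials on the plane. -/
def quadFn (s c A B : ℝ) (x : ℂ) : ℝ := s + c * x.re + (A * x.re ^ 2 + B * x.im ^ 2)

lemma hasFDerivAt_quadFn (s c A B : ℝ) (x : ℂ) :
    HasFDerivAt (quadFn s c A B)
      ((c + 2 * A * x.re) • Complex.reCLM + (2 * B * x.im) • Complex.imCLM) x := by
  have h1 : HasFDerivAt (fun y : ℂ => y.re) Complex.reCLM x := Complex.reCLM.hasFDerivAt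
  have h2 : HasFDerivAt (fun y : ℂ => y.im) Complex.imCLM x := Complex.imCLM.hasFDerivAt
  refine (((h1.const_mul c).const_add s).add
    (((h1.pow 2).const_mul A).add ((h2.pow 2).const_mul B))).congr_fderiv ?_
  ext; simp; ring

lemma contDiff_quadFn (s c A B : ℝ) {n : WithTop ℕ∞} : ContDiff ℝ n (quadFn s c A B) := by
  have h1 : ContDiff ℝ n (fun y : ℂ => y.re) := Complex.reCLM.contDiff
  have h2 : ContDiff ℝ n (fun y : ℂ => y.im) := Complex.imCLM.contDiff
  exact (contDiff_const.add (contDiff_const.mul h1)).add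
    ((contDiff_const.mul (h1.pow 2)).add (contDiff_const.mul (h2.pow 2)))

lemma fderiv_quadFn_one (s c A B : ℝ) (x : ℂ) :
    fderiv ℝ (quadFn s c A B) x 1 = c + 2 * A * x.re := by
  simp [(hasFDerivAt_quadFn s c A B x).fderiv]

lemma fderiv_quadFn_I (s c A B : ℝ) (x : ℂ) :
    fderiv ℝ (quadFn s c A B) x Complex.I = 2 * B * x.im := by
  simp [(hasFDerivAt_quadFn s c A B x).fderiv]

lemma lapR_quadFn (s c A B : ℝ) (x : ℂ) : lapR (quadFn s c A B) x = 2 * (A + B) := by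
  have h1 : HasFDerivAt (fun y : ℂ => c + 2 * A * y.re) ((2 * A) • Complex.reCLM) x :=
    ((Complex.reCLM.hasFDerivAt (x := x)).const_mul (2 * A)).const_add c
  have h2 : HasFDerivAt (fun y : ℂ => 2 * B * y.im) ((2 * B) • Complex.imCLM) x :=
    (Complex.imCLM.hasFDerivAt (x := x)).const_mul (2 * B)
  unfold lapR
  simp only [fderiv_quadFn_one, fderiv_quadFn_I, h1.fderiv, h2.fderiv]
  simp
  ring

lemma contDiff_gradW {W : ℂ → ℝ} (hW : ContDiff ℝ ∞ W) : ContDiff ℝ ∞ (gradW W) := by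
  have h1 := contDiff_fderiv_apply_const (n := ∞) (m := ∞) hW (by rfl) 1
  have h2 := contDiff_fderiv_apply_const (n := ∞) (m := ∞) hW (by rfl) Complex.I
  exact (Complex.ofRealCLM.contDiff.comp h1).add
    ((Complex.ofRealCLM.contDiff.comp h2).mul contDiff_const)

lemma exists_lipschitz_eqOn_ball {V₀ : ℂ → ℂ} (hV : ContDiff ℝ ∞ V₀) (z : ℂ) :
    ∃ V : ℂ → ℂ, ContDiff ℝ ∞ V ∧ (∃ L : ℝ, ∀ a b, ‖V a - V b‖ ≤ L * ‖a - b‖) ∧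
      ∀ y ∈ ball z 1, V y = V₀ y := by
  let χ : ContDiffBump z := ⟨1, 2, one_pos, one_lt_two⟩
  have h1 : ContDiff ℝ ∞ fun y => χ y • V₀ y := χ.contDiff.smul hV
  have h2 : HasCompactSupport fun y => χ y • V₀ y := χ.hasCompactSupport.smul_right
  obtain ⟨L, hL⟩ := ContDiff.lipschitzWith_of_hasCompactSupport h2 h1 (by simp)
  refine ⟨_, h1, ⟨L, fun a b => ?_⟩, fun y hy => ?_⟩
  · simpa [dist_eq_norm] using hL.dist_le_mul a b
  · simp only [χ.one_of_mem_closedBall (ball_subset_closedBall hy), one_smul]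

section Curve

variable {Γ : Set ℂ} {τ : ℝ → ℂ}

/-- The rescaled Laplacian of a quadratic perturbation in normal coordinates. -/
def scaledLap (τ : ℝ → ℂ) (s t α β A B E : ℝ) (w : ℝ × ℂ) : ℂ :=
  deriv τ (quadFn s (w.1 * α) (w.1 ^ 2 * A) (w.1 ^ 2 * B) w.2) *
    ((tubeJac τ (quadFn s (w.1 * α) (w.1 ^ 2 * A) (w.1 ^ 2 * B) w.2)
          (quadFn t (w.1 * β) (w.1 ^ 2 * E) (w.1 ^ 2 * E) w.2) * (2 * (A + B))
        - 2 * curv τ (quadFn s (w.1 * α) (w.1 ^ 2 * A) (w.1 ^ 2 * B) w.2) *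
          ((α + 2 * w.1 * A * w.2.re) * (β + 2 * w.1 * E * w.2.re)
            + 4 * w.1 ^ 2 * B * E * w.2.im ^ 2)
        - quadFn t (w.1 * β) (w.1 ^ 2 * E) (w.1 ^ 2 * E) w.2 *
          deriv (curv τ) (quadFn s (w.1 * α) (w.1 ^ 2 * A) (w.1 ^ 2 * B) w.2) *
          ((α + 2 * w.1 * A * w.2.re) ^ 2 + 4 * w.1 ^ 2 * B ^ 2 * w.2.im ^ 2) : ℝ)
      + Complex.I * (2 * (E + E) +
        curv τ (quadFn s (w.1 * α) (w.1 ^ 2 * A) (w.1 ^ 2 * B) w.2) *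
        tubeJac τ (quadFn s (w.1 * α) (w.1 ^ 2 * A) (w.1 ^ 2 * B) w.2)
          (quadFn t (w.1 * β) (w.1 ^ 2 * E) (w.1 ^ 2 * E) w.2) *
          ((α + 2 * w.1 * A * w.2.re) ^ 2 + 4 * w.1 ^ 2 * B ^ 2 * w.2.im ^ 2) : ℝ))

lemma lapC_quad_perturbation (hτ : ArcParam Γ τ) (s t α β A B E a : ℝ) (x : ℂ) :
    lapC (fun y => tubePt τ (quadFn s (a * α) (a ^ 2 * A) (a ^ 2 * B) y)
      (quadFn t (a * β) (a ^ 2 * E) (a ^ 2 * E) y)) x =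
      a ^ 2 • scaledLap τ s t α β A B E (a, x) := by
  rw [lapC_tubePt_comp hτ (contDiff_quadFn _ _ _ _).contDiffAt (contDiff_quadFn _ _ _ _).contDiffAt]
  simp only [fderiv_quadFn_one, fderiv_quadFn_I, lapR_quadFn, scaledLap, Complex.real_smul]
  push_cast
  ring

lemma continuous_quadFn_scaled (s α A B : ℝ) :
    Continuous fun w : ℝ × ℂ => quadFn s (w.1 * α) (w.1 ^ 2 * A) (w.1 ^ 2 * B) w.2 := by
  have h1 : Continuous fun w : ℝ × ℂ => w.2.re := Complex.continuous_re.comp continuous_snd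
  have h2 : Continuous fun w : ℝ × ℂ => w.2.im := Complex.continuous_im.comp continuous_snd
  unfold quadFn
  fun_prop

lemma continuous_scaledLap (hτ : ArcParam Γ τ) (s t α β A B E : ℝ) :
    Continuous (scaledLap τ s t α β A B E) := by
  have h1 : Continuous fun w : ℝ × ℂ => w.2.re := Complex.continuous_re.comp continuous_snd
  have h2 : Continuous fun w : ℝ × ℂ => w.2.im := Complex.continuous_im.comp continuous_snd
  have h3 := continuous_quadFn_scaled s α A B
  have h4 := continuous_quadFn_scaled t β E E
  have h5 := (contDiff_deriv_of_infty hτ.smooth).continuous.comp h3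
  have h6 := (contDiff_curv hτ).continuous.comp h3
  have h7 := (contDiff_deriv_of_infty (contDiff_curv hτ)).continuous.comp h3
  simp only [Function.comp_def] at h5 h6 h7
  unfold scaledLap tubeJac
  fun_prop

end Curve

section Curve

variable {Γ : Set ℂ} {τ : ℝ → ℂ} {W : ℂ → ℝ} {δ₁ m : ℝ}

lemma phase_quad_expansion (s t m β c E a : ℝ) {x : ℂ} (hx : ‖x‖ = 1) (ha : 0 ≤ a) (ha1 : a ≤ 1)
    (hm : 0 ≤ m) :
    quadFn s (a * -(m * t * β)) (a ^ 2 * (-c - m * t * E - m * β ^ 2 / 2))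
        (a ^ 2 * (-c - m * t * E)) x
      + m * quadFn t (a * β) (a ^ 2 * E) (a ^ 2 * E) x ^ 2 / 2 ≤
      s + m * t ^ 2 / 2 - c * a ^ 2 + m / 2 * (2 * |β * E| + E ^ 2) * a ^ 3 := by
  have h1 : x.re ^ 2 + x.im ^ 2 = 1 := by
    have := Complex.sq_norm x
    rw [hx, Complex.normSq_apply] at this
    linarith
  have h2 : |x.re| ≤ 1 := hx ▸ Complex.abs_re_le_norm x
  have e : quadFn s (a * -(m * t * β)) (a ^ 2 * (-c - m * t * E - m * β ^ 2 / 2))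
        (a ^ 2 * (-c - m * t * E)) x
      + m * quadFn t (a * β) (a ^ 2 * E) (a ^ 2 * E) x ^ 2 / 2 =
      s + m * t ^ 2 / 2 - c * a ^ 2 + m / 2 * (2 * (β * E * x.re) + E ^ 2 * a) * a ^ 3 := by
    have h3 : x.im ^ 2 = 1 - x.re ^ 2 := by linarith
    unfold quadFn
    rw [h3]
    ring
  rw [e]
  have h4 : β * E * x.re ≤ |β * E| := by
    calc β * E * x.re ≤ |β * E * x.re| := le_abs_self _
      _ = |β * E| * |x.re| := abs_mul _ _
      _ ≤ |β * E| * 1 := by gcongr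
      _ = _ := mul_one _
  have h5 : E ^ 2 * a ≤ E ^ 2 := mul_le_of_le_one_right (sq_nonneg _) ha1
  gcongr

set_option maxHeartbeats 1000000 in
theorem phaseForm_nonneg_of_coord (hτ : ArcParam Γ τ) (hW : ContDiff ℝ ∞ W) (hm : 0 < m)
    (hmax : HalfMax Γ τ W δ₁ m) {s t β k : ℝ} (hk : 0 < k) (hρ : 0 < tubeJac τ s t)
    (hδ : |t| < δ₁) (hinf : infDist (tubePt τ s t) Γ = |t|)
    (hcoord : ∀ U ∈ 𝓝 (s, t), ∀ᶠ z in 𝓝 (tubePt τ s t),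
      ∃ p ∈ U, tubePt τ p.1 p.2 = z ∧ |p.2| = infDist z Γ) :
    0 ≤ phaseForm τ W m β k s t := by
  by_contra! hneg
  have hδ0 : 0 < δ₁ := (abs_nonneg t).trans_lt hδ
  obtain ⟨α, hα⟩ : ∃ α, α = -(m * t * β) := ⟨_, rfl⟩
  obtain ⟨e, he⟩ : ∃ e, e = k * (frameGrad τ W s t).im - curv τ s * tubeJac τ s t * α ^ 2 :=
    ⟨_, rfl⟩
  obtain ⟨d, hd⟩ : ∃ d, d = (k * (frameGrad τ W s t).re + 2 * curv τ s * (α * β)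
    + t * deriv (curv τ) s * α ^ 2) / tubeJac τ s t := ⟨_, rfl⟩
  have hd' : tubeJac τ s t * d = k * (frameGrad τ W s t).re + 2 * curv τ s * (α * β)
    + t * deriv (curv τ) s * α ^ 2 := by rw [hd]; field_simp
  obtain ⟨c, hc⟩ : ∃ c, c = -(d + m * t * e + m * β ^ 2) / 4 := ⟨_, rfl⟩
  have hc0 : 0 < c := by
    have h1 : tubeJac τ s t * (d + m * t * e + m * β ^ 2) = phaseForm τ W m β k s t := by
      have : tubeJac τ s t * (d + m * t * e + m * β ^ 2) =
        tubeJac τ s t * d + tubeJac τ s t * (m * t * e + m * β ^ 2) := by ring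
      rw [this, hd', he, hα, phaseForm]
      ring
    have h2 : d + m * t * e + m * β ^ 2 < 0 := by
      by_contra! h3
      have := mul_nonneg hρ.le h3
      linarith
    rw [hc]; linarith
  set E := e / 4 with hE
  set A := -c - m * t * E - m * β ^ 2 / 2 with hA
  set B := -c - m * t * E with hB
  set z := tubePt τ s t with hz
  obtain ⟨G, hGs, hGz, hGl, hGr⟩ := exists_tubePt_inverse hτ hρ.ne'
  obtain ⟨V, hV, ⟨L, hL⟩, hVW⟩ := exists_lipschitz_eqOn_ball (contDiff_gradW hW) z
  obtain ⟨K, S, hS, hLip⟩ := (hGs.of_le (by exact_mod_cast le_top) :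
    ContDiffAt ℝ 1 G z).exists_lipschitzOnWith
  have hev : ∀ᶠ z' in 𝓝 z, z' ∈ S ∧ z' ∈ ball z 1 ∧ tubePt τ (G z').1 (G z').2 = z' ∧
      |(G z').2| = infDist z' Γ ∧ infDist z' Γ ≤ δ₁ := by
    have h1 : ∀ᶠ z' in 𝓝 z, infDist z' Γ < δ₁ :=
      (continuous_infDist_pt Γ).continuousAt.eventually_lt continuousAt_const (by rwa [hinf])
    filter_upwards [hS, ball_mem_nhds z one_pos, hGr, h1, hcoord _ hGl] with z' h1 h2 h3 h4 h5
    obtain ⟨p, hp, hpz, hpd⟩ := h5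
    refine ⟨h1, h2, h3, ?_, h4.le⟩
    rw [← hpd, ← hpz, show G (tubePt τ p.1 p.2) = p from hp]
  obtain ⟨r₀, hr₀, hball⟩ := Metric.eventually_nhds_iff_ball.1 hev
  obtain ⟨C, hC, hsol⟩ := exists_exact_solution hV hL
  set K' : ℝ := K * C * (1 + m * δ₁) with hK'
  have hK'0 : 0 ≤ K' := by positivity
  obtain ⟨η, hη⟩ : ∃ η, η = c / (8 * (K' + 1)) := ⟨_, rfl⟩
  have hη0 : 0 < η := by rw [hη]; positivity
  have hKη : 8 * (K' * η) ≤ c := by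
    have : 8 * ((K' + 1) * η) = c := by rw [hη]; field_simp
    nlinarith
  set C₁ : ℝ := m / 2 * (2 * |β * E| + E ^ 2) with hC₁
  set P : ℝ × ℂ → ℝ := fun w => quadFn s (w.1 * α) (w.1 ^ 2 * A) (w.1 ^ 2 * B) w.2 with hP
  set Q : ℝ × ℂ → ℝ := fun w => quadFn t (w.1 * β) (w.1 ^ 2 * E) (w.1 ^ 2 * E) w.2 with hQ
  have hPc : Continuous P := continuous_quadFn_scaled s α A B
  have hQc : Continuous Q := continuous_quadFn_scaled t β E E
  have hP0 : ∀ x, P (0, x) = s := fun x => by simp [hP, quadFn]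
  have hQ0 : ∀ x, Q (0, x) = t := fun x => by simp [hQ, quadFn]
  have hUc : Continuous fun w => tubePt τ (P w) (Q w) :=
    (contDiff_tubePt hτ).continuous.comp (hPc.prodMk hQc)
  have hunif : ∀ᶠ a : ℝ in 𝓝 0, ∀ x ∈ closedBall (0 : ℂ) 2,
      ‖k • V (tubePt τ (P (a, x)) (Q (a, x))) - scaledLap τ s t α β A B E (a, x)‖ < η ∧
      tubePt τ (P (a, x)) (Q (a, x)) ∈ ball z (r₀ / 2) ∧
      G (tubePt τ (P (a, x)) (Q (a, x))) = (P (a, x), Q (a, x)) := by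
    apply (isCompact_closedBall (0 : ℂ) 2).eventually_forall_of_forall_eventually
    intro x _
    have hF : Continuous fun w : ℝ × ℂ =>
        ‖k • V (tubePt τ (P w) (Q w)) - scaledLap τ s t α β A B E w‖ :=
      (((hV.continuous.comp hUc).const_smul k).sub (continuous_scaledLap hτ s t α β A B E)).norm
    have hF0 : k • V z - scaledLap τ s t α β A B E (0, x) = 0 := by
      rw [hVW z (mem_ball_self one_pos)]
      have h1 : gradW W z = deriv τ s * frameGrad τ W s t := by
        have := conj_mul_tangent hτ s
        unfold frameGrad
        linear_combination -gradW W (tubePt τ s t) * this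
      have h2 : scaledLap τ s t α β A B E (0, x) = deriv τ s *
          ((tubeJac τ s t * (2 * (A + B)) - 2 * curv τ s * (α * β)
            - t * deriv (curv τ) s * α ^ 2 : ℝ) + Complex.I * (2 * (E + E) +
              curv τ s * tubeJac τ s t * α ^ 2 : ℝ)) := by
        have e1 := hP0 x
        have e2 := hQ0 x
        simp only [hP, hQ] at e1 e2
        simp only [scaledLap, e1, e2]
        norm_num
      have h3 : tubeJac τ s t * (2 * (A + B)) - 2 * curv τ s * (α * β)
            - t * deriv (curv τ) s * α ^ 2 = k * (frameGrad τ W s t).re := by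
        have : 2 * (A + B) = d := by rw [hA, hB, hc, hE]; ring
        rw [this, hd']; ring
      have h4 : 2 * (E + E) + curv τ s * tubeJac τ s t * α ^ 2 = k * (frameGrad τ W s t).im := by
        rw [hE, he]; ring
      rw [h2, h3, h4, h1, Complex.real_smul]
      have h5 := Complex.re_add_im (frameGrad τ W s t)
      push_cast
      linear_combination -(k * deriv τ s) * h5
    have h1 : ∀ᶠ w in 𝓝 ((0 : ℝ), x),
        ‖k • V (tubePt τ (P w) (Q w)) - scaledLap τ s t α β A B E w‖ < η := by
      refine hF.continuousAt.eventually_lt continuousAt_const ?_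
      simp only [hP0, hQ0]
      rw [← hz, hF0, norm_zero]; exact hη0
    have hU0 : tubePt τ (P (0, x)) (Q (0, x)) = z := by rw [hP0, hQ0]
    have h2 : ∀ᶠ w in 𝓝 ((0 : ℝ), x), tubePt τ (P w) (Q w) ∈ ball z (r₀ / 2) := by
      apply hUc.continuousAt.eventually_mem
      rw [hU0]; exact ball_mem_nhds z (half_pos hr₀)
    have h3 : ∀ᶠ w in 𝓝 ((0 : ℝ), x), G (tubePt τ (P w) (Q w)) = (P w, Q w) := by
      have : Tendsto (fun w => (P w, Q w)) (𝓝 ((0 : ℝ), x)) (𝓝 (s, t)) := by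
        have := (hPc.prodMk hQc).tendsto ((0 : ℝ), x)
        rwa [hP0, hQ0] at this
      exact this.eventually hGl
    filter_upwards [h1, h2, h3] with w h1 h2 h3 using ⟨h1, h2, h3⟩
  have hsmall : ∀ (M c' : ℝ), 0 < c' → ∀ᶠ a : ℝ in 𝓝 0, M * a < c' := fun M c' hc' =>
    (continuous_const.mul continuous_id).continuousAt.eventually_lt continuousAt_const (by simpa)
  have hsmall2 : ∀ (M c' : ℝ), 0 < c' → ∀ᶠ a : ℝ in 𝓝 0, M * a ^ 2 < c' := fun M c' hc' =>
    (continuous_const.mul (continuous_id.pow 2)).continuousAt.eventually_lt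
      continuousAt_const (by simpa)
  obtain ⟨a, ⟨ha1, haC₁, hakC, har, haU⟩, ha0⟩ :=
    ((((hsmall 1 1 one_pos).and ((hsmall C₁ (c / 4) (by positivity)).and
      ((hsmall2 (k * C) 1 one_pos).and ((hsmall2 (C * η) (r₀ / 2) (by positivity)).and
        hunif)))).filter_mono nhdsWithin_le_nhds).and
      (self_mem_nhdsWithin : ∀ᶠ a in 𝓝[>] (0 : ℝ), a ∈ Ioi 0)).exists
  have ha0' : (0 : ℝ) < a := ha0
  set u₀ : ℂ → ℂ := fun y => tubePt τ (P (a, y)) (Q (a, y)) with hu₀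
  have hu₀s : ContDiff ℝ ∞ u₀ :=
    (contDiff_tubePt hτ).comp ((contDiff_quadFn s (a * α) (a ^ 2 * A) (a ^ 2 * B)).prodMk
      (contDiff_quadFn t (a * β) (a ^ 2 * E) (a ^ 2 * E)))
  have hlap : ∀ x, lapC u₀ x = a ^ 2 • scaledLap τ s t α β A B E (a, x) :=
    lapC_quad_perturbation hτ s t α β A B E a
  obtain ⟨w, hws, hwC, hweq⟩ := hsol u₀ (k * a ^ 2) (a ^ 2 * η) hu₀s (by positivity)
    (by linarith) (fun x hx => by
      rw [hlap, mul_comm k, mul_smul, ← smul_sub, norm_smul, Real.norm_of_nonneg (sq_nonneg a)]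
      exact mul_le_mul_of_nonneg_left (haU x (by simpa using hx)).1.le (sq_nonneg a))
  have hwr : ∀ x, ‖w x‖ < r₀ / 2 := fun x => (hwC x).trans_lt (by linarith)
  have hin₀ : ∀ x ∈ closedBall (0 : ℂ) 1, u₀ x ∈ ball z r₀ := fun x hx =>
    ball_subset_ball (by linarith)
      (haU x (closedBall_subset_closedBall (by norm_num) hx)).2.1
  have hin : ∀ x ∈ closedBall (0 : ℂ) 1, u₀ x + w x ∈ ball z r₀ := by
    intro x hx
    have h1 := (haU x (closedBall_subset_closedBall (by norm_num) hx)).2.1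
    rw [mem_ball, dist_eq_norm] at h1 ⊢
    calc ‖u₀ x + w x - z‖ = ‖(u₀ x - z) + w x‖ := by ring_nf
      _ ≤ ‖u₀ x - z‖ + ‖w x‖ := norm_add_le _ _
      _ < r₀ := by linarith [hwr x]
  have hus : ContDiff ℝ ∞ fun y => u₀ y + w y := hu₀s.add hws
  have hGc : ContinuousOn (fun x => G (u₀ x + w x)) (closedBall 0 1) :=
    ContinuousOn.comp (t := ball z r₀)
      (hLip.continuousOn.mono fun y hy => (hball y hy).1) hus.continuous.continuousOn hin
  obtain ⟨x, hx1, hxle⟩ := hmax (Real.sqrt k * a)⁻¹ (fun y => u₀ y + w y)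
    (fun x => (G (u₀ x + w x)).2) (fun x => (G (u₀ x + w x)).1) (by positivity) hus
    (fun x hx => by
      have h1 := hin x (by simpa using hx.le)
      rw [hweq x hx, hVW _ (hball _ h1).2.1]
      congr 1
      rw [inv_pow, inv_inv, mul_pow, Real.sq_sqrt hk.le])
    (fun x hx => (hball _ (hin x hx)).2.2.2.2)
    ⟨continuous_snd.comp_continuousOn hGc, continuous_fst.comp_continuousOn hGc,
      fun x hx => ⟨(hball _ (hin x hx)).2.2.1.symm, (hball _ (hin x hx)).2.2.2.1⟩⟩
  set δ : ℝ := K * (C * (a ^ 2 * η)) with hδdef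
  have hδnn : 0 ≤ δ := by positivity
  have hest : ∀ x ∈ closedBall (0 : ℂ) 1,
      |((G (u₀ x + w x)).1 + m * (G (u₀ x + w x)).2 ^ 2 / 2) -
        (P (a, x) + m * Q (a, x) ^ 2 / 2)| ≤ δ * (1 + m * δ₁) := by
    intro x hx
    obtain ⟨b1, -, -, b4, b5⟩ := hball _ (hin x hx)
    obtain ⟨c1, -, -, c4, c5⟩ := hball _ (hin₀ x hx)
    have hG0 : G (u₀ x) = (P (a, x), Q (a, x)) :=
      (haU x (closedBall_subset_closedBall (by norm_num) hx)).2.2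
    have h1 : ‖G (u₀ x + w x) - G (u₀ x)‖ ≤ δ := by
      rw [← dist_eq_norm]
      refine (hLip.dist_le_mul _ b1 _ c1).trans ?_
      rw [dist_eq_norm, add_sub_cancel_left]
      exact mul_le_mul_of_nonneg_left (hwC x) K.coe_nonneg
    rw [hG0] at h1 c4
    have h2 := (norm_fst_le _).trans h1
    have h3 := (norm_snd_le _).trans h1
    simp only [Prod.fst_sub, Prod.snd_sub, Real.norm_eq_abs] at h2 h3
    rw [← b4] at b5
    rw [← c4] at c5
    have h4 : |(G (u₀ x + w x)).2 ^ 2 - Q (a, x) ^ 2| ≤ δ * (2 * δ₁) := by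
      rw [sq_sub_sq, abs_mul, mul_comm]
      gcongr
      exact (abs_add_le _ _).trans (by simp only at c5; linarith)
    have h5 : ((G (u₀ x + w x)).1 + m * (G (u₀ x + w x)).2 ^ 2 / 2) -
        (P (a, x) + m * Q (a, x) ^ 2 / 2) = ((G (u₀ x + w x)).1 - P (a, x)) +
        m / 2 * ((G (u₀ x + w x)).2 ^ 2 - Q (a, x) ^ 2) := by ring
    rw [h5]
    refine (abs_add_le _ _).trans ?_
    rw [abs_mul, abs_of_pos (by positivity : 0 < m / 2)]
    have := mul_le_mul_of_nonneg_left h4 (by positivity : 0 ≤ m / 2)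
    linarith
  have hE0 := (abs_le.1 (hest 0 (by simp))).1
  have hE1 := (abs_le.1 (hest x (by simp [hx1]))).2
  have hPQ0 : P (a, 0) = s ∧ Q (a, 0) = t := by simp [hP, hQ, quadFn]
  have hexp := phase_quad_expansion s t m β c E a hx1 ha0'.le (by linarith) hm.le
  have hexp' : P (a, x) + m * Q (a, x) ^ 2 / 2 ≤
      s + m * t ^ 2 / 2 - c * a ^ 2 + C₁ * a ^ 3 := by
    simp only [hP, hQ, hα]
    exact hexp
  rw [hPQ0.1, hPQ0.2] at hE0
  have hfin : δ * (1 + m * δ₁) = K' * η * a ^ 2 := by rw [hδdef, hK']; ring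
  rw [hfin] at hE0 hE1
  have ha2 : 0 < a ^ 2 := by positivity
  have f1 : C₁ * a ^ 3 ≤ c / 4 * a ^ 2 := by
    calc C₁ * a ^ 3 = C₁ * a * a ^ 2 := by ring
      _ ≤ c / 4 * a ^ 2 := by gcongr
  have f2 : 8 * (K' * η) * a ^ 2 ≤ c * a ^ 2 := by gcongr
  have f3 : 0 < c * a ^ 2 := by positivity
  linarith

end Curve

section Curve

variable {Γ : Set ℂ} {τ : ℝ → ℂ} {W : ℂ → ℝ} {δ₁ m : ℝ}

lemma contDiff_frameGrad (hτ : ArcParam Γ τ) (hW : ContDiff ℝ ∞ W) :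
    ContDiff ℝ ∞ fun z : ℝ × ℝ => frameGrad τ W z.1 z.2 :=
  (Complex.conjCLE.contDiff.comp
    ((contDiff_deriv_of_infty hτ.smooth).comp contDiff_fst)).mul
    ((contDiff_gradW hW).comp (contDiff_tubePt hτ))

theorem phaseForm_nonneg (hτ : ArcParam Γ τ) (hW : ContDiff ℝ ∞ W) (hm : 0 < m) (hδ₁ : 0 < δ₁)
    (hmax : HalfMax Γ τ W δ₁ m) {s t β k : ℝ} (hk : 0 ≤ k) (ht : |t| ≤ δ₁)
    (h : infDist (tubePt τ s t) Γ = |t|) : 0 ≤ phaseForm τ W m β k s t := by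
  have hc : Continuous fun θ : ℝ => phaseForm τ W m β (k + (1 - θ)) s (θ * t) := by
    have h1 : Continuous fun θ : ℝ => frameGrad τ W s (θ * t) :=
      (contDiff_frameGrad hτ hW).continuous.comp
        (continuous_const.prodMk (continuous_id.mul continuous_const))
    have h2 := Complex.continuous_re.comp h1
    have h3 := Complex.continuous_im.comp h1
    simp only [Function.comp_def] at h2 h3
    unfold phaseForm tubeJac
    fun_prop
  have hlim := (hc.tendsto 1).mono_left (nhdsWithin_le_nhds (s := Iio 1))
  simp only [sub_self, add_zero, one_mul] at hlim
  refine ge_of_tendsto hlim ?_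
  have h0 : ∀ᶠ θ : ℝ in 𝓝[<] 1, 0 < θ :=
    nhdsWithin_le_nhds (lt_mem_nhds one_pos)
  filter_upwards [h0, self_mem_nhdsWithin] with θ hθ hθ1
  have hθ1' : θ < 1 := hθ1
  have habs : |θ * t| < δ₁ := by
    rw [abs_mul, abs_of_pos hθ]
    rcases eq_or_ne t 0 with rfl | h0
    · simpa
    · nlinarith [abs_pos.2 h0]
  exact phaseForm_nonneg_of_coord hτ hW hm hmax (by linarith)
    (tubeJac_pos_of_lt hτ h hθ.le hθ1') habs (infDist_tubePt_smul hτ h hθ.le hθ1'.le)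
    (fun U hU => eventually_exists_normal_coord hτ h hθ.le hθ1' hU)

lemma deriv_comp_neg_fun (τ : ℝ → ℂ) : deriv (fun s => τ (-s)) = fun s => -deriv τ (-s) :=
  funext fun s => deriv_comp_neg τ s

lemma ArcParam.reverse (hτ : ArcParam Γ τ) : ArcParam Γ fun s => τ (-s) where
  smooth := hτ.smooth.comp contDiff_neg
  periodic s := by
    change τ (-(s + 2 * Real.pi)) = τ (-s)
    rw [neg_add, ← sub_eq_add_neg]
    exact hτ.periodic.sub_eq _
  arclength s := by rw [deriv_comp_neg_fun]; simp [hτ.arclength]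
  inj s t h := by
    obtain ⟨k, hk⟩ := hτ.inj _ _ h
    exact ⟨-k, by push_cast; linarith⟩
  srange := by
    rw [← hτ.srange]
    exact (Equiv.neg ℝ).surjective.range_comp τ

lemma tubePt_reverse (τ : ℝ → ℂ) (s t : ℝ) :
    tubePt (fun s => τ (-s)) s t = tubePt τ (-s) (-t) := by
  simp [tubePt, deriv_comp_neg_fun]

lemma curv_reverse (τ : ℝ → ℂ) : curv (fun s => τ (-s)) = fun s => -curv τ (-s) := by
  funext s
  have : deriv (fun s => -deriv τ (-s)) s = deriv (deriv τ) (-s) := by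
    rw [deriv.fun_neg, deriv_comp_neg (deriv τ) s, neg_neg]
  simp [curv, deriv_comp_neg_fun, this]

lemma phaseForm_reverse (τ : ℝ → ℂ) (W : ℂ → ℝ) (m β k s t : ℝ) :
    phaseForm (fun s => τ (-s)) W m β k (-s) (-t) =
      β ^ 2 * (m * tubeJac τ s t - 2 * curv τ s * m * t - deriv (curv τ) s * m ^ 2 * t ^ 3
        - curv τ s * tubeJac τ s t ^ 2 * m ^ 3 * t ^ 3)
      + k * (-(frameGrad τ W s t).re + m * t * tubeJac τ s t * (frameGrad τ W s t).im) := by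
  have h1 : deriv (fun s => -curv τ (-s)) (-s) = deriv (curv τ) s := by
    rw [deriv.fun_neg, deriv_comp_neg (curv τ), neg_neg, neg_neg]
  have h2 : frameGrad (fun s => τ (-s)) W (-s) (-t) = -frameGrad τ W s t := by
    simp [frameGrad, tubePt_reverse, deriv_comp_neg_fun]
  have h3 : tubeJac (fun s => τ (-s)) (-s) (-t) = tubeJac τ s t := by
    simp [tubeJac, curv_reverse]
  rw [phaseForm, h2, h3, curv_reverse, h1]
  simp only [neg_neg, Complex.neg_re, Complex.neg_im]
  ring

lemma exists_sphere_le {h : ℂ → ℝ} (hc : ContinuousOn h (closedBall 0 1))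
    (hsup : sSup (h '' closedBall 0 1) = sSup (h '' sphere 0 1)) :
    ∃ x : ℂ, ‖x‖ = 1 ∧ h 0 ≤ h x := by
  have hcomp : IsCompact (h '' closedBall (0 : ℂ) 1) :=
    (isCompact_closedBall 0 1).image_of_continuousOn hc
  obtain ⟨x, hx, hxs⟩ := ((isCompact_sphere (0 : ℂ) 1).exists_sSup_image_eq
    ⟨1, by simp⟩ (hc.mono sphere_subset_closedBall))
  refine ⟨x, by simpa using hx, ?_⟩
  rw [← hxs, ← hsup]
  exact le_csSup hcomp.bddAbove (mem_image_of_mem h (by simp))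

lemma simplyConnectedSpace_ball : SimplyConnectedSpace ↥(ball (0 : ℂ) 1) := by
  have : ContractibleSpace ↥(ball (0 : ℂ) 1) :=
    (convex_ball (0 : ℂ) 1).contractibleSpace ⟨0, by simp⟩
  infer_instance

lemma MaxPrinciple.halfMax (h : MaxPrinciple Γ τ W δ₁ m) : HalfMax Γ τ W δ₁ m := by
  intro ε u t φ hε hu hlap hdist hdec
  have hcl : closure (ball (0 : ℂ) 1) = closedBall 0 1 := closure_ball 0 one_ne_zero
  have hfr : frontier (ball (0 : ℂ) 1) = sphere 0 1 := frontier_ball 0 one_ne_zero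
  have h1 := (h (ball 0 1) ε u t φ isOpen_ball isBounded_ball ⟨0, by simp⟩
    simplyConnectedSpace_ball hε hu.contDiffOn hu.continuous.continuousOn
    (fun x hx => hlap x (by simpa using hx)) (by rwa [hcl]) (by rwa [hcl])).2
  rw [hcl, hfr] at h1
  exact exists_sphere_le (hdec.2.1.add ((continuousOn_const.mul (hdec.1.pow 2)).div_const 2)) h1

lemma PhaseDecomp.reverse {S : Set ℂ} {u : ℂ → ℂ} {t φ : ℂ → ℝ}
    (h : PhaseDecomp Γ (fun s => τ (-s)) S u t φ) :
    PhaseDecomp Γ τ S u (fun x => -t x) (fun x => -φ x) := by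
  refine ⟨h.1.neg, h.2.1.neg, fun x hx => ⟨?_, ?_⟩⟩
  · exact (h.2.2 x hx).1.trans (tubePt_reverse τ (φ x) (t x))
  · rw [abs_neg]; exact (h.2.2 x hx).2

lemma MaxPrinciple.halfMax_reverse (h : MaxPrinciple Γ τ W δ₁ m) :
    HalfMax Γ (fun s => τ (-s)) W δ₁ m := by
  intro ε u t φ hε hu hlap hdist hdec
  have hcl : closure (ball (0 : ℂ) 1) = closedBall 0 1 := closure_ball 0 one_ne_zero
  have hfr : frontier (ball (0 : ℂ) 1) = sphere 0 1 := frontier_ball 0 one_ne_zero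
  have h1 := (h (ball 0 1) ε u (fun x => -t x) (fun x => -φ x) isOpen_ball isBounded_ball
    ⟨0, by simp⟩ simplyConnectedSpace_ball hε hu.contDiffOn hu.continuous.continuousOn
    (fun x hx => hlap x (by simpa using hx)) (by rwa [hcl]) (by rw [hcl]; exact hdec.reverse)).1
  rw [hcl, hfr] at h1
  refine exists_sphere_le (h := fun x => φ x + m * t x ^ 2 / 2)
    (hdec.2.1.add ((continuousOn_const.mul (hdec.1.pow 2)).div_const 2)) ?_
  have h2 : ∀ S : Set ℂ, (fun x => -φ x - m * (-t x) ^ 2 / 2) '' S =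
      -((fun x => φ x + m * t x ^ 2 / 2) '' S) := by
    intro S
    rw [← Set.image_neg_eq_neg, Set.image_image]
    congr 1
    funext x
    ring
  rw [h2, h2, Real.sInf_def, Real.sInf_def, neg_neg, neg_neg] at h1
  linarith

/-- Pointwise bounds on the admissible part of the normal coordinates. -/
structure TubeBounds (τ : ℝ → ℂ) (W : ℂ → ℝ) (m s t : ℝ) : Prop where
  jac : 2 / 3 ≤ tubeJac τ s t
  form : ∀ ς : ℝ, ς = 1 ∨ ς = -1 → 0 ≤ m * tubeJac τ s t - 2 * curv τ s * m * t
    + ς * deriv (curv τ) s * m ^ 2 * t ^ 3 - curv τ s * tubeJac τ s t ^ 2 * m ^ 3 * t ^ 3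
  grad : ∀ ς : ℝ, ς = 1 ∨ ς = -1 →
    0 ≤ ς * (frameGrad τ W s t).re + m * t * tubeJac τ s t * (frameGrad τ W s t).im

theorem MaxPrinciple.tubeBounds (hmax : MaxPrinciple Γ τ W δ₁ m) (hτ : ArcParam Γ τ)
    (hW : ContDiff ℝ ∞ W) (hm : 0 < m) (hδ₁ : 0 < δ₁) {s t : ℝ} (ht : |t| ≤ δ₁)
    (h : infDist (tubePt τ s t) Γ = |t|) : TubeBounds τ W m s t := by
  have hrev : infDist (tubePt (fun s => τ (-s)) (-s) (-t)) Γ = |-t| := by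
    rw [tubePt_reverse, neg_neg, neg_neg, abs_neg, h]
  have key1 := fun β k hk =>
    phaseForm_nonneg hτ hW hm hδ₁ hmax.halfMax (s := s) (t := t) (β := β) (k := k) hk ht h
  have key2 := fun β k hk =>
    phaseForm_nonneg hτ.reverse hW hm hδ₁ hmax.halfMax_reverse (s := -s) (t := -t) (β := β)
      (k := k) hk (by rwa [abs_neg]) hrev
  simp only [phaseForm_reverse] at key2
  unfold phaseForm at key1
  have a1 := key1 1 0 le_rfl
  have a2 := key2 1 0 le_rfl
  have b1 := key1 0 1 zero_le_one
  have b2 := key2 0 1 zero_le_one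
  refine ⟨?_, ?_, ?_⟩
  · by_contra! hlt
    have hx : 1 / 3 < curv τ s * t := by unfold tubeJac at hlt; linarith
    have hs : 0 ≤ m * (1 - 3 * (curv τ s * t) -
        (curv τ s * t) * (tubeJac τ s t * m * t) ^ 2) := by
      have e : tubeJac τ s t = 1 - curv τ s * t := rfl
      have : m * (1 - 3 * (curv τ s * t) - (curv τ s * t) * (tubeJac τ s t * m * t) ^ 2) =
        (m * tubeJac τ s t - 2 * curv τ s * m * t
          - curv τ s * tubeJac τ s t ^ 2 * m ^ 3 * t ^ 3) := by rw [e]; ring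
      rw [this]; linarith
    have hs' := nonneg_of_mul_nonneg_right hs hm
    have : 0 ≤ (curv τ s * t) * (tubeJac τ s t * m * t) ^ 2 :=
      mul_nonneg (by linarith) (sq_nonneg _)
    linarith
  · rintro ς (rfl | rfl)
    · linarith
    · linarith
  · rintro ς (rfl | rfl)
    · linarith
    · linarith

end Curve

lemma lapR_comp_of_eventually {F F₁ : ℝ → ℝ} {h : ℂ → ℝ} {x : ℂ} {c : ℝ}
    (hF : ∀ᶠ r in 𝓝 (h x), HasDerivAt F (F₁ r) r) (hF₁ : HasDerivAt F₁ c (h x))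
    (hh : ContDiffAt ℝ 2 h x) :
    lapR (fun y => F (h y)) x = F₁ (h x) * lapR h x +
      c * (fderiv ℝ h x 1 ^ 2 + fderiv ℝ h x Complex.I ^ 2) := by
  have key : ∀ v : ℂ, fderiv ℝ (fun y => fderiv ℝ (fun y => F (h y)) y v) x v =
      F₁ (h x) * fderiv ℝ (fun y => fderiv ℝ h y v) x v + c * fderiv ℝ h x v ^ 2 := by
    intro v
    have e : (fun y => fderiv ℝ (fun y => F (h y)) y v) =ᶠ[𝓝 x]
        fun y => F₁ (h y) * fderiv ℝ h y v := by
      filter_upwards [eventually_contDiffAt_two hh, hh.continuousAt.eventually hF] with y hy hFy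
      have h1 := hFy.comp_hasFDerivAt y (hy.differentiableAt (by norm_num)).hasFDerivAt
      have h2 : fderiv ℝ (fun y => F (h y)) y = F₁ (h y) • fderiv ℝ h y := h1.fderiv
      rw [h2]; simp
    rw [e.fderiv_eq]
    have h1 := hF₁.comp_hasFDerivAt x (hh.differentiableAt (by norm_num)).hasFDerivAt
    have h2 := (differentiableAt_fderiv_apply hh v).hasFDerivAt
    have h3 := h1.mul h2
    have h4 : fderiv ℝ (fun y => F₁ (h y) * fderiv ℝ h y v) x = _ := h3.fderiv
    rw [h4]
    simp
    ring
  unfold lapR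
  rw [key, key]
  ring

lemma lapR_comp {F F₁ F₂ : ℝ → ℝ} {h : ℂ → ℝ} {x : ℂ} (hF : ∀ r, HasDerivAt F (F₁ r) r)
    (hF₁ : ∀ r, HasDerivAt F₁ (F₂ r) r) (hh : ContDiffAt ℝ 2 h x) :
    lapR (fun y => F (h y)) x = F₁ (h x) * lapR h x +
      F₂ (h x) * (fderiv ℝ h x 1 ^ 2 + fderiv ℝ h x Complex.I ^ 2) :=
  lapR_comp_of_eventually (Eventually.of_forall hF) (hF₁ _) hh

lemma lapR_add {g h : ℂ → ℝ} {x : ℂ} (hg : ContDiffAt ℝ 2 g x) (hh : ContDiffAt ℝ 2 h x) :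
    lapR (fun y => g y + h y) x = lapR g x + lapR h x := by
  have key : ∀ v : ℂ, fderiv ℝ (fun y => fderiv ℝ (fun y => g y + h y) y v) x v =
      fderiv ℝ (fun y => fderiv ℝ g y v) x v + fderiv ℝ (fun y => fderiv ℝ h y v) x v := by
    intro v
    have e : (fun y => fderiv ℝ (fun y => g y + h y) y v) =ᶠ[𝓝 x]
        fun y => fderiv ℝ g y v + fderiv ℝ h y v := by
      filter_upwards [eventually_contDiffAt_two hg, eventually_contDiffAt_two hh] with y h1 h2
      rw [fderiv_fun_add (h1.differentiableAt (by norm_num)) (h2.differentiableAt (by norm_num))]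
      rfl
    rw [e.fderiv_eq, fderiv_fun_add (differentiableAt_fderiv_apply hg v)
      (differentiableAt_fderiv_apply hh v)]
    rfl
  unfold lapR
  rw [key, key]
  ring

lemma lapR_const_mul (c : ℝ) {h : ℂ → ℝ} {x : ℂ} (hh : ContDiffAt ℝ 2 h x) :
    lapR (fun y => c * h y) x = c * lapR h x := by
  have := lapR_comp (F := fun r => c * r) (F₁ := fun _ => c) (F₂ := fun _ => 0)
    (fun r => by simpa using (hasDerivAt_id r).const_mul c) (fun r => hasDerivAt_const r c) hh
  simpa using this

/-- The profile added to the phase. -/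
def phaseProfile (m σ K t : ℝ) : ℝ := m * t ^ 2 / 2 + σ * Real.cosh (K * t) / K

lemma hasDerivAt_phaseProfile (m σ : ℝ) {K : ℝ} (hK : K ≠ 0) (t : ℝ) :
    HasDerivAt (phaseProfile m σ K) (m * t + σ * Real.sinh (K * t)) t := by
  have h1 : HasDerivAt (fun t : ℝ => K * t) K t := by
    simpa using (hasDerivAt_id t).const_mul K
  have h2 := ((Real.hasDerivAt_cosh (K * t)).comp t h1).const_mul σ
  have h3 := ((hasDerivAt_pow 2 t).const_mul m).div_const 2
  refine (h3.add (h2.div_const K)).congr_deriv ?_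
  field_simp
  norm_num
  ring

lemma hasDerivAt_phaseProfile_deriv (m σ K t : ℝ) :
    HasDerivAt (fun t => m * t + σ * Real.sinh (K * t)) (m + σ * (K * Real.cosh (K * t))) t := by
  have h1 : HasDerivAt (fun t : ℝ => K * t) K t := by
    simpa using (hasDerivAt_id t).const_mul K
  have h2 := ((Real.hasDerivAt_sinh (K * t)).comp t h1).const_mul σ
  have h3 : HasDerivAt (fun t : ℝ => m * t) m t := by
    simpa using (hasDerivAt_id t).const_mul m
  refine (h3.add h2).congr_deriv ?_
  ring

lemma contDiff_phaseProfile (m σ K : ℝ) {n : WithTop ℕ∞} :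
    ContDiff ℝ n (phaseProfile m σ K) := by
  unfold phaseProfile
  exact ((contDiff_const.mul (contDiff_id.pow 2)).div_const 2).add
    ((contDiff_const.mul (Real.contDiff_cosh.comp (contDiff_const.mul contDiff_id))).div_const K)

lemma quadratic_form_nonneg {z Z Y Y₀ X b c : ℝ} (hz : 0 < z) (hZ : z ≤ Z) (hY : |Y| ≤ Y₀)
    (hX : Y₀ ^ 2 / (4 * z) ≤ X) : 0 ≤ Z * b ^ 2 + Y * c * b + X * c ^ 2 := by
  have h1 : Y ^ 2 ≤ Y₀ ^ 2 := by rw [← sq_abs Y]; gcongr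
  have h2 : Y ^ 2 / (4 * z) ≤ X := le_trans (by gcongr) hX
  have h3 : z * b ^ 2 + Y * c * b + Y ^ 2 / (4 * z) * c ^ 2 = (2 * z * b + Y * c) ^ 2 / (4 * z) := by
    field_simp; ring
  have h4 : 0 ≤ (2 * z * b + Y * c) ^ 2 / (4 * z) := by positivity
  nlinarith [sq_nonneg b, sq_nonneg c]

lemma profile_form_lower {M δ m K σ κ κ' t ρ ς : ℝ} (hM : 0 ≤ M) (hδ : 0 ≤ δ) (hm : 0 ≤ m)
    (hK : 3 / 2 * (2 * M + M * δ * (2 * (m * δ) + 1) +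
      M * (1 + M * δ) ^ 2 * (3 * (m * δ) ^ 2 + 3 * (m * δ) + 1) + 1) ≤ K)
    (hσ : 0 < σ) (hσh : σ * |Real.sinh (K * t)| ≤ 1) (hκ : |κ| ≤ M) (hκ' : |κ'| ≤ M)
    (ht : |t| ≤ δ) (hρ : 2 / 3 ≤ ρ) (hρ' : ρ ≤ 1 + M * δ) (hς : |ς| = 1)
    (hform : 0 ≤ m * ρ - 2 * κ * m * t + ς * κ' * m ^ 2 * t ^ 3 - κ * ρ ^ 2 * m ^ 3 * t ^ 3) :
    σ ≤ ρ * (m + σ * (K * Real.cosh (K * t))) - 2 * κ * (m * t + σ * Real.sinh (K * t))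
      + ς * t * κ' * (m * t + σ * Real.sinh (K * t)) ^ 2
      - κ * ρ ^ 2 * (m * t + σ * Real.sinh (K * t)) ^ 3 := by
  set h := Real.sinh (K * t) with hh
  set C := Real.cosh (K * t) with hC
  have hC1 : 1 ≤ C := Real.one_le_cosh _
  have hhC : |h| ≤ C := by
    have := Real.cosh_sq (K * t)
    apply abs_le_of_sq_le_sq _ (by linarith)
    rw [← hC, ← hh] at this
    linarith
  have hσh' : |σ * h| ≤ 1 := by rwa [abs_mul, abs_of_pos hσ]
  have hmt : |m * t| ≤ m * δ := by rw [abs_mul, abs_of_nonneg hm]; gcongr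
  set D := 2 * M + M * δ * (2 * (m * δ) + 1) +
      M * (1 + M * δ) ^ 2 * (3 * (m * δ) ^ 2 + 3 * (m * δ) + 1) with hD
  have b1 : |2 * κ * h| ≤ 2 * M * |h| := by
    rw [abs_mul, abs_mul, abs_two]; gcongr
  have b2 : |ς * t * κ' * (2 * (m * t) + σ * h) * h| ≤ M * δ * (2 * (m * δ) + 1) * |h| := by
    rw [abs_mul, abs_mul, abs_mul, abs_mul, hς, one_mul, mul_comm |t|]
    gcongr
    refine (abs_add_le _ _).trans ?_
    rw [abs_mul, abs_two]
    gcongr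
  have b3 : |κ * ρ ^ 2 * (3 * (m * t) ^ 2 + 3 * (m * t) * (σ * h) + (σ * h) ^ 2) * h| ≤
      M * (1 + M * δ) ^ 2 * (3 * (m * δ) ^ 2 + 3 * (m * δ) + 1) * |h| := by
    rw [abs_mul, abs_mul, abs_mul]
    have hρa : |ρ ^ 2| ≤ (1 + M * δ) ^ 2 := by
      rw [abs_of_nonneg (sq_nonneg ρ)]; gcongr
    gcongr
    refine (abs_add_three _ _ _).trans ?_
    rw [abs_mul, abs_mul, abs_mul 3 (m * t), abs_of_pos (by norm_num : (0 : ℝ) < 3), abs_pow,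
      abs_pow]
    have : |σ * h| ^ 2 ≤ 1 := pow_le_one₀ (abs_nonneg _) hσh'
    have h5 : 3 * |m * t| * |σ * h| ≤ 3 * (m * δ) := by
      calc 3 * |m * t| * |σ * h| ≤ 3 * (m * δ) * 1 := by gcongr
        _ = _ := mul_one _
    gcongr
  have hD0 : 0 ≤ D := by positivity
  have hK1 : C ≤ ρ * (K * C) - D * C := by
    have h7 : 2 / 3 * (3 / 2 * (D + 1)) ≤ ρ * K := by gcongr
    have : (D + 1) * C ≤ ρ * K * C := by
      gcongr
      linarith
    linarith
  have hDC : D * |h| ≤ D * C := by gcongr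
  have hsum : 1 ≤ ρ * (K * C) - 2 * κ * h + ς * t * κ' * (2 * (m * t) + σ * h) * h
      - κ * ρ ^ 2 * (3 * (m * t) ^ 2 + 3 * (m * t) * (σ * h) + (σ * h) ^ 2) * h := by
    have c1 := (abs_le.1 b1).2
    have c2 := (abs_le.1 b2).1
    have c3 := (abs_le.1 b3).2
    have c4 : 2 * M * |h| + M * δ * (2 * (m * δ) + 1) * |h| +
      M * (1 + M * δ) ^ 2 * (3 * (m * δ) ^ 2 + 3 * (m * δ) + 1) * |h| = D * |h| := by
      rw [hD]; ring
    linarith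
  have := mul_le_mul_of_nonneg_left hsum hσ.le
  linarith

lemma profile_combine {κ κ' t ρ ς w₁ w₂ N p₁ p₂ b₁ b₂ lφ lt m σ h f₁ f₂ l : ℝ} (hρ0 : 0 < ρ)
    (hς2 : ς ^ 2 = 1) (hN : 0 ≤ N) (hf₁ : f₁ = m * t + σ * h)
    (hgrad : 0 ≤ ς * w₁ + m * t * ρ * w₂)
    (e1 : ρ * lφ - 2 * κ * (p₁ * b₁ + p₂ * b₂) - t * κ' * (p₁ ^ 2 + p₂ ^ 2) = N * w₁)
    (e2 : lt + κ * ρ * (p₁ ^ 2 + p₂ ^ 2) = N * w₂)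
    (q1 : 0 ≤ (ρ * f₂ - 2 * κ * f₁ + ς * t * κ' * f₁ ^ 2 - κ * ρ ^ 2 * f₁ ^ 3) * b₁ ^ 2 +
      (2 * κ - 2 * (ς * t * κ' * f₁) + 2 * (κ * ρ ^ 2 * f₁ ^ 2)) * (ς * p₁ + f₁ * b₁) * b₁ +
      (ς * t * κ' - κ * ρ ^ 2 * f₁ + l * ρ) * (ς * p₁ + f₁ * b₁) ^ 2)
    (q2 : 0 ≤ (ρ * f₂ - 2 * κ * f₁ + ς * t * κ' * f₁ ^ 2 - κ * ρ ^ 2 * f₁ ^ 3) * b₂ ^ 2 +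
      (2 * κ - 2 * (ς * t * κ' * f₁) + 2 * (κ * ρ ^ 2 * f₁ ^ 2)) * (ς * p₂ + f₁ * b₂) * b₂ +
      (ς * t * κ' - κ * ρ ^ 2 * f₁ + l * ρ) * (ς * p₂ + f₁ * b₂) ^ 2) :
    N * σ * (h * w₂) ≤ ς * lφ + f₁ * lt + f₂ * (b₁ ^ 2 + b₂ ^ 2) +
      l * ((ς * p₁ + f₁ * b₁) ^ 2 + (ς * p₂ + f₁ * b₂) ^ 2) := by
  refine le_of_mul_le_mul_left ?_ hρ0
  have hNg := mul_nonneg hN hgrad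
  have hlφ : ρ * (ς * lφ) = ς * (2 * κ * (p₁ * b₁ + p₂ * b₂) + t * κ' * (p₁ ^ 2 + p₂ ^ 2)
      + N * w₁) := by rw [← e1]; ring
  have hlt : lt = N * w₂ - κ * ρ * (p₁ ^ 2 + p₂ ^ 2) := by rw [← e2]; ring
  obtain ⟨c₁, hc₁⟩ : ∃ c₁, c₁ = ς * p₁ + f₁ * b₁ := ⟨_, rfl⟩
  obtain ⟨c₂, hc₂⟩ : ∃ c₂, c₂ = ς * p₂ + f₁ * b₂ := ⟨_, rfl⟩
  rw [← hc₁] at q1 ⊢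
  rw [← hc₂] at q2 ⊢
  have hςp₁ : ς * p₁ = c₁ - f₁ * b₁ := by rw [hc₁]; ring
  have hςp₂ : ς * p₂ = c₂ - f₁ * b₂ := by rw [hc₂]; ring
  have hp₁2 : p₁ ^ 2 = (c₁ - f₁ * b₁) ^ 2 := by rw [← hςp₁, mul_pow, hς2, one_mul]
  have hp₂2 : p₂ ^ 2 = (c₂ - f₁ * b₂) ^ 2 := by rw [← hςp₂, mul_pow, hς2, one_mul]
  have expand : ρ * (ς * lφ + f₁ * lt + f₂ * (b₁ ^ 2 + b₂ ^ 2) + l * (c₁ ^ 2 + c₂ ^ 2)) =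
      ρ * (ς * lφ) + ρ * f₁ * lt + ρ * f₂ * (b₁ ^ 2 + b₂ ^ 2) + l * ρ * (c₁ ^ 2 + c₂ ^ 2) := by
    ring
  have expand2 : ς * (2 * κ * (p₁ * b₁ + p₂ * b₂) + t * κ' * (p₁ ^ 2 + p₂ ^ 2) + N * w₁) =
      2 * κ * ((ς * p₁) * b₁ + (ς * p₂) * b₂) + ς * t * κ' * (p₁ ^ 2 + p₂ ^ 2) + N * (ς * w₁) := by
    ring
  have hleft : ρ * (N * σ * (h * w₂)) = ρ * f₁ * (N * w₂) - m * t * ρ * N * w₂ := by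
    rw [hf₁]; ring
  rw [hleft, expand, hlφ, expand2, hlt, hςp₁, hςp₂, hp₁2, hp₂2]
  linear_combination q1 + q2 + hNg

lemma abs_sinh_mul_abs {K t w : ℝ} (hK : 0 < K) (htw : 0 ≤ t * w) :
    |Real.sinh (K * t)| * |w| = Real.sinh (K * t) * w := by
  rw [← abs_mul]
  apply abs_of_nonneg
  rcases lt_trichotomy t 0 with h0 | h0 | h0
  · have : Real.sinh (K * t) ≤ 0 :=
      Real.sinh_nonpos_iff.2 (mul_nonpos_of_nonneg_of_nonpos hK.le h0.le)
    exact mul_nonneg_of_nonpos_of_nonpos this (by nlinarith)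
  · simp [h0]
  · have : 0 ≤ Real.sinh (K * t) := Real.sinh_nonneg_iff.2 (by positivity)
    exact mul_nonneg this (by nlinarith)

/-- The algebraic core of the subsolution property. -/
lemma exists_profile_constants {M δ m : ℝ} (hM : 0 ≤ M) (hδ : 0 ≤ δ) (hm : 0 < m) :
    ∃ K σ l : ℝ, 0 < K ∧ 0 < σ ∧ 0 < l ∧
      ∀ κ κ' t ρ ς w₁ w₂ N p₁ p₂ b₁ b₂ lφ lt : ℝ, |κ| ≤ M → |κ'| ≤ M → |t| ≤ δ →
        2 / 3 ≤ ρ → ρ = 1 - κ * t → (ς = 1 ∨ ς = -1) → 0 ≤ N →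
        0 ≤ m * ρ - 2 * κ * m * t + ς * κ' * m ^ 2 * t ^ 3 - κ * ρ ^ 2 * m ^ 3 * t ^ 3 →
        0 ≤ ς * w₁ + m * t * ρ * w₂ → 0 ≤ t * w₂ →
        ρ * lφ - 2 * κ * (p₁ * b₁ + p₂ * b₂) - t * κ' * (p₁ ^ 2 + p₂ ^ 2) = N * w₁ →
        lt + κ * ρ * (p₁ ^ 2 + p₂ ^ 2) = N * w₂ →
        N * σ * |Real.sinh (K * t)| * |w₂| ≤
          ς * lφ + (m * t + σ * Real.sinh (K * t)) * lt
            + (m + σ * (K * Real.cosh (K * t))) * (b₁ ^ 2 + b₂ ^ 2)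
            + l * ((ς * p₁ + (m * t + σ * Real.sinh (K * t)) * b₁) ^ 2 +
                (ς * p₂ + (m * t + σ * Real.sinh (K * t)) * b₂) ^ 2) := by
  obtain ⟨K, hK⟩ : ∃ K, K = 3 / 2 * (2 * M + M * δ * (2 * (m * δ) + 1) +
      M * (1 + M * δ) ^ 2 * (3 * (m * δ) ^ 2 + 3 * (m * δ) + 1) + 1) := ⟨_, rfl⟩
  have hK0 : 0 < K := by rw [hK]; positivity
  obtain ⟨σ, hσ⟩ : ∃ σ, σ = 1 / (1 + Real.sinh (K * δ)) := ⟨_, rfl⟩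
  have hsd : 0 ≤ Real.sinh (K * δ) := Real.sinh_nonneg_iff.2 (by positivity)
  have hσ0 : 0 < σ := by rw [hσ]; positivity
  set F := m * δ + 1 with hF
  have hF0 : 0 ≤ F := by positivity
  set R := 1 + M * δ with hR
  have hR0 : 0 ≤ R := by positivity
  set Y₀ := 2 * M + 2 * (δ * M * F) + 2 * (M * R ^ 2 * F ^ 2) with hY₀
  set X₀ := δ * M + M * R ^ 2 * F with hX₀
  refine ⟨K, σ, 3 / 2 * (X₀ + Y₀ ^ 2 / (4 * σ)) + 1, hK0, hσ0, by positivity, ?_⟩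
  intro κ κ' t ρ ς w₁ w₂ N p₁ p₂ b₁ b₂ lφ lt hκ hκ' ht hρ hρe hς hN hform hgrad htw e1 e2
  set l := 3 / 2 * (X₀ + Y₀ ^ 2 / (4 * σ)) + 1 with hl
  have hςa : |ς| = 1 := by rcases hς with rfl | rfl <;> simp
  have hς2 : ς ^ 2 = 1 := by rcases hς with rfl | rfl <;> norm_num
  have hρR : ρ ≤ R := by
    have : |κ * t| ≤ M * δ := by rw [abs_mul]; gcongr
    have := (abs_le.1 this).1
    rw [hρe, hR]; linarith
  have hsinh : |Real.sinh (K * t)| ≤ Real.sinh (K * δ) := by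
    rw [Real.abs_sinh, Real.sinh_le_sinh, abs_mul, abs_of_pos hK0]
    gcongr
  have hσh : σ * |Real.sinh (K * t)| ≤ 1 := by
    calc σ * |Real.sinh (K * t)| ≤ σ * (1 + Real.sinh (K * δ)) := by gcongr; linarith
      _ = 1 := by rw [hσ]; field_simp
  have hZ := profile_form_lower hM hδ hm.le hK.ge hσ0 hσh hκ hκ' ht hρ hρR hςa hform
  set h := Real.sinh (K * t) with hh
  set f₁ := m * t + σ * h with hf₁
  set f₂ := m + σ * (K * Real.cosh (K * t)) with hf₂
  have hf₁F : |f₁| ≤ F := by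
    refine (abs_add_le _ _).trans ?_
    rw [abs_mul, abs_mul, abs_of_pos hm, abs_of_pos hσ0]
    rw [hF]; gcongr
  have hρa : |ρ| ≤ R := by rw [abs_of_nonneg (by linarith)]; exact hρR
  have hY : |2 * κ - 2 * (ς * t * κ' * f₁) + 2 * (κ * ρ ^ 2 * f₁ ^ 2)| ≤ Y₀ := by
    refine (abs_add_le _ _).trans (add_le_add ((abs_sub _ _).trans (add_le_add ?_ ?_)) ?_)
    · rw [abs_mul, abs_two]; gcongr
    · rw [abs_mul, abs_two, abs_mul, abs_mul, abs_mul, hςa, one_mul]; gcongr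
    · rw [abs_mul, abs_two, abs_mul, abs_mul, abs_pow, abs_pow]; gcongr
  have hX : |ς * t * κ' - κ * ρ ^ 2 * f₁| ≤ X₀ := by
    refine (abs_sub _ _).trans (add_le_add ?_ ?_)
    · rw [abs_mul, abs_mul, hςa, one_mul]; gcongr
    · rw [abs_mul, abs_mul, abs_pow]; gcongr
  have hX' : Y₀ ^ 2 / (4 * σ) ≤ ς * t * κ' - κ * ρ ^ 2 * f₁ + l * ρ := by
    have h1 := (abs_le.1 hX).1
    have h2 : X₀ + Y₀ ^ 2 / (4 * σ) ≤ l * ρ := by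
      have h0 : 0 ≤ X₀ + Y₀ ^ 2 / (4 * σ) := by positivity
      calc X₀ + Y₀ ^ 2 / (4 * σ) = 3 / 2 * (X₀ + Y₀ ^ 2 / (4 * σ)) * (2 / 3) := by ring
        _ ≤ l * ρ := by
          apply mul_le_mul _ hρ (by norm_num) (by positivity)
          rw [hl]; linarith
    linarith
  have q1 := quadratic_form_nonneg (b := b₁) (c := ς * p₁ + f₁ * b₁) hσ0 hZ hY hX'
  have q2 := quadratic_form_nonneg (b := b₂) (c := ς * p₂ + f₁ * b₂) hσ0 hZ hY hX'
  have hhw : |h| * |w₂| = h * w₂ := abs_sinh_mul_abs hK0 htw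
  rw [mul_assoc (N * σ), hhw]
  exact profile_combine (by linarith) hς2 hN hf₁ hgrad e1 e2 q1 q2

section Subsolution

variable {Γ : Set ℂ} {τ : ℝ → ℂ} {W : ℂ → ℝ} {δ₁ m : ℝ}

lemma exists_bound_of_periodic {f : ℝ → ℝ} {c : ℝ} (hc : 0 < c) (hf : Continuous f)
    (hp : Function.Periodic f c) : ∃ M, 0 ≤ M ∧ ∀ s, |f s| ≤ M := by
  obtain ⟨M, hM⟩ := isCompact_Icc.exists_bound_of_continuousOn (s := Icc 0 c) hf.continuousOn
  have hM0 : 0 ≤ M := (norm_nonneg _).trans (hM 0 ⟨le_rfl, hc.le⟩)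
  refine ⟨M, hM0, fun s => ?_⟩
  obtain ⟨y, hy, hys⟩ := hp.exists_mem_Ico₀ hc s
  rw [hys]
  exact hM y ⟨hy.1, hy.2.le⟩

lemma Function.Periodic.deriv_periodic {F : Type*} [NormedAddCommGroup F] [NormedSpace ℝ F]
    {f : ℝ → F} {c : ℝ} (hp : Function.Periodic f c) : Function.Periodic (deriv f) c := by
  intro s
  rw [← deriv_comp_add_const f c s]
  congr 1
  funext y
  exact hp y

lemma ArcParam.periodic_curv (hτ : ArcParam Γ τ) : Function.Periodic (curv τ) (2 * Real.pi) := by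
  intro s
  unfold curv
  rw [hτ.periodic.deriv_periodic s, hτ.periodic.deriv_periodic.deriv_periodic s]

lemma ArcParam.exists_curv_bound (hτ : ArcParam Γ τ) :
    ∃ M, 0 ≤ M ∧ ∀ s, |curv τ s| ≤ M ∧ |deriv (curv τ) s| ≤ M := by
  obtain ⟨M₁, h₁, hM₁⟩ := exists_bound_of_periodic Real.two_pi_pos (contDiff_curv hτ).continuous
    hτ.periodic_curv
  obtain ⟨M₂, h₂, hM₂⟩ := exists_bound_of_periodic Real.two_pi_pos
    (contDiff_deriv_of_infty (contDiff_curv hτ)).continuous hτ.periodic_curv.deriv_periodic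
  exact ⟨max M₁ M₂, le_max_of_le_left h₁, fun s =>
    ⟨(hM₁ s).trans (le_max_left _ _), (hM₂ s).trans (le_max_right _ _)⟩⟩

lemma contDiffAt_coords (hτ : ArcParam Γ τ) {u : ℂ → ℂ} {φ t : ℂ → ℝ} {x : ℂ} {n : ℕ∞}
    (hu : ContDiffAt ℝ n u x) (hφ : ContinuousAt φ x) (ht : ContinuousAt t x)
    (he : u =ᶠ[𝓝 x] fun y => tubePt τ (φ y) (t y)) (hj : tubeJac τ (φ x) (t x) ≠ 0) :
    ContDiffAt ℝ n φ x ∧ ContDiffAt ℝ n t x := by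
  obtain ⟨G, hG, -, hG1, -⟩ := exists_tubePt_inverse hτ hj
  have hev : (fun y => (φ y, t y)) =ᶠ[𝓝 x] fun y => G (u y) := by
    filter_upwards [he, (hφ.prodMk ht).eventually hG1] with y h1 h2
    rw [h1, h2]
  have hGu : ContDiffAt ℝ n (fun y => G (u y)) x := by
    refine ContDiffAt.comp x ?_ hu
    rw [he.eq_of_nhds]
    exact hG.of_le (WithTop.coe_le_coe.2 le_top)
  have h := hGu.congr_of_eventuallyEq hev
  exact ⟨contDiff_fst.contDiffAt.comp x h, contDiff_snd.contDiffAt.comp x h⟩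

/-- Normal coordinates of a solution of the Ginzburg–Landau type system. -/
structure TubeSol (Γ : Set ℂ) (τ : ℝ → ℂ) (W : ℂ → ℝ) (Ω : Set ℂ) (δ₁ m N : ℝ)
    (t φ : ℂ → ℝ) : Prop where
  cont_t : ContinuousOn t (closure Ω)
  cont_φ : ContinuousOn φ (closure Ω)
  smooth_t : ∀ x ∈ Ω, ContDiffAt ℝ 2 t x
  smooth_φ : ∀ x ∈ Ω, ContDiffAt ℝ 2 φ x
  pde : ∀ x ∈ Ω, lapC (fun y => tubePt τ (φ y) (t y)) x = N • gradW W (tubePt τ (φ x) (t x))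
  dist : ∀ x ∈ closure Ω, infDist (tubePt τ (φ x) (t x)) Γ = |t x|
  le : ∀ x ∈ closure Ω, |t x| ≤ δ₁
  bounds : ∀ x ∈ closure Ω, TubeBounds τ W m (φ x) (t x)

lemma lapC_congr {u v : ℂ → ℂ} {x : ℂ} (h : u =ᶠ[𝓝 x] v) : lapC u x = lapC v x := by
  have key : ∀ w : ℂ, fderiv ℝ (fun y => fderiv ℝ u y w) x = fderiv ℝ (fun y => fderiv ℝ v y w) x := by
    intro w
    refine Filter.EventuallyEq.fderiv_eq ?_
    filter_upwards [h.fderiv (𝕜 := ℝ)] with y hy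
    rw [hy]
  unfold lapC
  rw [key, key]

lemma PhaseDecomp.tubeSol (hmax : MaxPrinciple Γ τ W δ₁ m) (hτ : ArcParam Γ τ)
    (hW : ContDiff ℝ ∞ W) (hm : 0 < m) (hδ₁ : 0 < δ₁) {Ω : Set ℂ} (hΩ : IsOpen Ω)
    {u : ℂ → ℂ} {t φ : ℂ → ℝ} {ε : ℝ} (hu : SolvesGL W Ω ε u)
    (hd : PhaseDecomp Γ τ (closure Ω) u t φ) (hle : ∀ x ∈ closure Ω, infDist (u x) Γ ≤ δ₁) :
    TubeSol Γ τ W Ω δ₁ m (ε ^ 2)⁻¹ t φ := by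
  obtain ⟨ht, hφ, hd⟩ := hd
  have hdist : ∀ x ∈ closure Ω, infDist (tubePt τ (φ x) (t x)) Γ = |t x| := by
    intro x hx
    obtain ⟨h1, h2⟩ := hd x hx
    rw [h2, h1]; rfl
  have hle' : ∀ x ∈ closure Ω, |t x| ≤ δ₁ := fun x hx => (hd x hx).2 ▸ hle x hx
  have hb : ∀ x ∈ closure Ω, TubeBounds τ W m (φ x) (t x) := fun x hx =>
    hmax.tubeBounds hτ hW hm hδ₁ (hle' x hx) (hdist x hx)
  have hev : ∀ x ∈ Ω, u =ᶠ[𝓝 x] fun y => tubePt τ (φ y) (t y) := by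
    intro x hx
    filter_upwards [hΩ.mem_nhds hx] with y hy using (hd y (subset_closure hy)).1
  have hs : ∀ x ∈ Ω, ContDiffAt ℝ 2 φ x ∧ ContDiffAt ℝ 2 t x := by
    intro x hx
    have hn : closure Ω ∈ 𝓝 x := mem_of_superset (hΩ.mem_nhds hx) subset_closure
    refine contDiffAt_coords hτ (n := 2) ((contDiff_infty.1 hu.1 2).contDiffAt)
      (hφ.continuousAt hn) (ht.continuousAt hn) (hev x hx) ?_
    have := (hb x (subset_closure hx)).jac
    intro h0
    rw [h0] at this
    norm_num at this
  refine ⟨ht, hφ, fun x hx => (hs x hx).2, fun x hx => (hs x hx).1, fun x hx => ?_, hdist, hle', hb⟩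
  rw [← lapC_congr (hev x hx), hu.2 x hx, (hev x hx).eq_of_nhds]

lemma TubeSol.components (hτ : ArcParam Γ τ) {Ω : Set ℂ} {N : ℝ} {t φ : ℂ → ℝ}
    (h : TubeSol Γ τ W Ω δ₁ m N t φ) {x : ℂ} (hx : x ∈ Ω) :
    tubeJac τ (φ x) (t x) * lapR φ x
        - 2 * curv τ (φ x) * (fderiv ℝ φ x 1 * fderiv ℝ t x 1 +
            fderiv ℝ φ x Complex.I * fderiv ℝ t x Complex.I)
        - t x * deriv (curv τ) (φ x) * (fderiv ℝ φ x 1 ^ 2 + fderiv ℝ φ x Complex.I ^ 2) =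
      N * (frameGrad τ W (φ x) (t x)).re ∧
    lapR t x + curv τ (φ x) * tubeJac τ (φ x) (t x) *
          (fderiv ℝ φ x 1 ^ 2 + fderiv ℝ φ x Complex.I ^ 2) =
      N * (frameGrad τ W (φ x) (t x)).im := by
  have h1 := h.pde x hx
  rw [lapC_tubePt_comp hτ (h.smooth_φ x hx) (h.smooth_t x hx)] at h1
  have h2 : conj (deriv τ (φ x)) * _ = conj (deriv τ (φ x)) * _ :=
    congrArg (fun z => conj (deriv τ (φ x)) * z) h1
  rw [← mul_assoc, conj_mul_tangent hτ, one_mul, mul_smul_comm] at h2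
  constructor
  · have := congrArg Complex.re h2
    simpa only [Complex.add_re, Complex.ofReal_re, Complex.I_mul_re, Complex.ofReal_im, neg_zero,
      add_zero, Complex.smul_re, smul_eq_mul, frameGrad] using this
  · have := congrArg Complex.im h2
    simpa only [Complex.add_im, Complex.ofReal_re, Complex.I_mul_im, Complex.ofReal_im,
      zero_add, Complex.smul_im, smul_eq_mul, frameGrad] using this

lemma TubeBounds.mul_im_nonneg (hm : 0 < m) {s t : ℝ} (h : TubeBounds τ W m s t) :
    0 ≤ t * (frameGrad τ W s t).im := by
  have h1 := h.grad 1 (Or.inl rfl)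
  have h2 := h.grad (-1) (Or.inr rfl)
  have h3 : 0 ≤ m * tubeJac τ s t * (t * (frameGrad τ W s t).im) := by linarith
  exact nonneg_of_mul_nonneg_right h3 (mul_pos hm (by linarith [h.jac]))

/-- The exponential of the corrected phase is a quantified subsolution. -/
theorem exists_subsolution (hτ : ArcParam Γ τ) (hm : 0 < m) (hδ₁ : 0 < δ₁) :
    ∃ K σ l : ℝ, 0 < K ∧ 0 < σ ∧ 0 < l ∧ ∀ (W : ℂ → ℝ) (Ω : Set ℂ) (N : ℝ) (t φ : ℂ → ℝ),
      0 ≤ N → TubeSol Γ τ W Ω δ₁ m N t φ → ∀ ς : ℝ, ς = 1 ∨ ς = -1 → ∀ x ∈ Ω,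
        l * Real.exp (l * (ς * φ x + phaseProfile m σ K (t x))) *
            (N * σ * |Real.sinh (K * t x)| * |(frameGrad τ W (φ x) (t x)).im|) ≤
          lapR (fun y => Real.exp (l * (ς * φ y + phaseProfile m σ K (t y)))) x := by
  obtain ⟨M, hM, hκ⟩ := hτ.exists_curv_bound
  obtain ⟨K, σ, l, hK, hσ, hl, H⟩ := exists_profile_constants hM hδ₁.le hm
  refine ⟨K, σ, l, hK, hσ, hl, fun W Ω N t φ hN hs ς hς x hx => ?_⟩
  have hxc := subset_closure hx
  have hb := hs.bounds x hxc
  obtain ⟨e1, e2⟩ := hs.components hτ hx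
  have key := H _ _ _ _ ς _ _ N _ _ _ _ _ _ (hκ (φ x)).1 (hκ (φ x)).2 (hs.le x hxc) hb.jac rfl
    hς hN (hb.form ς hς) (hb.grad ς hς) (hb.mul_im_nonneg hm) e1 e2
  have hφ := hs.smooth_φ x hx
  have ht := hs.smooth_t x hx
  have hft : ContDiffAt ℝ 2 (fun y => phaseProfile m σ K (t y)) x :=
    (contDiff_phaseProfile m σ K).contDiffAt.comp x ht
  have hςφ : ContDiffAt ℝ 2 (fun y => ς * φ y) x := contDiffAt_const.mul hφ
  have hψ : ContDiffAt ℝ 2 (fun y => ς * φ y + phaseProfile m σ K (t y)) x := hςφ.add hft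
  have hexp1 : ∀ r, HasDerivAt (fun r => Real.exp (l * r)) (l * Real.exp (l * r)) r := by
    intro r
    have := ((hasDerivAt_id r).const_mul l).exp
    refine this.congr_deriv ?_
    simp [mul_comm]
  have hexp2 : ∀ r, HasDerivAt (fun r => l * Real.exp (l * r)) (l * (l * Real.exp (l * r))) r :=
    fun r => (hexp1 r).const_mul l
  have hd : ∀ v, fderiv ℝ (fun y => ς * φ y + phaseProfile m σ K (t y)) x v =
      ς * fderiv ℝ φ x v + (m * t x + σ * Real.sinh (K * t x)) * fderiv ℝ t x v := by
    intro v
    have h1 := ((hφ.differentiableAt (by norm_num)).hasFDerivAt.const_mul ς).add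
      ((hasDerivAt_phaseProfile m σ hK.ne' (t x)).comp_hasFDerivAt x
        (ht.differentiableAt (by norm_num)).hasFDerivAt)
    have h2 : fderiv ℝ (fun y => ς * φ y + phaseProfile m σ K (t y)) x = _ := h1.fderiv
    rw [h2]; simp
  rw [lapR_comp hexp1 hexp2 hψ, lapR_add hςφ hft, lapR_const_mul ς hφ,
    lapR_comp (hasDerivAt_phaseProfile m σ hK.ne') (hasDerivAt_phaseProfile_deriv m σ K) ht,
    hd, hd]
  have hE : 0 ≤ l * Real.exp (l * (ς * φ x + phaseProfile m σ K (t x))) := by positivity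
  have := mul_le_mul_of_nonneg_left key hE
  refine this.trans (le_of_eq ?_)
  ring

lemma fderiv_line_eq {f : ℂ → ℝ} {x v : ℂ} (hf : ContDiffAt ℝ 2 f x) :
    deriv (deriv fun r : ℝ => f (x + r • v)) 0 = fderiv ℝ (fun y => fderiv ℝ f y v) x v := by
  have hc : ContinuousAt (fun r : ℝ => x + r • v) 0 := by fun_prop
  have he : (deriv fun r : ℝ => f (x + r • v)) =ᶠ[𝓝 0] fun r : ℝ => fderiv ℝ f (x + r • v) v := by
    have hev : ∀ᶠ r : ℝ in 𝓝 0, ContDiffAt ℝ 2 f (x + r • v) := by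
      apply hc.eventually
      simpa using eventually_contDiffAt_two hf
    filter_upwards [hev] with r hr
    have h1 := hasDerivAt_line (hr.differentiableAt (by norm_num)) v
    have h2 : HasDerivAt (fun q : ℝ => f (x + r • v + (q - r) • v)) (fderiv ℝ f (x + r • v) v) r := by
      have h3 : HasDerivAt (fun q : ℝ => q - r) 1 r := (hasDerivAt_id r).sub_const r
      have h1' : HasDerivAt (fun q : ℝ => f (x + r • v + q • v)) (fderiv ℝ f (x + r • v) v)
          (r - r) := by rwa [sub_self]
      exact (HasDerivAt.comp (h := fun q : ℝ => q - r) r h1' h3).congr_deriv (mul_one _)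
    have h4 : (fun q : ℝ => f (x + r • v + (q - r) • v)) = fun q : ℝ => f (x + q • v) := by
      funext q
      rw [sub_smul]; congr 1; abel
    rw [h4] at h2
    exact h2.deriv
  rw [he.deriv_eq]
  exact (hasDerivAt_line (differentiableAt_fderiv_apply hf v) v).deriv

lemma lapR_nonneg_of_isLocalMin {f : ℂ → ℝ} {x : ℂ} (hf : ContDiffAt ℝ 2 f x)
    (h : IsLocalMin f x) : 0 ≤ lapR f x := by
  have key : ∀ v : ℂ, 0 ≤ fderiv ℝ (fun y => fderiv ℝ f y v) x v := by
    intro v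
    have hc : ContinuousAt (fun r : ℝ => x + r • v) 0 := by fun_prop
    rw [← fderiv_line_eq hf]
    refine deriv_deriv_nonneg_of_isLocalMin ?_ ?_
    · refine ContinuousAt.comp (f := fun r : ℝ => x + r • v) ?_ hc
      simpa using hf.continuousAt
    · have h1 : ∀ᶠ y in 𝓝 (x + (0 : ℝ) • v), f x ≤ f y := by
        rw [zero_smul, add_zero]; exact h
      have := hc.eventually h1
      filter_upwards [this] with r hr
      simpa using hr
  exact add_nonneg (key 1) (key Complex.I)

lemma lapR_neg (f : ℂ → ℝ) (x : ℂ) : lapR (fun y => -f y) x = -lapR f x := by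
  simp only [lapR, fderiv_fun_neg, neg_apply, neg_add]

/-- Strict weak maximum principle. -/
lemma le_of_lapR_pos {U : Set ℂ} (hU : IsOpen U) (hb : IsBounded U) {h : ℂ → ℝ} {M : ℝ}
    (hc : ContinuousOn h (closure U)) (h2 : ∀ x ∈ U, ContDiffAt ℝ 2 h x)
    (hl : ∀ x ∈ U, 0 < lapR h x) (hM : ∀ x ∈ frontier U, h x ≤ M) :
    ∀ x ∈ closure U, h x ≤ M := by
  intro x hx
  obtain ⟨y, hy, hmax⟩ := hb.isCompact_closure.exists_isMaxOn ⟨x, hx⟩ hc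
  refine (hmax hx).trans ?_
  by_cases hyU : y ∈ U
  · exfalso
    have hloc : IsLocalMin (fun z => -h z) y := by
      filter_upwards [hU.mem_nhds hyU] with z hz
      exact neg_le_neg (hmax (subset_closure hz))
    have := lapR_nonneg_of_isLocalMin (h2 y hyU).neg hloc
    rw [lapR_neg] at this
    linarith [hl y hyU]
  · exact hM y ⟨hy, by rwa [hU.interior_eq]⟩

end Subsolution

/-- The squared distance to `p`, in coordinates. -/
def sqDist (p x : ℂ) : ℝ := (x.re - p.re) ^ 2 + (x.im - p.im) ^ 2

lemma sqDist_eq (p x : ℂ) : sqDist p x = ‖x - p‖ ^ 2 := by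
  rw [← Complex.normSq_eq_norm_sq, Complex.normSq_apply]
  simp [sqDist, sq]

lemma contDiff_sqDist (p : ℂ) {n : WithTop ℕ∞} : ContDiff ℝ n (sqDist p) := by
  have h1 : ContDiff ℝ n (fun y : ℂ => y.re) := Complex.reCLM.contDiff
  have h2 : ContDiff ℝ n (fun y : ℂ => y.im) := Complex.imCLM.contDiff
  exact ((h1.sub contDiff_const).pow 2).add ((h2.sub contDiff_const).pow 2)

lemma hasFDerivAt_sqDist (p x : ℂ) : HasFDerivAt (sqDist p)
    ((2 * (x.re - p.re)) • Complex.reCLM + (2 * (x.im - p.im)) • Complex.imCLM) x := by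
  have h1 := ((Complex.reCLM.hasFDerivAt (x := x)).sub_const p.re).pow 2
  have h2 := ((Complex.imCLM.hasFDerivAt (x := x)).sub_const p.im).pow 2
  refine (h1.add h2).congr_fderiv ?_
  ext
  simp

lemma fderiv_sqDist_one (p x : ℂ) : fderiv ℝ (sqDist p) x 1 = 2 * (x.re - p.re) := by
  simp [(hasFDerivAt_sqDist p x).fderiv]

lemma fderiv_sqDist_I (p x : ℂ) : fderiv ℝ (sqDist p) x Complex.I = 2 * (x.im - p.im) := by
  simp [(hasFDerivAt_sqDist p x).fderiv]

lemma lapR_sqDist (p x : ℂ) : lapR (sqDist p) x = 4 := by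
  have h1 : HasFDerivAt (fun y : ℂ => 2 * (y.re - p.re)) ((2 : ℝ) • Complex.reCLM) x :=
    ((Complex.reCLM.hasFDerivAt (x := x)).sub_const p.re).const_mul 2
  have h2 : HasFDerivAt (fun y : ℂ => 2 * (y.im - p.im)) ((2 : ℝ) • Complex.imCLM) x :=
    ((Complex.imCLM.hasFDerivAt (x := x)).sub_const p.im).const_mul 2
  unfold lapR
  simp only [fderiv_sqDist_one, fderiv_sqDist_I, h1.fderiv, h2.fderiv]
  norm_num

lemma lapR_radial {F F₁ : ℝ → ℝ} {p x : ℂ} {c : ℝ}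
    (hF : ∀ᶠ r in 𝓝 (sqDist p x), HasDerivAt F (F₁ r) r)
    (hF₁ : HasDerivAt F₁ c (sqDist p x)) :
    lapR (fun y => F (sqDist p y)) x = 4 * F₁ (sqDist p x) + 4 * c * sqDist p x := by
  rw [lapR_comp_of_eventually hF hF₁ (contDiff_sqDist p).contDiffAt, lapR_sqDist,
    fderiv_sqDist_one, fderiv_sqDist_I]
  unfold sqDist
  ring

lemma lapR_neg_inv_sqDist {p x : ℂ} (hx : sqDist p x ≠ 0) :
    lapR (fun y => -(sqDist p y)⁻¹) x = -4 * ((sqDist p x)⁻¹) ^ 2 := by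
  have h1 : ∀ᶠ r : ℝ in 𝓝 (sqDist p x), HasDerivAt (fun r => -r⁻¹) ((r ^ 2)⁻¹) r := by
    filter_upwards [isOpen_ne.mem_nhds hx] with r hr
    exact (hasDerivAt_inv hr).neg.congr_deriv (by simp)
  have h2 : HasDerivAt (fun r : ℝ => (r ^ 2)⁻¹) (-(2 * sqDist p x) / ((sqDist p x) ^ 2) ^ 2)
      (sqDist p x) := by
    have := (hasDerivAt_pow 2 (sqDist p x)).inv (pow_ne_zero 2 hx)
    exact this.congr_deriv (by simp)
  rw [lapR_radial h1 h2]
  field_simp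
  ring

section Geometry

variable {Ω : Set ℂ} {γ : ℝ → ℂ} {L : ℝ}

lemma BoundaryParam.mem_frontier (h : BoundaryParam Ω γ L) (s : ℝ) : γ s ∈ frontier Ω :=
  h.srange ▸ mem_range_self s

lemma BoundaryParam.isCompact_frontier (h : BoundaryParam Ω γ L) : IsCompact (frontier Ω) := by
  rw [← h.srange]
  exact h.periodic.compact_of_continuous h.Lpos.ne' h.smooth.continuous

lemma BoundaryParam.hasDerivAt (h : BoundaryParam Ω γ L) (s : ℝ) : HasDerivAt γ (deriv γ s) s :=
  ContDiff.hasDerivAt_of_infty h.smooth s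

/-- A quadratic bound for the deviation of the boundary curve from its tangent. -/
lemma BoundaryParam.exists_taylor (h : BoundaryParam Ω γ L) :
    ∃ B, 0 ≤ B ∧ ∀ s a : ℝ, ‖γ (s + a) - γ s - a • deriv γ s‖ ≤ B * a ^ 2 := by
  have h1 := contDiff_deriv_of_infty h.smooth
  have h2 := contDiff_deriv_of_infty h1
  obtain ⟨B, hB0, hB⟩ := exists_bound_of_periodic (f := fun s => ‖deriv (deriv γ) s‖) h.Lpos
    h2.continuous.norm (fun s => congrArg norm (h.periodic.deriv_periodic.deriv_periodic s))
  refine ⟨B, hB0, fun s a => ?_⟩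
  have hlip : ∀ b, ‖deriv γ (s + b) - deriv γ s‖ ≤ B * |b| := by
    intro b
    have := convex_univ.norm_image_sub_le_of_norm_deriv_le (f := deriv γ) (C := B)
      (fun x _ => (ContDiff.hasDerivAt_of_infty h1 x).differentiableAt)
      (fun x _ => by simpa using hB x) (mem_univ s) (mem_univ (s + b))
    simpa using this
  have hd : ∀ b, HasDerivAt (fun b : ℝ => γ (s + b) - γ s - b • deriv γ s)
      (deriv γ (s + b) - deriv γ s) b := by
    intro b
    have h3 := (h.hasDerivAt (s + b)).comp_const_add s b
    have h4 : HasDerivAt (fun b : ℝ => b • deriv γ s) (deriv γ s) b := by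
      simpa using (hasDerivAt_id b).smul_const (deriv γ s)
    exact (h3.sub_const (γ s)).sub h4
  have := (convex_closedBall (0 : ℝ) |a|).norm_image_sub_le_of_norm_hasDerivWithin_le
    (C := B * |a|) (fun x _ => (hd x).hasDerivWithinAt)
    (fun x hx => (hlip x).trans (by
      have : |x| ≤ |a| := by simpa using hx
      gcongr)) (x := 0) (y := a) (by simp) (by simp)
  simpa [← abs_mul, mul_assoc, ← sq] using this

/-- Boundary points stay outside balls of a uniform radius tangent to the boundary. -/
lemma BoundaryParam.exists_tangent_radius (h : BoundaryParam Ω γ L) :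
    ∃ r, 0 < r ∧ ∀ ς : ℝ, |ς| = 1 → ∀ s s',
      2 * r * (conj (Complex.I * deriv γ s) * (γ s' - γ s)).re * ς ≤ ‖γ s' - γ s‖ ^ 2 := by
  obtain ⟨B, hB0, hB⟩ := h.exists_taylor
  obtain ⟨a, ha⟩ : ∃ a, a = 1 / (2 * (B + 1)) := ⟨_, rfl⟩
  have ha0 : 0 < a := by rw [ha]; positivity
  have hBa : B * a ≤ 1 / 2 := by
    rw [ha, ← mul_div_assoc, mul_one, div_le_iff₀ (by positivity)]; linarith
  have hcont : Continuous fun z : ℝ × ℝ => ‖γ (z.1 + z.2) - γ z.1‖ := by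
    have := h.smooth.continuous
    fun_prop
  obtain ⟨c, hc0, hc⟩ : ∃ c, 0 < c ∧ ∀ z ∈ Icc 0 L ×ˢ Icc a (L - a),
      c ≤ ‖γ (z.1 + z.2) - γ z.1‖ := by
    refine (isCompact_Icc.prod isCompact_Icc).exists_forall_le' hcont.continuousOn ?_
    rintro ⟨s, b⟩ ⟨-, hb⟩
    simp only
    rw [norm_pos_iff, sub_ne_zero]
    intro he
    obtain ⟨k, hk⟩ := h.inj _ _ he
    have hL := h.Lpos
    have hb1 : 0 < L * k := by rw [← hk]; linarith [hb.1]
    have hb2 : L * k < L * 1 := by rw [← hk]; linarith [hb.2]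
    have hk1 : (0 : ℝ) < k := (mul_pos_iff_of_pos_left hL).1 hb1
    have hk2 : (k : ℝ) < 1 := lt_of_mul_lt_mul_left hb2 hL.le
    have : 0 < k := by exact_mod_cast hk1
    have : k < 1 := by exact_mod_cast hk2
    omega
  have hunit : ∀ s, ‖conj (Complex.I * deriv γ s)‖ = 1 := by
    intro s; simp [h.arclength]
  have horth : ∀ s, (conj (Complex.I * deriv γ s) * deriv γ s).re = 0 := by
    intro s; simp [Complex.mul_re, Complex.mul_im]; ring
  have hnear : ∀ s b, |b| ≤ a → |(conj (Complex.I * deriv γ s) * (γ (s + b) - γ s)).re| ≤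
      4 * B * ‖γ (s + b) - γ s‖ ^ 2 := by
    intro s b hb
    have h1 := hB s b
    have h2 : |b| / 2 ≤ ‖γ (s + b) - γ s‖ := by
      have h3 : ‖b • deriv γ s‖ - ‖γ (s + b) - γ s‖ ≤ ‖γ (s + b) - γ s - b • deriv γ s‖ := by
        rw [← norm_neg (γ (s + b) - γ s - b • deriv γ s), neg_sub]
        exact norm_sub_norm_le _ _
      rw [norm_smul, h.arclength, mul_one, Real.norm_eq_abs] at h3
      have h4 : B * b ^ 2 ≤ |b| / 2 := by
        rw [← sq_abs]
        calc B * |b| ^ 2 = B * |b| * |b| := by ring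
          _ ≤ B * a * |b| := by gcongr
          _ ≤ 1 / 2 * |b| := by gcongr
          _ = _ := by ring
      linarith
    have h5 : (conj (Complex.I * deriv γ s) * (γ (s + b) - γ s)).re =
        (conj (Complex.I * deriv γ s) * (γ (s + b) - γ s - b • deriv γ s)).re := by
      rw [mul_sub _ (γ (s + b) - γ s), mul_smul_comm, Complex.sub_re, Complex.smul_re, horth]
      simp
    rw [h5]
    refine (Complex.abs_re_le_norm _).trans ?_
    rw [norm_mul, hunit, one_mul]
    refine h1.trans ?_
    have h6 : b ^ 2 ≤ 4 * ‖γ (s + b) - γ s‖ ^ 2 := by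
      rw [← sq_abs]
      have : |b| ≤ 2 * ‖γ (s + b) - γ s‖ := by linarith
      calc |b| ^ 2 ≤ (2 * ‖γ (s + b) - γ s‖) ^ 2 := by gcongr
        _ = _ := by ring
    calc B * b ^ 2 ≤ B * (4 * ‖γ (s + b) - γ s‖ ^ 2) := by gcongr
      _ = _ := by ring
  obtain ⟨r, hr⟩ : ∃ r, r = min (1 / (8 * (B + 1))) (c / 2) := ⟨_, rfl⟩
  have hr0 : 0 < r := by rw [hr]; positivity
  have hrB : 2 * r * (4 * B) ≤ 1 := by
    have : r ≤ 1 / (8 * (B + 1)) := hr ▸ min_le_left _ _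
    rw [le_div_iff₀ (by positivity)] at this
    linarith
  have hrc : 2 * r ≤ c := by
    have : r ≤ c / 2 := hr ▸ min_le_right _ _
    linarith
  refine ⟨r, hr0, fun ς hς s s' => ?_⟩
  suffices hmain : 2 * r * |(conj (Complex.I * deriv γ s) * (γ s' - γ s)).re| ≤
      ‖γ s' - γ s‖ ^ 2 by
    refine le_trans ?_ hmain
    rw [mul_assoc]
    gcongr
    refine (le_abs_self _).trans ?_
    rw [abs_mul, hς, mul_one]
  have fin_near : ∀ s b, |b| ≤ a → 2 * r *
      |(conj (Complex.I * deriv γ s) * (γ (s + b) - γ s)).re| ≤ ‖γ (s + b) - γ s‖ ^ 2 := by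
    intro s b hb
    calc _ ≤ 2 * r * (4 * B * ‖γ (s + b) - γ s‖ ^ 2) := by gcongr; exact hnear s b hb
      _ = 2 * r * (4 * B) * ‖γ (s + b) - γ s‖ ^ 2 := by ring
      _ ≤ 1 * ‖γ (s + b) - γ s‖ ^ 2 := by gcongr
      _ = _ := one_mul _
  obtain ⟨s₁, hs₁, k₁, hk₁⟩ : ∃ s₁ ∈ Ico 0 L, ∃ k : ℤ, s = s₁ + k • L := by
    refine ⟨toIcoMod h.Lpos 0 s, by simpa using toIcoMod_mem_Ico h.Lpos 0 s,
      toIcoDiv h.Lpos 0 s, (toIcoMod_add_toIcoDiv_zsmul _ _ _).symm⟩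
  have hγ₁ : γ s = γ s₁ := by rw [hk₁]; exact h.periodic.zsmul k₁ s₁
  have hγ₁' : deriv γ s = deriv γ s₁ := by
    rw [hk₁]; exact h.periodic.deriv_periodic.zsmul k₁ s₁
  obtain ⟨b, hb, k₂, hk₂⟩ : ∃ b ∈ Ico 0 L, ∃ k : ℤ, s' - s₁ = b + k • L := by
    refine ⟨toIcoMod h.Lpos 0 (s' - s₁), by simpa using toIcoMod_mem_Ico h.Lpos 0 (s' - s₁),
      toIcoDiv h.Lpos 0 (s' - s₁), (toIcoMod_add_toIcoDiv_zsmul _ _ _).symm⟩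
  have hγ₂ : γ s' = γ (s₁ + b) := by
    have : s' = s₁ + b + k₂ • L := by linarith
    rw [this]; exact h.periodic.zsmul k₂ _
  rw [hγ₁, hγ₁', hγ₂]
  by_cases hb1 : b ≤ a
  · exact fin_near s₁ b (by rwa [abs_of_nonneg hb.1])
  by_cases hb2 : L - a ≤ b
  · have hp : γ (s₁ + b) = γ (s₁ + (b - L)) := by
      rw [← h.periodic (s₁ + (b - L))]; congr 1; ring
    rw [hp]
    exact fin_near s₁ (b - L) (by rw [abs_le]; constructor <;> linarith [hb.2])
  · push Not at hb1 hb2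
    have hcb := hc (s₁, b) ⟨⟨hs₁.1, hs₁.2.le⟩, hb1.le, hb2.le⟩
    simp only at hcb
    have h7 : |(conj (Complex.I * deriv γ s₁) * (γ (s₁ + b) - γ s₁)).re| ≤
        ‖γ (s₁ + b) - γ s₁‖ := by
      refine (Complex.abs_re_le_norm _).trans ?_
      rw [norm_mul, hunit, one_mul]
    calc _ ≤ ‖γ (s₁ + b) - γ s₁‖ * ‖γ (s₁ + b) - γ s₁‖ := by gcongr; linarith
      _ = _ := by ring

end Geometry

section Geometry

variable {Ω : Set ℂ} {γ : ℝ → ℂ} {L : ℝ}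

/-- If `z` is nearest to the boundary point `γ s` then `z - γ s` is normal to the boundary. -/
lemma BoundaryParam.normal_of_nearest (h : BoundaryParam Ω γ L) {z : ℂ} {s : ℝ}
    (hs : ∀ s', ‖z - γ s‖ ≤ ‖z - γ s'‖) :
    ∃ q : ℝ, z = γ s + q * (Complex.I * deriv γ s) := by
  have hd : HasDerivAt (fun s' => (z.re - (γ s').re) ^ 2 + (z.im - (γ s').im) ^ 2)
      (2 * (z.re - (γ s).re) * (-(deriv γ s).re) + 2 * (z.im - (γ s).im) * (-(deriv γ s).im)) s := by
    have hr : HasDerivAt (fun s' => (γ s').re) (deriv γ s).re s :=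
      Complex.reCLM.hasFDerivAt.comp_hasDerivAt s (h.hasDerivAt s)
    have hi : HasDerivAt (fun s' => (γ s').im) (deriv γ s).im s :=
      Complex.imCLM.hasFDerivAt.comp_hasDerivAt s (h.hasDerivAt s)
    refine (((hr.const_sub z.re).pow 2).add ((hi.const_sub z.im).pow 2)).congr_deriv ?_
    norm_num
  have hmin : IsLocalMin (fun s' => (z.re - (γ s').re) ^ 2 + (z.im - (γ s').im) ^ 2) s := by
    refine Eventually.of_forall fun s' => ?_
    have e : ∀ s', (z.re - (γ s').re) ^ 2 + (z.im - (γ s').im) ^ 2 = ‖z - γ s'‖ ^ 2 :=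
      fun s' => sqDist_eq (γ s') z
    have h1 : ‖z - γ s‖ ^ 2 ≤ ‖z - γ s'‖ ^ 2 := by
      have := hs s'
      gcongr
    rwa [← e, ← e] at h1
  have h0 := hmin.hasDerivAt_eq_zero hd
  have hu : (deriv γ s).re ^ 2 + (deriv γ s).im ^ 2 = 1 := by
    have := Complex.sq_norm (deriv γ s)
    rw [h.arclength, Complex.normSq_apply] at this
    linarith
  refine ⟨(deriv γ s).re * (z.im - (γ s).im) - (deriv γ s).im * (z.re - (γ s).re), ?_⟩
  apply Complex.ext
  · simp
    linear_combination (-(z.re - (γ s).re)) * hu - (deriv γ s).re / 2 * h0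
  · simp
    linear_combination (-(z.im - (γ s).im)) * hu - (deriv γ s).im / 2 * h0

/-- The centre of the tangent ball. -/
def tangentCentre (γ : ℝ → ℂ) (r ς s : ℝ) : ℂ := γ s + (ς * r : ℝ) * (Complex.I * deriv γ s)

lemma normSq_sub_tangent {a ν : ℂ} {q : ℝ} (hν : ‖ν‖ = 1) :
    ‖a - (q : ℂ) * ν‖ ^ 2 = ‖a‖ ^ 2 - 2 * q * (conj ν * a).re + q ^ 2 := by
  have h1 : ν.re ^ 2 + ν.im ^ 2 = 1 := by
    have := Complex.sq_norm ν
    rw [hν, Complex.normSq_apply] at this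
    linarith
  rw [← Complex.normSq_eq_norm_sq, ← Complex.normSq_eq_norm_sq, Complex.normSq_apply,
    Complex.normSq_apply]
  simp
  linear_combination q ^ 2 * h1

lemma BoundaryParam.norm_normal (h : BoundaryParam Ω γ L) (s : ℝ) :
    ‖Complex.I * deriv γ s‖ = 1 := by simp [h.arclength]

/-- Uniform exterior ball condition, in the form of a quadratic lower bound. -/
theorem BoundaryParam.exists_exterior_ball (h : BoundaryParam Ω γ L) (hΩ : IsOpen Ω)
    (hb : IsBounded Ω) (hne : Ω.Nonempty) :
    ∃ r, 0 < r ∧ ∀ x₀ ∈ frontier Ω, ∃ p, ‖x₀ - p‖ = r ∧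
      ∀ x ∈ closure Ω, r ^ 2 + ‖x - x₀‖ ^ 2 / 2 ≤ ‖x - p‖ ^ 2 := by
  obtain ⟨r, hr, H⟩ := h.exists_tangent_radius
  have hdist : ∀ ς : ℝ, |ς| = 1 → ∀ s, ∀ z : ℂ, ‖z - tangentCentre γ r ς s‖ ^ 2 =
      ‖z - γ s‖ ^ 2 - 2 * r * (conj (Complex.I * deriv γ s) * (z - γ s)).re * ς + r ^ 2 := by
    intro ς hς s z
    have e : z - tangentCentre γ r ς s =
        (z - γ s) - ((ς * r : ℝ) : ℂ) * (Complex.I * deriv γ s) := by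
      unfold tangentCentre; ring
    rw [e, normSq_sub_tangent (h.norm_normal s)]
    have : ς ^ 2 = 1 := by rw [← sq_abs, hς, one_pow]
    linear_combination r ^ 2 * this
  have hfront : ∀ ς : ℝ, |ς| = 1 → ∀ s, ∀ z ∈ frontier Ω, r ≤ ‖z - tangentCentre γ r ς s‖ := by
    intro ς hς s z hz
    rw [← h.srange] at hz
    obtain ⟨s', rfl⟩ := hz
    have h1 := hdist ς hς s (γ s')
    have h2 := H ς hς s s'
    exact abs_le_of_sq_le_sq' (by linarith) (norm_nonneg _) |>.2
  have hball : ∀ ς : ℝ, |ς| = 1 → ∀ s, ball (tangentCentre γ r ς s) r ⊆ Ω ∨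
      ball (tangentCentre γ r ς s) r ⊆ Ωᶜ := by
    intro ς hς s
    have hsub : ball (tangentCentre γ r ς s) r ⊆ Ω ∪ (closure Ω)ᶜ := by
      intro z hz
      by_contra hn
      rw [mem_union, not_or, notMem_compl_iff] at hn
      have := hfront ς hς s z ⟨hn.2, by rw [hΩ.interior_eq]; exact hn.1⟩
      rw [mem_ball, dist_eq_norm] at hz
      linarith
    rcases (convex_ball (tangentCentre γ r ς s) r).isPreconnected.subset_or_subset hΩ
      isClosed_closure.isOpen_compl (disjoint_compl_right.mono_left subset_closure) hsub
      with h1 | h1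
    · exact Or.inl h1
    · exact Or.inr (h1.trans (compl_subset_compl.2 subset_closure))
  have hcont : ∀ ς : ℝ, Continuous (tangentCentre γ r ς) := by
    intro ς
    have h1 := h.smooth.continuous
    have h2 := (contDiff_deriv_of_infty h.smooth).continuous
    unfold tangentCentre
    fun_prop
  have hclopen : ∀ ς : ℝ, |ς| = 1 → IsClopen {s | tangentCentre γ r ς s ∈ Ω} := by
    intro ς hς
    refine ⟨?_, hΩ.preimage (hcont ς)⟩
    have : {s | tangentCentre γ r ς s ∈ Ω} = tangentCentre γ r ς ⁻¹' (closure Ω) := by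
      ext s
      refine ⟨fun hs => subset_closure hs, fun hs => ?_⟩
      by_contra hn
      have := hfront ς hς s _ ⟨hs, by rwa [hΩ.interior_eq]⟩
      rw [sub_self, norm_zero] at this
      linarith
    rw [this]
    exact isClosed_closure.preimage (hcont ς)
  have hall : ∀ ς : ℝ, |ς| = 1 → (∀ s, ball (tangentCentre γ r ς s) r ⊆ Ω) ∨
      (∀ s, ball (tangentCentre γ r ς s) r ⊆ Ωᶜ) := by
    intro ς hς
    rcases isClopen_iff.1 (hclopen ς hς) with h0 | h0
    · right
      intro s
      rcases hball ς hς s with h1 | h1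
      · exact absurd (h1 (mem_ball_self hr)) (eq_empty_iff_forall_notMem.1 h0 s)
      · exact h1
    · left
      intro s
      rcases hball ς hς s with h1 | h1
      · exact h1
      · exact absurd (eq_univ_iff_forall.1 h0 s) (h1 (mem_ball_self hr))
  have hout : ∃ ς : ℝ, |ς| = 1 ∧ ∀ s, ball (tangentCentre γ r ς s) r ⊆ Ωᶜ := by
    by_contra! hcon
    have hin : ∀ ς : ℝ, |ς| = 1 → ∀ s, ball (tangentCentre γ r ς s) r ⊆ Ω := by
      intro ς hς
      rcases hall ς hς with h1 | h1
      · exact h1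
      · obtain ⟨s, hs⟩ := hcon ς hς
        exact absurd (h1 s) hs
    have hopen : IsOpen (closure Ω) := by
      rw [isOpen_iff_mem_nhds]
      intro x hx
      by_cases hxΩ : x ∈ Ω
      · exact mem_of_superset (hΩ.mem_nhds hxΩ) subset_closure
      have hxf : x ∈ frontier Ω := ⟨hx, by rwa [hΩ.interior_eq]⟩
      refine mem_of_superset (ball_mem_nhds x hr) fun z hz => ?_
      obtain ⟨y, hy, hmin⟩ := h.isCompact_frontier.exists_isMinOn ⟨x, hxf⟩
        (f := fun y => ‖z - y‖) (by fun_prop)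
      rw [← h.srange] at hy
      obtain ⟨s, rfl⟩ := hy
      obtain ⟨q, hq⟩ := h.normal_of_nearest (z := z) (s := s) fun s' => hmin (h.mem_frontier s')
      have hqr : |q| < r := by
        have h1 : ‖z - γ s‖ ≤ ‖z - x‖ := hmin hxf
        rw [mem_ball, dist_eq_norm] at hz
        have h2 : ‖z - γ s‖ = |q| := by
          have : z - γ s = q * (Complex.I * deriv γ s) := by rw [hq]; ring
          rw [this, norm_mul, h.norm_normal, mul_one, Complex.norm_real, Real.norm_eq_abs]
        linarith
      have key : ∀ ς : ℝ, |ς| = 1 → |q - ς * r| < r → z ∈ closure Ω := by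
        intro ς hς hlt
        apply subset_closure
        apply hin ς hς s
        rw [mem_ball, dist_eq_norm]
        have : z - tangentCentre γ r ς s = ((q - ς * r : ℝ) : ℂ) * (Complex.I * deriv γ s) := by
          rw [hq]; unfold tangentCentre; push_cast; ring
        rwa [this, norm_mul, h.norm_normal, mul_one, Complex.norm_real, Real.norm_eq_abs]
      rw [abs_lt] at hqr
      rcases lt_trichotomy q 0 with h0 | h0 | h0
      · exact key (-1) (by simp) (by rw [abs_lt]; constructor <;> linarith)
      · rw [hq, h0]
        simpa using (h.mem_frontier s).1
      · exact key 1 (by simp) (by rw [abs_lt]; constructor <;> linarith)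
    have huniv : closure Ω = univ := by
      rcases isClopen_iff.1 ⟨isClosed_closure, hopen⟩ with h0 | h0
      · exact absurd h0 hne.closure.ne_empty
      · exact h0
    have := hb.closure
    rw [huniv] at this
    exact NormedSpace.unbounded_univ ℝ ℂ this
  obtain ⟨ς, hς, hout⟩ := hout
  refine ⟨r / 2, by positivity, fun x₀ hx₀ => ?_⟩
  rw [← h.srange] at hx₀
  obtain ⟨s, rfl⟩ := hx₀
  refine ⟨tangentCentre γ (r / 2) ς s, ?_, fun x hx => ?_⟩
  · have : γ s - tangentCentre γ (r / 2) ς s =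
        ((-(ς * (r / 2)) : ℝ) : ℂ) * (Complex.I * deriv γ s) := by
      unfold tangentCentre; push_cast; ring
    rw [this, norm_mul, h.norm_normal, mul_one, Complex.norm_real, Real.norm_eq_abs, abs_neg,
      abs_mul, hς, one_mul, abs_of_pos (by positivity)]
  · have h1 : r ≤ ‖x - tangentCentre γ r ς s‖ := by
      by_contra! hlt
      have h2 : x ∈ ball (tangentCentre γ r ς s) r := by rwa [mem_ball, dist_eq_norm]
      obtain ⟨z, hz, hzΩ⟩ := mem_closure_iff.1 hx _ isOpen_ball h2
      exact hout s hz hzΩ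
    have h2 : r ^ 2 ≤ ‖x - tangentCentre γ r ς s‖ ^ 2 := by gcongr
    rw [hdist ς hς] at h2
    have e : x - tangentCentre γ (r / 2) ς s =
        (x - γ s) - ((ς * (r / 2) : ℝ) : ℂ) * (Complex.I * deriv γ s) := by
      unfold tangentCentre; ring
    rw [e, normSq_sub_tangent (h.norm_normal s)]
    have : ς ^ 2 = 1 := by rw [← sq_abs, hς, one_pow]
    nlinarith

end Geometry

section Boundary

variable {Ω : Set ℂ}

/-- Subharmonic functions with given boundary values have a uniform upper modulus of continuity
at the boundary. -/
theorem exists_boundary_modulus (hΩ : IsOpen Ω) (hb : IsBounded Ω) {r : ℝ} (hr : 0 < r)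
    (hball : ∀ x₀ ∈ frontier Ω, ∃ p, ‖x₀ - p‖ = r ∧
      ∀ x ∈ closure Ω, r ^ 2 + ‖x - x₀‖ ^ 2 / 2 ≤ ‖x - p‖ ^ 2)
    {b : ℂ → ℝ} (hbc : Continuous b) {η : ℝ} (hη : 0 < η) :
    ∃ d > 0, ∀ h : ℂ → ℝ, ContinuousOn h (closure Ω) → (∀ x ∈ Ω, ContDiffAt ℝ 2 h x) →
      (∀ x ∈ Ω, 0 ≤ lapR h x) → (∀ x ∈ frontier Ω, h x = b x) →
      ∀ x₀ ∈ frontier Ω, ∀ x ∈ closure Ω, ‖x - x₀‖ < d → h x ≤ b x₀ + η := by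
  have hcomp : IsCompact (closure Ω) := hb.isCompact_closure
  obtain ⟨B, hB⟩ := hcomp.exists_bound_of_continuousOn hbc.continuousOn
  obtain ⟨D, hD⟩ := hcomp.isBounded.exists_norm_le
  obtain ⟨ρ, hρ, hmod⟩ := Metric.uniformContinuousOn_iff.1
    (hcomp.uniformContinuousOn_of_continuous hbc.continuousOn) (η / 2) (by positivity)
  obtain ⟨D', hD'⟩ : ∃ D', D' = 2 * |D| + r := ⟨_, rfl⟩
  have hD'0 : 0 < D' := by rw [hD']; positivity
  obtain ⟨Q, hQ⟩ : ∃ Q, Q = (2 * |B| + 1) * (2 * r ^ 2 * D' ^ 2) / ρ ^ 2 := ⟨_, rfl⟩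
  have hQ0 : 0 < Q := by rw [hQ]; positivity
  refine ⟨η * r ^ 4 / (4 * Q * D'), by positivity, ?_⟩
  intro h hc h2 hl hbd x₀ hx₀ x hx hxd
  obtain ⟨p, hp, hpx⟩ := hball x₀ hx₀
  have hnorm : ∀ y ∈ closure Ω, ‖y - x₀‖ ≤ 2 * |D| := by
    intro y hy
    have h1 := hD y hy
    have h3 := hD x₀ hx₀.1
    have h4 := norm_sub_le y x₀
    have h5 := le_abs_self D
    linarith
  have hup : ∀ y ∈ closure Ω, ‖y - p‖ ≤ D' := by
    intro y hy
    have h1 := norm_add_le (y - x₀) (x₀ - p)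
    rw [sub_add_sub_cancel, hp] at h1
    linarith [hnorm y hy]
  have hlow : ∀ y ∈ closure Ω, r ^ 2 ≤ sqDist p y := by
    intro y hy
    rw [sqDist_eq]
    have := hpx y hy
    have h3 : 0 ≤ ‖y - x₀‖ ^ 2 / 2 := by positivity
    linarith
  have hpos : ∀ y ∈ closure Ω, 0 < sqDist p y := fun y hy => lt_of_lt_of_le (by positivity) (hlow y hy)
  have hwlow : ∀ y ∈ closure Ω, ‖y - x₀‖ ^ 2 / (2 * r ^ 2 * D' ^ 2) ≤
      (r ^ 2)⁻¹ - (sqDist p y)⁻¹ := by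
    intro y hy
    have h1 := hpos y hy
    have h3 : sqDist p y ≤ D' ^ 2 := by
      rw [sqDist_eq]
      have := hup y hy
      gcongr
    have h4 : (r ^ 2)⁻¹ - (sqDist p y)⁻¹ = (sqDist p y - r ^ 2) / (r ^ 2 * sqDist p y) := by
      field_simp
    have h5 : ‖y - x₀‖ ^ 2 / 2 ≤ sqDist p y - r ^ 2 := by
      rw [sqDist_eq]; linarith [hpx y hy]
    rw [h4]
    calc ‖y - x₀‖ ^ 2 / (2 * r ^ 2 * D' ^ 2) = (‖y - x₀‖ ^ 2 / 2) / (r ^ 2 * D' ^ 2) := by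
          field_simp
      _ ≤ (sqDist p y - r ^ 2) / (r ^ 2 * sqDist p y) := by
          have : 0 ≤ sqDist p y - r ^ 2 := sub_nonneg.2 (hlow y hy)
          gcongr
  have hwup : (r ^ 2)⁻¹ - (sqDist p x)⁻¹ ≤ 2 * D' * ‖x - x₀‖ / r ^ 4 := by
    have h1 := hpos x hx
    have h4 : (r ^ 2)⁻¹ - (sqDist p x)⁻¹ = (sqDist p x - r ^ 2) / (r ^ 2 * sqDist p x) := by
      field_simp
    have h3 : sqDist p x - r ^ 2 ≤ ‖x - x₀‖ * (2 * D') := by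
      have h6 : ‖x - p‖ ≤ ‖x - x₀‖ + r := by
        have := norm_add_le (x - x₀) (x₀ - p)
        rwa [sub_add_sub_cancel, hp] at this
      have h7 := hup x hx
      have h8 : r ≤ D' := by rw [hD']; linarith [abs_nonneg D]
      have h9 := norm_nonneg (x - x₀)
      rw [sqDist_eq]
      have h10 : ‖x - p‖ ^ 2 - r ^ 2 = (‖x - p‖ - r) * (‖x - p‖ + r) := by ring
      rw [h10]
      have h11 : 0 ≤ ‖x - p‖ + r := by positivity
      calc (‖x - p‖ - r) * (‖x - p‖ + r) ≤ ‖x - x₀‖ * (‖x - p‖ + r) := by gcongr; linarith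
        _ ≤ ‖x - x₀‖ * (2 * D') := by gcongr; linarith
    rw [h4, div_le_div_iff₀ (by positivity) (by positivity)]
    have h5 := hlow x hx
    calc (sqDist p x - r ^ 2) * r ^ 4 ≤ (‖x - x₀‖ * (2 * D')) * (r ^ 2 * r ^ 2) := by
          rw [← pow_add]; gcongr
      _ ≤ (‖x - x₀‖ * (2 * D')) * (r ^ 2 * sqDist p x) := by gcongr
      _ = _ := by ring
  have hcs : ∀ y ∈ closure Ω, ContDiffAt ℝ 2 (fun y => -(sqDist p y)⁻¹) y := fun y hy =>
    ((contDiff_sqDist p).contDiffAt.inv (hpos y hy).ne').neg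
  have hsm : ∀ y ∈ closure Ω, ContDiffAt ℝ 2 (fun y => -Q * -(sqDist p y)⁻¹) y := fun y hy =>
    contDiffAt_const.mul (hcs y hy)
  have hmp := le_of_lapR_pos hΩ hb (h := fun y => h y + -Q * -(sqDist p y)⁻¹)
    (M := b x₀ + η / 2 + Q * (r ^ 2)⁻¹)
    (hc.add fun y hy => (hsm y hy).continuousAt.continuousWithinAt)
    (fun y hy => (h2 y hy).add (hsm y (subset_closure hy)))
    (fun y hy => by
      have hyc := subset_closure hy
      rw [lapR_add (h2 y hy) (hsm y hyc), lapR_const_mul _ (hcs y hyc),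
        lapR_neg_inv_sqDist (hpos y hyc).ne']
      have h1 := hl y hy
      have h3 := hpos y hyc
      have : 0 < Q * (4 * ((sqDist p y)⁻¹) ^ 2) := by positivity
      linarith)
    (fun y hy => by
      have hyc := hy.1
      have h1 := hwlow y hyc
      rw [hbd y hy]
      suffices b y ≤ b x₀ + η / 2 + Q * ((r ^ 2)⁻¹ - (sqDist p y)⁻¹) by linarith
      have h4 : 0 ≤ ‖y - x₀‖ ^ 2 / (2 * r ^ 2 * D' ^ 2) := by positivity
      by_cases hy' : ‖y - x₀‖ < ρ
      · have h3 := hmod y hyc x₀ hx₀.1 (by rwa [dist_eq_norm])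
        rw [Real.dist_eq] at h3
        have h5 := (abs_lt.1 h3).2
        have : 0 ≤ Q * ((r ^ 2)⁻¹ - (sqDist p y)⁻¹) := mul_nonneg hQ0.le (h4.trans h1)
        linarith
      · push Not at hy'
        have h3 : 2 * |B| + 1 ≤ Q * ((r ^ 2)⁻¹ - (sqDist p y)⁻¹) := by
          calc 2 * |B| + 1 = Q * (ρ ^ 2 / (2 * r ^ 2 * D' ^ 2)) := by
                rw [hQ]; field_simp
            _ ≤ Q * (‖y - x₀‖ ^ 2 / (2 * r ^ 2 * D' ^ 2)) := by gcongr
            _ ≤ _ := by gcongr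
        have h5 := abs_le.1 ((hB y hyc).trans (le_abs_self B))
        have h6 := abs_le.1 ((hB x₀ hx₀.1).trans (le_abs_self B))
        linarith [h5.2, h6.1])
    x hx
  have hfin : Q * ((r ^ 2)⁻¹ - (sqDist p x)⁻¹) ≤ η / 2 := by
    calc Q * ((r ^ 2)⁻¹ - (sqDist p x)⁻¹) ≤ Q * (2 * D' * ‖x - x₀‖ / r ^ 4) := by gcongr
      _ ≤ Q * (2 * D' * (η * r ^ 4 / (4 * Q * D')) / r ^ 4) := by gcongr
      _ = η / 2 := by field_simp; norm_num
  linarith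

end Boundary

section Phase

variable {Γ : Set ℂ} {τ : ℝ → ℂ} {W : ℂ → ℝ} {δ₁ m : ℝ} {Ω : Set ℂ}

lemma phaseProfile_lower {m σ K : ℝ} (hσ : 0 < σ) (hK : 0 < K) (t : ℝ) :
    m * t ^ 2 / 2 + phaseProfile m σ K 0 ≤ phaseProfile m σ K t := by
  unfold phaseProfile
  have h1 : σ * 1 / K ≤ σ * Real.cosh (K * t) / K := by
    gcongr
    exact Real.one_le_cosh _
  simp only [mul_zero, Real.cosh_zero]
  linarith

lemma TubeSol.contDiffAt_exp {N l ς σ K : ℝ} {t φ : ℂ → ℝ} (h : TubeSol Γ τ W Ω δ₁ m N t φ)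
    {x : ℂ} (hx : x ∈ Ω) :
    ContDiffAt ℝ 2 (fun y => Real.exp (l * (ς * φ y + phaseProfile m σ K (t y)))) x :=
  (contDiffAt_const.mul ((contDiffAt_const.mul (h.smooth_φ x hx)).add
    ((contDiff_phaseProfile m σ K).contDiffAt.comp x (h.smooth_t x hx)))).exp

lemma TubeSol.continuousOn_exp {N l ς σ K : ℝ} {t φ : ℂ → ℝ} (h : TubeSol Γ τ W Ω δ₁ m N t φ) :
    ContinuousOn (fun y => Real.exp (l * (ς * φ y + phaseProfile m σ K (t y)))) (closure Ω) :=
  (continuousOn_const.mul ((continuousOn_const.mul h.cont_φ).add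
    ((contDiff_phaseProfile m σ K (n := 0)).continuous.comp_continuousOn h.cont_t))).rexp

lemma le_of_exp_le {l A B B₀ κ : ℝ} (hl : 0 < l) (hB : -B₀ ≤ B)
    (h : Real.exp (l * A) ≤ Real.exp (l * B) + l * κ * Real.exp (-(l * B₀))) (hκ : 0 ≤ κ) :
    A ≤ B + κ := by
  have h1 : Real.exp (l * A) ≤ Real.exp (l * B) * (1 + l * κ) := by
    have : Real.exp (-(l * B₀)) ≤ Real.exp (l * B) := by
      apply Real.exp_le_exp.2
      nlinarith
    have h2 : l * κ * Real.exp (-(l * B₀)) ≤ l * κ * Real.exp (l * B) := by gcongr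
    linarith
  have h3 : Real.exp (l * (A - B)) ≤ 1 + l * κ := by
    rw [mul_sub, Real.exp_sub, div_le_iff₀ (Real.exp_pos _)]
    linarith
  have h4 := Real.add_one_le_exp (l * (A - B))
  have h5 : l * (A - B) ≤ l * κ := by linarith
  have := le_of_mul_le_mul_left h5 hl
  linarith

/-- Uniform smallness of the signed distance near the boundary. -/
theorem exists_boundary_layer (hτ : ArcParam Γ τ) (hm : 0 < m) (hδ₁ : 0 < δ₁) (hΩ : IsOpen Ω)
    (hb : IsBounded Ω) {r : ℝ} (hr : 0 < r)
    (hball : ∀ x₀ ∈ frontier Ω, ∃ p, ‖x₀ - p‖ = r ∧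
      ∀ x ∈ closure Ω, r ^ 2 + ‖x - x₀‖ ^ 2 / 2 ≤ ‖x - p‖ ^ 2)
    {φ₀ : ℂ → ℝ} (hφ₀ : Continuous φ₀) {η : ℝ} (hη : 0 < η) :
    ∃ d > 0, ∀ (W : ℂ → ℝ) (N : ℝ) (t φ : ℂ → ℝ), 0 ≤ N → TubeSol Γ τ W Ω δ₁ m N t φ →
      (∀ x ∈ frontier Ω, φ x = φ₀ x) → (∀ x ∈ frontier Ω, t x = 0) →
      ∀ x₀ ∈ frontier Ω, ∀ x ∈ closure Ω, ‖x - x₀‖ < d → |t x| < η := by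
  obtain ⟨K, σ, l, hK, hσ, hl, H⟩ := exists_subsolution hτ hm hδ₁
  obtain ⟨B, hB⟩ := hb.isCompact_closure.exists_bound_of_continuousOn hφ₀.continuousOn
  obtain ⟨B₀, hB₀⟩ : ∃ B₀, B₀ = |B| + |phaseProfile m σ K 0| := ⟨_, rfl⟩
  obtain ⟨κ, hκ⟩ : ∃ κ, κ = m * η ^ 2 / 4 := ⟨_, rfl⟩
  have hκ0 : 0 < κ := by rw [hκ]; positivity
  have key : ∀ ς : ℝ, ς = 1 ∨ ς = -1 → ∃ d > 0, ∀ (W : ℂ → ℝ) (N : ℝ) (t φ : ℂ → ℝ), 0 ≤ N →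
      TubeSol Γ τ W Ω δ₁ m N t φ →
      (∀ x ∈ frontier Ω, φ x = φ₀ x) → (∀ x ∈ frontier Ω, t x = 0) →
      ∀ x₀ ∈ frontier Ω, ∀ x ∈ closure Ω, ‖x - x₀‖ < d →
        ς * φ x + phaseProfile m σ K (t x) ≤ ς * φ₀ x₀ + phaseProfile m σ K 0 + κ := by
    intro ς hς
    have hςa : |ς| = 1 := by rcases hς with rfl | rfl <;> simp
    obtain ⟨d, hd, hmod⟩ := exists_boundary_modulus hΩ hb hr hball
      (b := fun y => Real.exp (l * (ς * φ₀ y + phaseProfile m σ K 0)))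
      (by fun_prop) (η := l * κ * Real.exp (-(l * B₀))) (by positivity)
    refine ⟨d, hd, fun W N t φ hN hs hφ ht x₀ hx₀ x hx hxd => ?_⟩
    have h1 := hmod _ hs.continuousOn_exp (fun y hy => hs.contDiffAt_exp hy)
      (fun y hy => le_trans (by positivity) (H W Ω N t φ hN hs ς hς y hy))
      (fun y hy => by rw [hφ y hy, ht y hy]) x₀ hx₀ x hx hxd
    have h2 : |ς * φ₀ x₀ + phaseProfile m σ K 0| ≤ B₀ := by
      refine (abs_add_le _ _).trans ?_
      rw [abs_mul, hςa, one_mul, hB₀]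
      have := (hB x₀ hx₀.1).trans (le_abs_self B)
      rw [Real.norm_eq_abs] at this
      linarith
    rw [abs_le] at h2
    exact le_of_exp_le hl h2.1 h1 hκ0.le
  obtain ⟨d₁, hd₁, H₁⟩ := key 1 (Or.inl rfl)
  obtain ⟨d₂, hd₂, H₂⟩ := key (-1) (Or.inr rfl)
  refine ⟨min d₁ d₂, lt_min hd₁ hd₂, fun W N t φ hN hs hφ ht x₀ hx₀ x hx hxd => ?_⟩
  have h1 := H₁ W N t φ hN hs hφ ht x₀ hx₀ x hx (hxd.trans_le (min_le_left _ _))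
  have h2 := H₂ W N t φ hN hs hφ ht x₀ hx₀ x hx (hxd.trans_le (min_le_right _ _))
  have h3 := phaseProfile_lower (m := m) hσ hK (t x)
  have h4 : m * t x ^ 2 ≤ m * (η ^ 2 / 2) := by rw [hκ] at h1 h2; linarith
  have h5 := le_of_mul_le_mul_left h4 hm
  apply abs_lt_of_sq_lt_sq _ hη.le
  have : 0 < η ^ 2 := by positivity
  linarith

end Phase

section GradientBound

lemma fderiv_fderiv_comp_affine {h : ℂ → ℝ} (hh : ContDiff ℝ 2 h) (L : ℂ →L[ℝ] ℂ) (p x v : ℂ) :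
    fderiv ℝ (fun y => fderiv ℝ (fun z => h (p + L z)) y v) x v =
      fderiv ℝ (fun y => fderiv ℝ h y (L v)) (p + L x) (L v) := by
  have hL : ∀ y, HasFDerivAt (fun z => p + L z) L y := fun y => L.hasFDerivAt.const_add p
  have h1 : ∀ y, fderiv ℝ (fun z => h (p + L z)) y v = fderiv ℝ h (p + L y) (L v) := by
    intro y
    have h2 := ((hh.differentiable (by norm_num)) (p + L y)).hasFDerivAt.comp y (hL y)
    have h3 : fderiv ℝ (fun z => h (p + L z)) y = (fderiv ℝ h (p + L y)).comp L := h2.fderiv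
    rw [h3]; rfl
  simp only [h1]
  have hd : Differentiable ℝ (fun y => fderiv ℝ h y (L v)) :=
    ((hh.fderiv_right (m := 1) (by norm_num)).clm_apply contDiff_const).differentiable (by norm_num)
  have h2 := (hd (p + L x)).hasFDerivAt.comp x (hL x)
  have h3 : fderiv ℝ (fun y => fderiv ℝ h (p + L y) (L v)) x = _ := h2.fderiv
  rw [h3]; rfl

lemma lapR_comp_conj {h : ℂ → ℝ} (hh : ContDiff ℝ 2 h) (p x : ℂ) :
    lapR (fun z => h (p + conj z)) x = lapR h (p + conj x) := by
  have h1 := fun v => fderiv_fderiv_comp_affine hh (Complex.conjCLE : ℂ →L[ℝ] ℂ) p x v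
  simp only [ContinuousLinearEquiv.coe_coe, Complex.conjCLE_apply] at h1
  unfold lapR
  rw [h1, h1]
  simp

lemma lapR_comp_const_add {h : ℂ → ℝ} (hh : ContDiff ℝ 2 h) (p x : ℂ) :
    lapR (fun z => h (p + z)) x = lapR h (p + x) := by
  have h1 := fun v => fderiv_fderiv_comp_affine hh (ContinuousLinearMap.id ℝ ℂ) p x v
  simp only [ContinuousLinearMap.id_apply] at h1
  unfold lapR
  rw [h1, h1]

lemma lapR_comp_I_mul {h : ℂ → ℝ} (hh : ContDiff ℝ 2 h) (x : ℂ) :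
    lapR (fun z => h (Complex.I * z)) x = lapR h (Complex.I * x) := by
  have h1 := fun v => fderiv_fderiv_comp_affine hh
    (ContinuousLinearMap.mul ℝ ℂ Complex.I) 0 x v
  simp only [ContinuousLinearMap.mul_apply', zero_add] at h1
  unfold lapR
  rw [h1, h1]
  simp [add_comm]

lemma lapR_clm_comp {u : ℂ → ℂ} (hu : ContDiff ℝ 2 u) (L : ℂ →L[ℝ] ℝ) (x : ℂ) :
    lapR (fun y => L (u y)) x = L (lapC u x) := by
  have h1 : ∀ y v, fderiv ℝ (fun z => L (u z)) y v = L (fderiv ℝ u y v) := by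
    intro y v
    have h3 : fderiv ℝ (fun z => L (u z)) y = L.comp (fderiv ℝ u y) :=
      (L.hasFDerivAt.comp y ((hu.differentiable (by norm_num)) y).hasFDerivAt).fderiv
    rw [h3]; rfl
  have h2 : ∀ v, fderiv ℝ (fun y => L (fderiv ℝ u y v)) x v =
      L (fderiv ℝ (fun y => fderiv ℝ u y v) x v) := by
    intro v
    have hd : Differentiable ℝ (fun y => fderiv ℝ u y v) :=
      ((hu.fderiv_right (m := 1) (by norm_num)).clm_apply contDiff_const).differentiable
        (by norm_num)
    have h3 : fderiv ℝ (fun y => L (fderiv ℝ u y v)) x = L.comp (fderiv ℝ _ x) :=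
      (L.hasFDerivAt.comp x (hd x).hasFDerivAt).fderiv
    rw [h3]; rfl
  unfold lapR lapC
  simp only [h1, h2, map_add]

/-- Comparison on a half square bounds the odd part of a function with bounded Laplacian. -/
lemma sub_reflection_le {U : ℂ → ℝ} (hU : ContDiff ℝ 2 U) {p : ℂ} {d M N y : ℝ} (hd : 0 < d)
    (hM : ∀ z ∈ closedBall p (2 * d), |U z| ≤ M)
    (hN : ∀ z ∈ closedBall p (2 * d), |lapR U z| < N) (hy : 0 ≤ y) (hyd : y ≤ d) :
    U (p + y * Complex.I) - U (p - y * Complex.I) ≤ (4 * M / d + N * d) * y := by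
  obtain ⟨Q, hQ⟩ : ∃ Q : Set ℂ, Q = {z | |z.re| < d ∧ 0 < z.im ∧ z.im < d} := ⟨_, rfl⟩
  have hQo : IsOpen Q := by
    rw [hQ]
    exact (isOpen_lt Complex.continuous_re.abs continuous_const).inter
      ((isOpen_lt continuous_const Complex.continuous_im).inter
        (isOpen_lt Complex.continuous_im continuous_const))
  have hQc : closure Q ⊆ {z | |z.re| ≤ d ∧ 0 ≤ z.im ∧ z.im ≤ d} := by
    refine closure_minimal ?_ ?_
    · rw [hQ]
      exact fun z hz => ⟨hz.1.le, hz.2.1.le, hz.2.2.le⟩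
    · exact (isClosed_le Complex.continuous_re.abs continuous_const).inter
        ((isClosed_le continuous_const Complex.continuous_im).inter
          (isClosed_le Complex.continuous_im continuous_const))
  have hnorm : ∀ z ∈ {z : ℂ | |z.re| ≤ d ∧ 0 ≤ z.im ∧ z.im ≤ d}, ‖z‖ ≤ 2 * d := by
    intro z hz
    have h1 := Complex.norm_le_abs_re_add_abs_im z
    rw [abs_of_nonneg hz.2.1] at h1
    linarith [hz.1, hz.2.2]
  have hQb : IsBounded Q := by
    refine isBounded_iff_forall_norm_le.2 ⟨2 * d, fun z hz => hnorm z (hQc (subset_closure hz))⟩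
  have hmem : ∀ z ∈ {z : ℂ | |z.re| ≤ d ∧ 0 ≤ z.im ∧ z.im ≤ d},
      p + z ∈ closedBall p (2 * d) ∧ p + conj z ∈ closedBall p (2 * d) := by
    intro z hz
    simp only [mem_closedBall, dist_eq_norm, add_sub_cancel_left, RCLike.norm_conj, and_self]
    exact hnorm z hz
  obtain ⟨q, hq⟩ : ∃ q : ℂ → ℝ, q = quadFn 0 0 (-(2 * M / d ^ 2)) (2 * M / d ^ 2 + N) := ⟨_, rfl⟩
  have hM0 : 0 ≤ M := (abs_nonneg _).trans (hM p (mem_closedBall_self (by positivity)))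
  have hN0 : 0 < N := (abs_nonneg _).trans_lt (hN p (mem_closedBall_self (by positivity)))
  have hlin : ContDiff ℝ 2 (fun z : ℂ => z.im) := Complex.imCLM.contDiff
  have c1 : ContDiff ℝ 2 (fun z => U (p + z)) := hU.comp (contDiff_const.add contDiff_id)
  have c2 : ContDiff ℝ 2 (fun z => U (p + conj z)) :=
    hU.comp (contDiff_const.add (Complex.conjCLE : ℂ →L[ℝ] ℂ).contDiff)
  have c2' : ContDiff ℝ 2 (fun z => -1 * U (p + conj z)) := contDiff_const.mul c2
  have c3 : ContDiff ℝ 2 q := by rw [hq]; exact contDiff_quadFn _ _ _ _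
  have c4 : ContDiff ℝ 2 (fun z : ℂ => -(4 * M / d + N * d) * z.im) := contDiff_const.mul hlin
  have hlapim : ∀ x, lapR (fun z : ℂ => z.im) x = 0 := by
    intro x
    have h1 : ∀ y v, fderiv ℝ (fun z : ℂ => z.im) y v = v.im := fun y v => by
      rw [show (fun z : ℂ => z.im) = Complex.imCLM from rfl, ContinuousLinearMap.fderiv]; rfl
    unfold lapR
    simp only [h1]
    simp
  have key := le_of_lapR_pos hQo hQb
    (h := fun z => (U (p + z) + -1 * U (p + conj z)) + (q z + -(4 * M / d + N * d) * z.im)) (M := 0)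
    ((c1.add c2').add (c3.add c4)).continuous.continuousOn
    (fun z _ => ((c1.add c2').add (c3.add c4)).contDiffAt)
    (fun z hz => by
      obtain ⟨hz1, hz2⟩ := hmem z (hQc (subset_closure hz))
      rw [lapR_add (c1.add c2').contDiffAt (c3.add c4).contDiffAt,
        lapR_add c1.contDiffAt c2'.contDiffAt, lapR_add c3.contDiffAt c4.contDiffAt,
        lapR_const_mul _ c2.contDiffAt, lapR_const_mul _ hlin.contDiffAt, hlapim, hq, lapR_quadFn,
        lapR_comp_const_add hU, lapR_comp_conj hU]
      have h1 := (abs_lt.1 (hN _ hz1)).1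
      have h2 := (abs_lt.1 (hN _ hz2)).2
      linarith)
    (fun z hz => by
      have hzc := hQc hz.1
      have hzQ : z ∉ Q := by
        have := hz.2
        rwa [hQo.interior_eq] at this
      obtain ⟨h1, h2, h3⟩ := hzc
      obtain ⟨hz1, hz2⟩ := hmem z ⟨h1, h2, h3⟩
      have hb1 := (abs_le.1 (hM _ hz1)).2
      have hb2 := (abs_le.1 (hM _ hz2)).1
      have hqz : q z + -(4 * M / d + N * d) * z.im =
          -(2 * M * ((z.re / d) ^ 2 + z.im / d * (2 - z.im / d))) - N * (z.im * (d - z.im)) := by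
        rw [hq]; unfold quadFn; field_simp; ring
      rw [hqz]
      have hn : 0 ≤ N * (z.im * (d - z.im)) := by
        have : 0 ≤ d - z.im := by linarith
        positivity
      have hs : 0 ≤ z.im / d := by positivity
      have hs1 : z.im / d ≤ 1 := (div_le_one hd).2 h3
      have hss : 0 ≤ z.im / d * (2 - z.im / d) := mul_nonneg hs (by linarith)
      by_cases hz0 : z.im = 0
      · have : conj z = z := Complex.conj_eq_iff_im.2 hz0
        rw [this]
        have : 0 ≤ M * ((z.re / d) ^ 2 + z.im / d * (2 - z.im / d)) := by positivity
        linarith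
      · have hone : 1 ≤ (z.re / d) ^ 2 + z.im / d * (2 - z.im / d) := by
          by_cases hzd : z.im = d
          · rw [hzd, div_self hd.ne']
            have := sq_nonneg (z.re / d)
            linarith
          · have hre : |z.re| = d := by
              by_contra hne
              exact hzQ (by
                rw [hQ]
                exact ⟨lt_of_le_of_ne h1 hne, lt_of_le_of_ne h2 (Ne.symm hz0),
                  lt_of_le_of_ne h3 hzd⟩)
            have : (z.re / d) ^ 2 = 1 := by
              rw [div_pow, ← sq_abs z.re, hre, div_self (by positivity)]
            linarith
        have := mul_le_mul_of_nonneg_left hone hM0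
        linarith)
  rcases hy.eq_or_lt with rfl | hy0
  · simp
  rcases hyd.eq_or_lt with hyd' | hyd'
  · have h1 := hmem (y * Complex.I) (by simp [hy, hyd, hd.le])
    have hb1 := (abs_le.1 (hM _ h1.1)).2
    have hb2 := (abs_le.1 (hM _ h1.2)).1
    simp only [map_mul, Complex.conj_ofReal, Complex.conj_I, mul_neg, ← sub_eq_add_neg] at hb2
    have : (4 * M / d + N * d) * y = 4 * M + N * d ^ 2 := by rw [hyd']; field_simp
    rw [this]
    have : 0 ≤ N * d ^ 2 := by positivity
    linarith
  · have h1 := key (y * Complex.I) (subset_closure (by rw [hQ]; simp [hy0, hyd', hd]))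
    simp only [map_mul, Complex.conj_ofReal, Complex.conj_I, mul_neg, ← sub_eq_add_neg, hq, quadFn]
      at h1
    simp at h1
    have h3 : 0 ≤ (2 * M / d ^ 2 + N) * y ^ 2 := by positivity
    linarith

lemma abs_sub_reflection_le {U : ℂ → ℝ} (hU : ContDiff ℝ 2 U) {p : ℂ} {d M N y : ℝ} (hd : 0 < d)
    (hM : ∀ z ∈ closedBall p (2 * d), |U z| ≤ M)
    (hN : ∀ z ∈ closedBall p (2 * d), |lapR U z| < N) (hyd : |y| ≤ d) :
    |U (p + y * Complex.I) - U (p - y * Complex.I)| ≤ (4 * M / d + N * d) * |y| := by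
  have hcase : ∀ y : ℝ, 0 ≤ y → y ≤ d →
      |U (p + y * Complex.I) - U (p - y * Complex.I)| ≤ (4 * M / d + N * d) * y := by
    intro y hy hyd
    rw [abs_le']
    refine ⟨sub_reflection_le hU hd hM hN hy hyd, ?_⟩
    have := sub_reflection_le (U := fun z => -U z) hU.neg hd (M := M) (N := N)
      (fun z hz => by rw [abs_neg]; exact hM z hz)
      (fun z hz => by rw [lapR_neg, abs_neg]; exact hN z hz) hy hyd
    linarith
  rcases le_total 0 y with hy | hy
  · rw [abs_of_nonneg hy] at hyd ⊢
    exact hcase y hy hyd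
  · rw [abs_of_nonpos hy] at hyd ⊢
    have := hcase (-y) (by linarith) hyd
    rw [abs_sub_comm]
    push_cast at this
    rwa [neg_mul, sub_neg_eq_add, ← sub_eq_add_neg] at this

/-- A function with bounded Laplacian is Lipschitz in the interior. -/
lemma abs_sub_le_of_lapR_bound {U : ℂ → ℝ} (hU : ContDiff ℝ 2 U) {p x : ℂ} {d M N : ℝ}
    (hd : 0 < d) (hM : ∀ z ∈ closedBall p (4 * d), |U z| ≤ M)
    (hN : ∀ z ∈ closedBall p (4 * d), |lapR U z| < N) (hx : ‖x - p‖ ≤ d) :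
    |U x - U p| ≤ (4 * M / d + N * d) * ‖x - p‖ := by
  have hM0 : 0 ≤ M := (abs_nonneg _).trans (hM p (mem_closedBall_self (by positivity)))
  have hN0 : 0 < N := (abs_nonneg _).trans_lt (hN p (mem_closedBall_self (by positivity)))
  obtain ⟨a, ha⟩ : ∃ a, a = (x - p).re / 2 := ⟨_, rfl⟩
  obtain ⟨b, hb⟩ : ∃ b, b = (x - p).im / 2 := ⟨_, rfl⟩
  have ha' : |a| ≤ ‖x - p‖ / 2 := by
    rw [ha, abs_div, abs_two]; gcongr; exact Complex.abs_re_le_norm _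
  have hb' : |b| ≤ ‖x - p‖ / 2 := by
    rw [hb, abs_div, abs_two]; gcongr; exact Complex.abs_im_le_norm _
  have hxp : x = p + 2 * a + 2 * b * Complex.I := by
    rw [ha, hb]
    push_cast
    rw [mul_div_cancel₀ _ two_ne_zero, mul_div_cancel₀ _ two_ne_zero, add_assoc,
      Complex.re_add_im]
    ring
  have hball : ∀ q : ℂ, ‖q - p‖ ≤ 2 * d → ∀ z ∈ closedBall q (2 * d), z ∈ closedBall p (4 * d) := by
    intro q hq z hz
    rw [mem_closedBall, dist_eq_norm] at hz ⊢
    have := norm_add_le (z - q) (q - p)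
    rw [sub_add_sub_cancel] at this
    linarith
  have hn := norm_nonneg (x - p)
  have hball1 : ∀ z ∈ closedBall (p + a : ℂ) (2 * d), z ∈ closedBall p (4 * d) := by
    refine hball _ ?_
    rw [add_sub_cancel_left, Complex.norm_real, Real.norm_eq_abs]
    linarith
  have hball2 : ∀ z ∈ closedBall (p + 2 * a + b * Complex.I : ℂ) (2 * d),
      z ∈ closedBall p (4 * d) := by
    refine hball _ ?_
    have h1 : (p + 2 * a + b * Complex.I : ℂ) - p = 2 * a + b * Complex.I := by ring
    rw [h1]
    refine (norm_add_le _ _).trans ?_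
    simp only [norm_mul, Complex.norm_real, Real.norm_eq_abs, Complex.norm_I, Complex.norm_ofNat]
    linarith
  have v := abs_sub_reflection_le hU hd (fun z hz => hM z (hball2 z hz))
    (fun z hz => hN z (hball2 z hz)) (y := b) (by linarith)
  have hrot : ContDiff ℝ 2 (fun z : ℂ => Complex.I * z) := contDiff_const.mul contDiff_id
  have hmaps : ∀ z ∈ closedBall (-Complex.I * (p + a)) (2 * d),
      Complex.I * z ∈ closedBall p (4 * d) := by
    intro z hz
    refine hball1 _ ?_
    rw [mem_closedBall, dist_eq_norm] at hz ⊢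
    have : Complex.I * z - (p + a) = Complex.I * (z - -Complex.I * (p + a)) := by
      linear_combination (-(p + a)) * Complex.I_sq
    rwa [this, norm_mul, Complex.norm_I, one_mul]
  have w := abs_sub_reflection_le (U := fun z => U (Complex.I * z)) (hU.comp hrot) hd
    (fun z hz => hM _ (hmaps z hz))
    (fun z hz => by rw [lapR_comp_I_mul hU]; exact hN _ (hmaps z hz)) (y := a) (by linarith)
  have e1 : Complex.I * (-Complex.I * (p + a) + a * Complex.I) = p := by
    linear_combination (-p) * Complex.I_sq
  have e2 : Complex.I * (-Complex.I * (p + a) - a * Complex.I) = p + 2 * a := by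
    linear_combination (-(p + 2 * a)) * Complex.I_sq
  have e3 : p + 2 * a + b * Complex.I + b * Complex.I = x := by rw [hxp]; ring
  have e4 : p + 2 * a + b * Complex.I - b * Complex.I = p + 2 * a := by ring
  rw [e1, e2, abs_sub_comm] at w
  rw [e3, e4] at v
  have h1 := abs_add_le (U x - U (p + 2 * a)) (U (p + 2 * a) - U p)
  rw [sub_add_sub_cancel] at h1
  have hC : 0 ≤ 4 * M / d + N * d := by positivity
  have h2 := mul_le_mul_of_nonneg_left ha' hC
  have h3 := mul_le_mul_of_nonneg_left hb' hC
  linarith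

end GradientBound

section Lipschitz

variable {Γ : Set ℂ} {τ : ℝ → ℂ} {W : ℂ → ℝ} {δ₁ : ℝ}

/-- Solutions close to `Γ` are Lipschitz in the interior at scale `ε`. -/
lemma exists_interior_lipschitz (hτ : ArcParam Γ τ) (hW : ContDiff ℝ ∞ W) :
    ∃ C > 0, ∀ (Ω : Set ℂ) (ε : ℝ) (u : ℂ → ℂ), 0 < ε → SolvesGL W Ω ε u →
      (∀ x ∈ Ω, infDist (u x) Γ ≤ δ₁) → ∀ p, closedBall p (4 * ε) ⊆ Ω → ∀ x, ‖x - p‖ ≤ ε →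
        ‖u x - u p‖ ≤ C * ‖x - p‖ / ε := by
  have hcomp : IsCompact (cthickening δ₁ Γ) := hτ.isCompact.cthickening
  obtain ⟨M, hM⟩ := hcomp.exists_bound_of_continuousOn (f := fun z : ℂ => z) continuousOn_id
  obtain ⟨M', hM'⟩ := hcomp.exists_bound_of_continuousOn (contDiff_gradW hW).continuous.continuousOn
  refine ⟨2 * (4 * |M| + (|M'| + 1)), by positivity, ?_⟩
  intro Ω ε u hε hu hle p hp x hx
  have hu2 : ContDiff ℝ 2 u := contDiff_infty.1 hu.1 2
  have hmem : ∀ z ∈ closedBall p (4 * ε), u z ∈ cthickening δ₁ Γ := by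
    intro z hz
    obtain ⟨s, -, hs⟩ := hτ.exists_nearest 0 (u z)
    refine mem_cthickening_of_dist_le _ _ _ _ (hτ.mem s) ?_
    rw [dist_comm, dist_eq_norm, ← hs]
    exact hle z (hp hz)
  have key : ∀ L : ℂ →L[ℝ] ℝ, (∀ z, |L z| ≤ ‖z‖) →
      |L (u x) - L (u p)| ≤ (4 * |M| / ε + (|M'| + 1) / ε ^ 2 * ε) * ‖x - p‖ := by
    intro L hL
    refine abs_sub_le_of_lapR_bound (U := fun z => L (u z)) (L.contDiff.comp hu2) hε
      (fun z hz => (hL _).trans ((hM _ (hmem z hz)).trans (le_abs_self M))) (fun z hz => ?_) hx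
    rw [lapR_clm_comp hu2, hu.2 z (hp hz)]
    refine (hL _).trans_lt ?_
    rw [norm_smul, Real.norm_eq_abs, abs_of_nonneg (by positivity), div_eq_inv_mul]
    have := (hM' _ (hmem z hz)).trans (le_abs_self M')
    have h2 : ‖gradW W (u z)‖ < |M'| + 1 := by linarith
    gcongr
  have h1 := key Complex.reCLM Complex.abs_re_le_norm
  have h2 := key Complex.imCLM Complex.abs_im_le_norm
  have h3 := Complex.norm_le_abs_re_add_abs_im (u x - u p)
  have h4 : 2 * (4 * |M| + (|M'| + 1)) * ‖x - p‖ / ε =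
      2 * ((4 * |M| / ε + (|M'| + 1) / ε ^ 2 * ε) * ‖x - p‖) := by field_simp
  rw [h4]
  simp only [Complex.reCLM_apply, Complex.imCLM_apply] at h1 h2
  rw [Complex.sub_re, Complex.sub_im] at h3
  linarith

end Lipschitz

section Nondegenerate

variable {Γ : Set ℂ} {τ : ℝ → ℂ} {W : ℂ → ℝ} {R₀ : ℝ}

lemma hasDerivAt_snd_fderiv {F : ℝ × ℝ → ℝ} (hF : ContDiff ℝ ∞ F) (s r : ℝ) :
    HasDerivAt (fun r => F (s, r)) (fderiv ℝ F (s, r) (0, 1)) r :=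
  ((hF.differentiable (by simp)) (s, r)).hasFDerivAt.comp_hasDerivAt r
    ((hasDerivAt_const r s).prodMk (hasDerivAt_id r))

lemma contDiff_fderiv_snd {F : ℝ × ℝ → ℝ} (hF : ContDiff ℝ ∞ F) :
    ContDiff ℝ ∞ fun z => fderiv ℝ F z (0, 1) :=
  (hF.fderiv_right (m := ∞) (by rfl)).clm_apply contDiff_const

lemma fderiv_snd_periodic {F : ℝ × ℝ → ℝ} (hF : ContDiff ℝ ∞ F) {c : ℝ}
    (hp : ∀ s r, F (s + c, r) = F (s, r)) (s r : ℝ) :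
    fderiv ℝ F (s + c, r) (0, 1) = fderiv ℝ F (s, r) (0, 1) := by
  have h1 := hasDerivAt_snd_fderiv hF (s + c) r
  simp only [hp] at h1
  exact h1.unique (hasDerivAt_snd_fderiv hF s r)

lemma exists_bound_of_fst_periodic {F : ℝ × ℝ → ℝ} (hF : Continuous F) {c : ℝ} (hc : 0 < c)
    (hp : ∀ s r, F (s + c, r) = F (s, r)) : ∃ M, 0 ≤ M ∧ ∀ s r, |r| ≤ 1 → |F (s, r)| ≤ M := by
  obtain ⟨M, hM⟩ := (isCompact_Icc.prod isCompact_Icc).exists_bound_of_continuousOn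
    (s := Icc 0 c ×ˢ Icc (-1 : ℝ) 1) hF.continuousOn
  have hM0 : 0 ≤ M := (norm_nonneg _).trans (hM (0, 0) ⟨⟨le_rfl, hc.le⟩, by norm_num, by norm_num⟩)
  refine ⟨M, hM0, fun s r hr => ?_⟩
  have hp' : Function.Periodic (fun s => F (s, r)) c := fun s => hp s r
  obtain ⟨y, hy, hys⟩ := hp'.exists_mem_Ico₀ hc s
  rw [hys]
  exact hM (y, r) ⟨⟨hy.1, hy.2.le⟩, abs_le.1 hr⟩

lemma abs_le_of_hasDerivAt_bound {f f' : ℝ → ℝ} {t C : ℝ} (hf : ∀ r, HasDerivAt f (f' r) r)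
    (h0 : f 0 = 0) (hC : ∀ r, |r| ≤ |t| → |f' r| ≤ C) {r : ℝ} (hr : |r| ≤ |t|) :
    |f r| ≤ C * |r| := by
  have h1 := (convex_closedBall (0 : ℝ) |t|).norm_image_sub_le_of_norm_hasDerivWithin_le
    (f := f) (f' := f') (C := C) (x := 0) (y := r) (fun x _ => (hf x).hasDerivWithinAt)
    (fun x hx => hC x (by simpa using hx)) (by simp) (by simpa using hr)
  simpa [h0] using h1

lemma hasDerivAt_comp_tubePt (hW : ContDiff ℝ ∞ W) (s r : ℝ) :
    HasDerivAt (fun r => W (tubePt τ s r)) (frameGrad τ W s r).im r := by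
  have h1 : HasDerivAt (fun r : ℝ => tubePt τ s r) (Complex.I * deriv τ s) r := by
    have := ((Complex.ofRealCLM.hasDerivAt (x := r)).mul_const (Complex.I * deriv τ s)).const_add
      (τ s)
    exact this.congr_deriv (by simp)
  have h2 := ((hW.differentiable (by simp)) (tubePt τ s r)).hasFDerivAt.comp_hasDerivAt r h1
  refine h2.congr_deriv ?_
  obtain ⟨v, hv⟩ : ∃ v, v = deriv τ s := ⟨_, rfl⟩
  have h3 : Complex.I * v = (-v.im) • (1 : ℂ) + v.re • Complex.I := by
    apply Complex.ext <;> simp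
  rw [← hv, h3, map_add, map_smul, map_smul]
  unfold frameGrad gradW
  rw [← hv]
  simp
  ring

/-- Near `Γ` the normal derivative of the potential is coercive. -/
lemma exists_frameGrad_coercive (hτ : ArcParam Γ τ) (hW : PotentialHyp Γ W R₀) :
    ∃ μ > 0, ∃ η > 0, ∀ s t : ℝ, |t| ≤ η → infDist (tubePt τ s t) Γ = |t| →
      μ * t ^ 2 ≤ t * (frameGrad τ W s t).im := by
  obtain ⟨μ, hμ, δ, hδ, hnd⟩ := hW.nondeg
  obtain ⟨w, hw⟩ : ∃ w : ℝ × ℝ → ℝ, w = fun z => (frameGrad τ W z.1 z.2).im := ⟨_, rfl⟩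
  have hws : ContDiff ℝ ∞ w := by
    rw [hw]
    exact Complex.imCLM.contDiff.comp (contDiff_frameGrad hτ hW.smooth)
  have hwp : ∀ s r, w (s + 2 * Real.pi, r) = w (s, r) := by
    intro s r
    simp only [hw, frameGrad, tubePt]
    rw [hτ.periodic s, hτ.periodic.deriv_periodic s]
  obtain ⟨w₁, hw₁⟩ : ∃ w₁ : ℝ × ℝ → ℝ, w₁ = fun z => fderiv ℝ w z (0, 1) := ⟨_, rfl⟩
  have hw₁s : ContDiff ℝ ∞ w₁ := by rw [hw₁]; exact contDiff_fderiv_snd hws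
  have hw₁p : ∀ s r, w₁ (s + 2 * Real.pi, r) = w₁ (s, r) := by
    intro s r
    rw [hw₁]
    exact fderiv_snd_periodic hws hwp s r
  obtain ⟨C, hC, hbd⟩ := exists_bound_of_fst_periodic (contDiff_fderiv_snd hw₁s).continuous
    Real.two_pi_pos (fderiv_snd_periodic hw₁s hw₁p)
  refine ⟨μ, hμ, min (min 1 (δ / 2)) (μ / (C + 1)), by positivity, ?_⟩
  intro s t ht hdist
  have ht1 : |t| ≤ 1 := ht.trans ((min_le_left _ _).trans (min_le_left _ _))
  have ht2 : |t| ≤ δ / 2 := ht.trans ((min_le_left _ _).trans (min_le_right _ _))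
  have ht3 : |t| ≤ μ / (C + 1) := ht.trans (min_le_right _ _)
  have dh : ∀ r, HasDerivAt (fun r => W (tubePt τ s r)) (w (s, r)) r := fun r => by
    rw [hw]; exact hasDerivAt_comp_tubePt hW.smooth s r
  have dw : ∀ r, HasDerivAt (fun r => w (s, r)) (w₁ (s, r)) r := fun r => by
    rw [hw₁]; exact hasDerivAt_snd_fderiv hws s r
  have dw₁ : ∀ r, HasDerivAt (fun r => w₁ (s, r)) (fderiv ℝ w₁ (s, r) (0, 1)) r :=
    hasDerivAt_snd_fderiv hw₁s s
  have h0 : W (tubePt τ s 0) = 0 := by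
    have : tubePt τ s 0 ∈ W ⁻¹' {0} := by
      rw [hW.zeros]
      simp only [tubePt, Complex.ofReal_zero, zero_mul, add_zero]
      exact hτ.mem s
    simpa using this
  have hw0 : w (s, 0) = 0 := by
    refine IsLocalMin.hasDerivAt_eq_zero (f := fun r => W (tubePt τ s r)) ?_ (dh 0)
    refine Eventually.of_forall fun r => ?_
    simp only [h0]
    exact hW.nonneg _
  have d1 : ∀ r, HasDerivAt (fun r => r * w₁ (s, r) - w (s, r))
      (r * fderiv ℝ w₁ (s, r) (0, 1)) r := fun r =>
    (((hasDerivAt_id r).mul (dw₁ r)).sub (dw r)).congr_deriv (by simp)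
  have d0 : ∀ r, HasDerivAt (fun r => r * w (s, r) - 2 * W (tubePt τ s r))
      (r * w₁ (s, r) - w (s, r)) r := fun r =>
    (((hasDerivAt_id r).mul (dw r)).sub ((dh r).const_mul 2)).congr_deriv (by simp; ring)
  have b1 : ∀ r, |r| ≤ |t| → |r * w₁ (s, r) - w (s, r)| ≤ |t| * C * |t| := by
    intro r hr
    refine (abs_le_of_hasDerivAt_bound d1 (by simp [hw0]) (fun r hr => ?_) hr).trans
      (mul_le_mul_of_nonneg_left hr (by positivity))
    rw [abs_mul]
    exact mul_le_mul hr (hbd s r (hr.trans ht1)) (abs_nonneg _) (abs_nonneg _)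
  have b0 := abs_le_of_hasDerivAt_bound d0 (by simp [h0]) b1 le_rfl
  have hWt := hnd (tubePt τ s t) (by rw [hdist]; linarith)
  rw [hdist, sq_abs] at hWt
  have h5 := (abs_le.1 b0).1
  have hsq : |t| * C * |t| * |t| = C * |t| * t ^ 2 := by rw [← sq_abs t]; ring
  have h6 : C * |t| ≤ μ := by
    have h7 : |t| * (C + 1) ≤ μ := (le_div_iff₀ (by positivity)).1 ht3
    linarith [abs_nonneg t]
  have h7 : C * |t| * t ^ 2 ≤ μ * t ^ 2 := by gcongr
  have h8 : w (s, t) = (frameGrad τ W s t).im := by rw [hw]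
  rw [← h8]
  linarith

end Nondegenerate

section Capacity

lemma lapR_log_sqDist {p x : ℂ} (hx : sqDist p x ≠ 0) :
    lapR (fun y => Real.log (sqDist p y)) x = 0 := by
  have h1 : ∀ᶠ r : ℝ in 𝓝 (sqDist p x), HasDerivAt Real.log (r⁻¹) r := by
    filter_upwards [isOpen_ne.mem_nhds hx] with r hr using Real.hasDerivAt_log hr
  rw [lapR_radial h1 (hasDerivAt_inv hx)]
  field_simp
  ring

/-- A bounded subharmonic function cannot have a Laplacian of size `c / ρ ^ 2` on a ball of
radius `ρ` small compared to the size of its domain. -/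
lemma log_capacity_bound {G : ℂ → ℝ} {p : ℂ} {R ρ c A : ℝ} (hρ : 0 < ρ) (hρR : ρ < R) (hc : 0 < c)
    (hG : ∀ x ∈ closedBall p R, ContDiffAt ℝ 2 G x) (h0 : 0 ≤ G p)
    (hA : ∀ x ∈ closedBall p R, G x ≤ A) (hl : ∀ x ∈ closedBall p R, 0 ≤ lapR G x)
    (hl' : ∀ x ∈ closedBall p ρ, c / ρ ^ 2 ≤ lapR G x) :
    c / 4 * (1 + Real.log (R ^ 2 / ρ ^ 2)) ≤ A + 1 := by
  have hR : 0 < R := hρ.trans hρR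
  obtain ⟨s, hs⟩ : ∃ s, s = (R ^ 2)⁻¹ := ⟨_, rfl⟩
  have hs0 : 0 < s := by rw [hs]; positivity
  obtain ⟨qi, hqi⟩ : ∃ qi : ℝ → ℝ, qi = fun r => r / ρ ^ 2 - 1 + Real.log (ρ ^ 2) := ⟨_, rfl⟩
  obtain ⟨q, hq⟩ : ∃ q : ℝ → ℝ, q = fun r => if r ≤ ρ ^ 2 then qi r else Real.log r := ⟨_, rfl⟩
  have hρ2 : 0 < ρ ^ 2 := by positivity
  have hqle : ∀ r, q r ≤ qi r := by
    intro r
    simp only [hq]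
    split_ifs with hr
    · exact le_rfl
    · push Not at hr
      have h1 : 0 < r := hρ2.trans hr
      have h2 := Real.log_le_sub_one_of_pos (x := r / ρ ^ 2) (by positivity)
      rw [Real.log_div h1.ne' hρ2.ne'] at h2
      simp only [hqi]
      linarith
  have hqc : Continuous q := by
    rw [hq]
    have hcl : Continuous (fun r => qi r) := by rw [hqi]; fun_prop
    refine continuous_if_le continuous_id continuous_const hcl.continuousOn
      (fun r hr => (Real.continuousAt_log ?_).continuousWithinAt) (fun r hr => ?_)
    · exact (hρ2.trans_le hr).ne'
    · have : r = ρ ^ 2 := hr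
      simp [hqi, this, hρ2.ne']
  have hsd : Continuous (sqDist p) := (contDiff_sqDist p (n := 0)).continuous
  have hGc : ContinuousOn G (closedBall p R) := fun x hx => (hG x hx).continuousAt.continuousWithinAt
  obtain ⟨y, hy, hmax⟩ := (isCompact_closedBall p R).exists_isMaxOn
    ⟨p, mem_closedBall_self hR.le⟩
    (f := fun x => G x + (-(c / 4) * q (sqDist p x) + s * sqDist p x))
    (hGc.add (((continuous_const.mul (hqc.comp hsd)).add
      (continuous_const.mul hsd)).continuousOn))
  rw [isMaxOn_iff] at hmax
  have hsy : sqDist p y = ‖y - p‖ ^ 2 := sqDist_eq p y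
  have hyR : ‖y - p‖ ≤ R := by rwa [mem_closedBall, dist_eq_norm] at hy
  have c2 : ∀ x, ContDiffAt ℝ 2 (fun x => s * sqDist p x) x := fun x =>
    contDiffAt_const.mul (contDiff_sqDist p).contDiffAt
  have contra : ∀ f : ℂ → ℝ, ‖y - p‖ < R → ContDiffAt ℝ 2 f y →
      (∀ᶠ x in 𝓝 y, q (sqDist p x) ≤ f x) → f y = q (sqDist p y) →
      c / 4 * lapR f y ≤ lapR G y → False := by
    intro f hyR hf hqf hfy hlf
    have c1 : ContDiffAt ℝ 2 (fun x => -(c / 4) * f x) y := contDiffAt_const.mul hf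
    have hloc : IsLocalMin (fun x => -(G x + (-(c / 4) * f x + s * sqDist p x))) y := by
      filter_upwards [hqf, isOpen_ball.mem_nhds (show y ∈ ball p R by
        rwa [mem_ball, dist_eq_norm])] with x hx hxR
      have h1 := hmax x (ball_subset_closedBall hxR)
      rw [hfy]
      have h2 : c / 4 * q (sqDist p x) ≤ c / 4 * f x := by gcongr
      linarith
    have h1 := lapR_nonneg_of_isLocalMin ((hG y hy).add (c1.add (c2 y))).neg hloc
    rw [lapR_neg, lapR_add (hG y hy) (c1.add (c2 y)), lapR_add c1 (c2 y), lapR_const_mul _ hf,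
      lapR_const_mul _ (contDiff_sqDist p).contDiffAt, lapR_sqDist] at h1
    linarith
  have hyeq : ‖y - p‖ = R := by
    by_contra hne
    have hlt : ‖y - p‖ < R := lt_of_le_of_ne hyR hne
    by_cases hyρ : ‖y - p‖ ≤ ρ
    · have hcq : ContDiff ℝ 2 qi := by rw [hqi]; fun_prop
      have hd : ∀ r, HasDerivAt qi ((ρ ^ 2)⁻¹) r := fun r => by
        rw [hqi]
        exact ((((hasDerivAt_id r).div_const (ρ ^ 2)).sub_const 1).add_const _).congr_deriv
          (by simp)
      refine contra (fun x => qi (sqDist p x)) hlt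
        (hcq.contDiffAt.comp y (contDiff_sqDist p).contDiffAt)
        (Eventually.of_forall fun x => hqle _) ?_ ?_
      · simp only [hq]
        rw [if_pos]
        rw [hsy]
        gcongr
      · rw [lapR_radial (F₁ := fun _ => (ρ ^ 2)⁻¹) (Eventually.of_forall hd)
          (hasDerivAt_const _ _)]
        have := hl' y (by rwa [mem_closedBall, dist_eq_norm])
        rw [div_eq_mul_inv] at this
        linarith
    · push Not at hyρ
      have h1 : ρ ^ 2 < sqDist p y := by rw [hsy]; gcongr
      refine contra (fun x => Real.log (sqDist p x)) hlt
        ((contDiff_sqDist p).contDiffAt.log (hρ2.trans h1).ne') ?_ ?_ ?_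
      · filter_upwards [hsd.continuousAt.eventually (isOpen_Ioi.mem_nhds h1)] with x hx
        simp only [hq]
        rw [if_neg (not_le.2 hx)]
      · simp only [hq]
        rw [if_neg (not_le.2 h1)]
      · rw [lapR_log_sqDist (hρ2.trans h1).ne', mul_zero]
        exact hl y hy
  have hp := hmax p (mem_closedBall_self hR.le)
  have e1 : q (sqDist p y) = Real.log (R ^ 2) := by
    rw [hsy, hyeq, hq]
    simp only
    rw [if_neg]
    rw [not_le]
    gcongr
  have e2 : sqDist p p = 0 := by simp [sqDist]
  have e3 : q 0 = -1 + Real.log (ρ ^ 2) := by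
    rw [hq]
    simp only
    rw [if_pos hρ2.le, hqi]
    simp
  rw [e1, e2, e3, hsy, hyeq] at hp
  have e4 : s * R ^ 2 = 1 := by rw [hs]; field_simp
  rw [e4] at hp
  rw [Real.log_div (by positivity) hρ2.ne']
  have := hA y hy
  linarith

lemma le_add_sq_of_lapR_nonneg {U : Set ℂ} (hU : IsOpen U) (hb : IsBounded U) {h : ℂ → ℝ}
    {M D : ℝ} (hD : ∀ x ∈ closure U, ‖x‖ ≤ D) (hc : ContinuousOn h (closure U))
    (h2 : ∀ x ∈ U, ContDiffAt ℝ 2 h x) (hl : ∀ x ∈ U, 0 ≤ lapR h x)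
    (hM : ∀ x ∈ frontier U, h x ≤ M) : ∀ x ∈ closure U, h x ≤ M + D ^ 2 := by
  intro x hx
  have key := le_of_lapR_pos hU hb (h := fun y => h y + sqDist 0 y) (M := M + D ^ 2)
    (hc.add (contDiff_sqDist 0 (n := 0)).continuous.continuousOn)
    (fun y hy => (h2 y hy).add (contDiff_sqDist 0).contDiffAt)
    (fun y hy => by
      rw [lapR_add (h2 y hy) (contDiff_sqDist 0).contDiffAt, lapR_sqDist]
      linarith [hl y hy])
    (fun y hy => by
      have h1 := hD y hy.1
      have h3 : sqDist 0 y ≤ D ^ 2 := by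
        rw [sqDist_eq, sub_zero]
        gcongr
      linarith [hM y hy])
    x hx
  have h3 : 0 ≤ sqDist 0 x := by rw [sqDist_eq]; positivity
  linarith

lemma closedBall_subset_of_frontier {U : Set ℂ} (hU : IsOpen U) {x : ℂ} {d : ℝ} (hx : x ∈ U)
    (hd : ∀ y ∈ frontier U, d ≤ ‖x - y‖) {R : ℝ} (hR : 0 ≤ R) (hRd : R < d) :
    closedBall x R ⊆ U := by
  refine (convex_closedBall x R).isPreconnected.subset_of_closure_inter_subset hU
    ⟨x, mem_closedBall_self hR, hx⟩ fun y hy => ?_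
  by_contra hyU
  have h1 := hd y ⟨hy.1, by rwa [hU.interior_eq]⟩
  have h2 := hy.2
  rw [mem_closedBall, dist_eq_norm, norm_sub_rev] at h2
  linarith

end Capacity

section Level

variable {Γ : Set ℂ} {τ : ℝ → ℂ} {W : ℂ → ℝ} {R₀ δ₁ m : ℝ} {Ω : Set ℂ}

lemma phaseProfile_nonneg {m σ K : ℝ} (hm : 0 ≤ m) (hσ : 0 < σ) (hK : 0 < K) (t : ℝ) :
    0 ≤ phaseProfile m σ K t := by
  have h1 := phaseProfile_lower (m := m) hσ hK t
  have h2 : 0 ≤ phaseProfile m σ K 0 := by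
    unfold phaseProfile
    simp only [mul_zero, Real.cosh_zero]
    positivity
  have h3 : 0 ≤ m * t ^ 2 / 2 := by positivity
  linarith

lemma le_abs_sinh {K t : ℝ} (hK : 0 < K) : K * |t| ≤ |Real.sinh (K * t)| := by
  have h1 : |K * t| ≤ |Real.sinh (K * t)| := by
    rw [Real.abs_sinh]
    exact Real.self_le_sinh_iff.2 (abs_nonneg _)
  rwa [abs_mul, abs_of_pos hK] at h1

lemma PhaseDecomp.abs_sub_le {s : Set ℂ} {u : ℂ → ℂ} {t φ : ℂ → ℝ}
    (hd : PhaseDecomp Γ τ s u t φ) {x y : ℂ} (hx : x ∈ s) (hy : y ∈ s) :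
    |t x| ≤ |t y| + ‖u x - u y‖ := by
  rw [(hd.2.2 x hx).2, (hd.2.2 y hy).2, ← dist_eq_norm]
  exact infDist_le_infDist_add_dist

/-- The exponential of the corrected phase is bounded above and below, uniformly over all
solutions with given boundary data. -/
lemma exists_exp_bounds (hm : 0 < m) (hΩ : IsOpen Ω) (hb : IsBounded Ω) {φ₀ : ℂ → ℝ}
    (hφ₀ : Continuous φ₀) {K σ l : ℝ} (hK : 0 < K) (hσ : 0 < σ) (hl : 0 < l)
    (H : ∀ (W : ℂ → ℝ) (Ω : Set ℂ) (N : ℝ) (t φ : ℂ → ℝ),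
      0 ≤ N → TubeSol Γ τ W Ω δ₁ m N t φ → ∀ ς : ℝ, ς = 1 ∨ ς = -1 → ∀ x ∈ Ω,
        l * Real.exp (l * (ς * φ x + phaseProfile m σ K (t x))) *
            (N * σ * |Real.sinh (K * t x)| * |(frameGrad τ W (φ x) (t x)).im|) ≤
          lapR (fun y => Real.exp (l * (ς * φ y + phaseProfile m σ K (t y)))) x) :
    ∃ A > 0, ∀ (W : ℂ → ℝ) (N : ℝ) (t φ : ℂ → ℝ), 0 ≤ N → TubeSol Γ τ W Ω δ₁ m N t φ →
      (∀ x ∈ frontier Ω, φ x = φ₀ x) → (∀ x ∈ frontier Ω, t x = 0) → ∀ x ∈ closure Ω,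
        A⁻¹ ≤ Real.exp (l * (1 * φ x + phaseProfile m σ K (t x))) ∧
        Real.exp (l * (1 * φ x + phaseProfile m σ K (t x))) ≤ A := by
  obtain ⟨B, hB⟩ := hb.isCompact_closure.exists_bound_of_continuousOn hφ₀.continuousOn
  obtain ⟨D, hD⟩ := hb.isCompact_closure.isBounded.exists_norm_le
  obtain ⟨A, hA⟩ : ∃ A, A = Real.exp (l * (B + phaseProfile m σ K 0)) + D ^ 2 := ⟨_, rfl⟩
  have hA0 : 0 < A := by rw [hA]; positivity
  refine ⟨A, hA0, fun W N t φ hN hs hφ ht x hx => ?_⟩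
  have key : ∀ ς : ℝ, ς = 1 ∨ ς = -1 →
      Real.exp (l * (ς * φ x + phaseProfile m σ K (t x))) ≤ A := by
    intro ς hς
    rw [hA]
    refine le_add_sq_of_lapR_nonneg hΩ hb hD
      (h := fun y => Real.exp (l * (ς * φ y + phaseProfile m σ K (t y)))) hs.continuousOn_exp
      (fun y hy => hs.contDiffAt_exp hy)
      (fun y hy => le_trans (by positivity) (H W Ω N t φ hN hs ς hς y hy)) (fun y hy => ?_) x hx
    rw [hφ y hy, ht y hy]
    have h1 : ς * φ₀ y ≤ B := by
      have h2 := abs_le.1 (hB y hy.1)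
      rcases hς with rfl | rfl <;> linarith [h2.1, h2.2]
    gcongr
  refine ⟨?_, key 1 (Or.inl rfl)⟩
  have h1 := key (-1) (Or.inr rfl)
  refine (inv_anti₀ (Real.exp_pos _) h1).trans ?_
  rw [← Real.exp_neg]
  gcongr
  have h2 := mul_nonneg hl.le (phaseProfile_nonneg hm.le hσ hK (t x))
  linarith

/-- For small `ε` the distance to `Γ` avoids a given small level. -/
theorem exists_abs_ne_level (hτ : ArcParam Γ τ) (hW : PotentialHyp Γ W R₀)
    (hmax : MaxPrinciple Γ τ W δ₁ m) (hm : 0 < m) (hδ₁ : 0 < δ₁) (hΩ : IsOpen Ω)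
    (hb : IsBounded Ω) {r : ℝ} (hr : 0 < r)
    (hball : ∀ x₀ ∈ frontier Ω, ∃ p, ‖x₀ - p‖ = r ∧
      ∀ x ∈ closure Ω, r ^ 2 + ‖x - x₀‖ ^ 2 / 2 ≤ ‖x - p‖ ^ 2)
    {φ₀ : ℂ → ℝ} (hφ₀ : Continuous φ₀) :
    ∃ η₁ > 0, ∀ η, 0 < η → η ≤ η₁ → ∃ ε₁ > 0, ∀ (ε : ℝ) (u : ℂ → ℂ) (t φ : ℂ → ℝ),
      0 < ε → ε < ε₁ → SolvesGL W Ω ε u → PhaseDecomp Γ τ (closure Ω) u t φ →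
      (∀ x ∈ closure Ω, infDist (u x) Γ ≤ δ₁) → (∀ x ∈ frontier Ω, φ x = φ₀ x) →
      (∀ x ∈ frontier Ω, t x = 0) → ∀ x ∈ closure Ω, |t x| ≠ η := by
  obtain ⟨K, σ, l, hK, hσ, hl, H⟩ := exists_subsolution hτ hm hδ₁
  obtain ⟨A, hA, hexp⟩ := exists_exp_bounds hm hΩ hb hφ₀ hK hσ hl H
  obtain ⟨μ, hμ, η₀, hη₀, hco⟩ := exists_frameGrad_coercive hτ hW
  obtain ⟨C, hC, hlip⟩ := exists_interior_lipschitz (δ₁ := δ₁) hτ hW.smooth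
  refine ⟨η₀ / 2, by positivity, fun η hη hηη₀ => ?_⟩
  obtain ⟨d, hd, hlayer⟩ := exists_boundary_layer hτ hm hδ₁ hΩ hb hr hball hφ₀ hη
  obtain ⟨R, hR⟩ : ∃ R, R = d / 2 := ⟨_, rfl⟩
  have hR0 : 0 < R := by rw [hR]; positivity
  obtain ⟨κ, hκ⟩ : ∃ κ, κ = min 1 (η / (2 * C)) := ⟨_, rfl⟩
  have hκ0 : 0 < κ := by rw [hκ]; positivity
  have hκ1 : κ ≤ 1 := by rw [hκ]; exact min_le_left _ _
  have hκC : C * κ ≤ η / 2 := by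
    have h1 : κ ≤ η / (2 * C) := by rw [hκ]; exact min_le_right _ _
    calc C * κ ≤ C * (η / (2 * C)) := by gcongr
      _ = η / 2 := by field_simp
  obtain ⟨c, hc⟩ : ∃ c, c = l * A⁻¹ * (σ * K * (μ * (η / 2) ^ 2)) * κ ^ 2 := ⟨_, rfl⟩
  have hc0 : 0 < c := by rw [hc]; positivity
  obtain ⟨T, hT⟩ : ∃ T, T = 4 * (A + 1) / c := ⟨_, rfl⟩
  refine ⟨min (R / 4) (R * Real.exp (-(T / 2))), by positivity, ?_⟩
  intro ε u t φ hε hε₁ hu hdec hle hφ ht x hx hxη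
  have hεR : ε < R / 4 := hε₁.trans_le (min_le_left _ _)
  have hεT : ε < R * Real.exp (-(T / 2)) := hε₁.trans_le (min_le_right _ _)
  have hs := hdec.tubeSol hmax hτ hW.smooth hm hδ₁ hΩ hu hle
  have hN : 0 ≤ (ε ^ 2)⁻¹ := by positivity
  have hxΩ : x ∈ Ω := by
    by_contra hxΩ
    have h1 := ht x ⟨hx, by rwa [hΩ.interior_eq]⟩
    rw [h1, abs_zero] at hxη
    exact hη.ne hxη
  have hsub : closedBall x R ⊆ Ω := by
    refine closedBall_subset_of_frontier hΩ hxΩ (d := d) (fun y hy => ?_) hR0.le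
      (by rw [hR]; linarith)
    by_contra hlt
    push Not at hlt
    exact (hlayer W _ t φ hN hs hφ ht y hy x hx hlt).ne hxη
  have hκε : κ * ε ≤ ε := mul_le_of_le_one_left hε.le hκ1
  have hεle : ∀ y ∈ closedBall x (κ * ε), y ∈ Ω := fun y hy =>
    hsub (closedBall_subset_closedBall (by linarith) hy)
  have hbd := log_capacity_bound
    (G := fun y => Real.exp (l * (1 * φ y + phaseProfile m σ K (t y)))) (p := x) (R := R)
    (ρ := κ * ε) (c := c) (A := A) (by positivity) (by linarith) hc0
    (fun y hy => hs.contDiffAt_exp (hsub hy)) (Real.exp_pos _).le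
    (fun y hy => (hexp W _ t φ hN hs hφ ht y (subset_closure (hsub hy))).2)
    (fun y hy => le_trans (by positivity) (H W Ω _ t φ hN hs 1 (Or.inl rfl) y (hsub hy)))
    (fun y hy => by
      have hyΩ := hεle y hy
      have hyc := subset_closure hyΩ
      refine le_trans ?_ (H W Ω _ t φ hN hs 1 (Or.inl rfl) y hyΩ)
      rw [mem_closedBall, dist_eq_norm] at hy
      have hl1 := hlip Ω ε u hε hu (fun z hz => hle z (subset_closure hz)) x
        ((closedBall_subset_closedBall (by linarith)).trans hsub) y (hy.trans hκε)
      have hl2 : ‖u y - u x‖ ≤ η / 2 := by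
        refine hl1.trans (le_trans ?_ hκC)
        rw [div_le_iff₀ hε, mul_assoc]
        gcongr
      have h1 := hdec.abs_sub_le hyc hx
      have h2 := hdec.abs_sub_le hx hyc
      rw [norm_sub_rev] at h2
      rw [hxη] at h1 h2
      have hty : η / 2 ≤ |t y| := by linarith
      have hco' := hco (φ y) (t y) (by linarith) (hs.dist y hyc)
      have h3 : μ * (η / 2) ^ 2 ≤ |t y| * |(frameGrad τ W (φ y) (t y)).im| := by
        rw [← abs_mul]
        refine le_trans ?_ (hco'.trans (le_abs_self _))
        rw [← sq_abs (t y)]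
        gcongr
      have h4 : σ * K * (μ * (η / 2) ^ 2) ≤
          σ * |Real.sinh (K * t y)| * |(frameGrad τ W (φ y) (t y)).im| := by
        calc σ * K * (μ * (η / 2) ^ 2)
            ≤ σ * K * (|t y| * |(frameGrad τ W (φ y) (t y)).im|) := by gcongr
          _ = σ * (K * |t y|) * |(frameGrad τ W (φ y) (t y)).im| := by ring
          _ ≤ _ := by
            gcongr
            exact le_abs_sinh hK
      have h5 := (hexp W _ t φ hN hs hφ ht y hyc).1
      calc c / (κ * ε) ^ 2 = l * A⁻¹ * ((ε ^ 2)⁻¹ * (σ * K * (μ * (η / 2) ^ 2))) := by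
            rw [hc]; field_simp
        _ ≤ l * Real.exp (l * (1 * φ y + phaseProfile m σ K (t y))) * ((ε ^ 2)⁻¹ *
            (σ * |Real.sinh (K * t y)| * |(frameGrad τ W (φ y) (t y)).im|)) := by gcongr
        _ = _ := by ring)
  have hlog : T < Real.log (R ^ 2 / (κ * ε) ^ 2) := by
    rw [Real.lt_log_iff_exp_lt (by positivity), lt_div_iff₀ (by positivity)]
    have h1 : (κ * ε) ^ 2 < (R * Real.exp (-(T / 2))) ^ 2 := by
      have : κ * ε < R * Real.exp (-(T / 2)) := hκε.trans_lt hεT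
      gcongr
    calc Real.exp T * (κ * ε) ^ 2 < Real.exp T * (R * Real.exp (-(T / 2))) ^ 2 := by gcongr
      _ = R ^ 2 := by
        rw [mul_pow, ← Real.exp_nat_mul, mul_left_comm, ← Real.exp_add]
        simp
        ring_nf
        simp
  have h1 : c / 4 * T = A + 1 := by rw [hT]; field_simp
  have h2 : c / 4 * T < c / 4 * Real.log (R ^ 2 / (κ * ε) ^ 2) := by gcongr
  linarith

end Level

section Normalization

variable {Γ : Set ℂ} {τ : ℝ → ℂ}

lemma BoundaryParam.isPreconnected_frontier {Ω : Set ℂ} {γ : ℝ → ℂ} {L : ℝ}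
    (h : BoundaryParam Ω γ L) : IsPreconnected (frontier Ω) :=
  h.srange ▸ isPreconnected_range h.smooth.continuous

/-- Two continuous phases of the same map on a connected set differ by a multiple of `2π`. -/
lemma exists_phase_shift (hτ : ArcParam Γ τ) {S : Set ℂ} (hS : IsPreconnected S) {φ φ₀ : ℂ → ℝ}
    (hφ : ContinuousOn φ S) (hφ₀ : ContinuousOn φ₀ S) (h : ∀ x ∈ S, τ (φ x) = τ (φ₀ x)) :
    ∃ k : ℤ, ∀ x ∈ S, φ x - k * (2 * Real.pi) = φ₀ x := by
  rcases S.eq_empty_or_nonempty with rfl | ⟨a, ha⟩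
  · exact ⟨0, by simp⟩
  have hk : ∀ x ∈ S, ∃ k : ℤ, (φ x - φ₀ x) / (2 * Real.pi) = k := by
    intro x hx
    obtain ⟨k, hk⟩ := hτ.inj _ _ (h x hx)
    exact ⟨k, by rw [hk]; field_simp⟩
  have : DiscreteTopology (range (Int.cast : ℤ → ℝ)) :=
    Int.isClosedEmbedding_coe_real.isEmbedding.toHomeomorph.symm.isEmbedding.discreteTopology
  obtain ⟨k, hka⟩ := hk a ha
  refine ⟨k, fun x hx => ?_⟩
  have h1 := hS.constant_of_mapsTo (T := range (Int.cast : ℤ → ℝ)) ⟨this⟩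
    ((hφ.sub hφ₀).div_const (2 * Real.pi))
    (fun y hy => by obtain ⟨j, hj⟩ := hk y hy; exact ⟨j, hj.symm⟩) hx ha
  have h2 : (φ x - φ₀ x) / (2 * Real.pi) = k := h1.trans hka
  rw [div_eq_iff Real.two_pi_pos.ne'] at h2
  linarith

lemma PhaseDecomp.sub_int_mul_two_pi (hτ : ArcParam Γ τ) {s : Set ℂ} {u : ℂ → ℂ} {t φ : ℂ → ℝ}
    (hd : PhaseDecomp Γ τ s u t φ) (k : ℤ) :
    PhaseDecomp Γ τ s u t fun x => φ x - k * (2 * Real.pi) := by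
  refine ⟨hd.1, hd.2.1.sub continuousOn_const, fun x hx => ?_⟩
  simp only [hτ.periodic.sub_int_mul_eq, hτ.periodic.deriv_periodic.sub_int_mul_eq]
  exact hd.2.2 x hx

lemma PhaseDecomp.eq_zero_of_mem (hτ : ArcParam Γ τ) {s : Set ℂ} {u : ℂ → ℂ} {t φ : ℂ → ℝ}
    (hd : PhaseDecomp Γ τ s u t φ) {x : ℂ} (hx : x ∈ s) {θ : ℝ} (hu : u x = τ θ) :
    t x = 0 ∧ τ (φ x) = τ θ := by
  obtain ⟨h1, h2⟩ := hd.2.2 x hx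
  have h3 : t x = 0 := by
    rw [hu, infDist_zero_of_mem (hτ.mem θ)] at h2
    exact abs_eq_zero.1 h2
  refine ⟨h3, ?_⟩
  rw [← hu, h1, h3]
  simp

end Normalization

end Preparation

/-- Lemma 3.4: for vortex-less solutions with degree-zero boundary datum,
the signed distance `t_ε` of `u_ε` to `Γ` tends to `0` uniformly on `closure Ω` as `ε → 0`. -/
theorem signed_distance_uniformly_to_zero
    (Γ : Set ℂ) (τ : ℝ → ℂ) (W : ℂ → ℝ) (R₀ : ℝ)
    (hΓ : ArcParam Γ τ) (hW : PotentialHyp Γ W R₀)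
    (Ω : Set ℂ) (hΩo : IsOpen Ω) (hΩb : Bornology.IsBounded Ω) (hΩne : Ω.Nonempty)
    (hΩsc : SimplyConnectedSpace ↥Ω) (hΩsm : ∃ γ L, BoundaryParam Ω γ L)
    (δ₁ m : ℝ) (hδ₁ : 0 < δ₁) (hm : 0 < m) (hmax : MaxPrinciple Γ τ W δ₁ m)
    (g : ℂ → ℂ) (φ₀ : ℂ → ℝ) (hφ₀ : ContDiff ℝ (⊤ : ℕ∞) φ₀)
    (hgφ₀ : ∀ x ∈ frontier Ω, g x = τ (φ₀ x))
    (ε₀ : ℝ) (hε₀ : 0 < ε₀) (u : ℝ → ℂ → ℂ)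
    (hu : ∀ ε ∈ Set.Ioo (0 : ℝ) ε₀, SolvesGL W Ω ε (u ε) ∧
      (∀ x ∈ frontier Ω, u ε x = g x) ∧
      ∀ x ∈ Ω, Metric.infDist (u ε x) Γ ≤ δ₁)
    (t φ : ℝ → ℂ → ℝ)
    (hdec : ∀ ε ∈ Set.Ioo (0 : ℝ) ε₀,
      PhaseDecomp Γ τ (closure Ω) (u ε) (t ε) (φ ε)) :
    TendstoUniformlyOn (fun ε => t ε) (fun _ => (0 : ℝ)) (𝓝[>] (0 : ℝ)) (closure Ω) := by
  obtain ⟨γ, L, hγ⟩ := hΩsm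
  obtain ⟨r, hr, hball⟩ := hγ.exists_exterior_ball hΩo hΩb hΩne
  obtain ⟨η₁, hη₁, hlevel⟩ := exists_abs_ne_level hΓ hW hmax hm hδ₁ hΩo hΩb hr hball hφ₀.continuous
  have hconn : IsPreconnected (closure Ω) :=
    (isPreconnected_iff_preconnectedSpace.2 inferInstance : IsPreconnected Ω).closure
  rw [Metric.tendstoUniformlyOn_iff]
  intro e he
  obtain ⟨ε₁, hε₁, hno⟩ := hlevel (min η₁ e) (lt_min hη₁ he) (min_le_left _ _)
  filter_upwards [Ioo_mem_nhdsGT (lt_min hε₀ hε₁)] with ε hε x hx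
  have hε' : ε ∈ Ioo 0 ε₀ := ⟨hε.1, hε.2.trans_le (min_le_left _ _)⟩
  obtain ⟨hsol, hbdry, hle⟩ := hu ε hε'
  have hd := hdec ε hε'
  have hfr : ∀ y ∈ frontier Ω, t ε y = 0 ∧ τ (φ ε y) = τ (φ₀ y) := fun y hy =>
    hd.eq_zero_of_mem hΓ hy.1 ((hbdry y hy).trans (hgφ₀ y hy))
  obtain ⟨k, hk⟩ := exists_phase_shift hΓ hγ.isPreconnected_frontier
    (hd.2.1.mono frontier_subset_closure) hφ₀.continuous.continuousOn fun y hy => (hfr y hy).2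
  have hle' : ∀ y ∈ closure Ω, infDist (u ε y) Γ ≤ δ₁ := by
    intro y hy
    by_cases hyΩ : y ∈ Ω
    · exact hle y hyΩ
    · have hyf : y ∈ frontier Ω := ⟨hy, by rwa [hΩo.interior_eq]⟩
      rw [← (hd.2.2 y hy).2, (hfr y hyf).1, abs_zero]
      exact hδ₁.le
  have hne := hno ε (u ε) (t ε) _ hε.1 (hε.2.trans_le (min_le_right _ _)) hsol
    (hd.sub_int_mul_two_pi hΓ k) hle' hk fun y hy => (hfr y hy).1
  have hlt : |t ε x| < min η₁ e := by
    by_contra hge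
    push Not at hge
    have h0 : γ 0 ∈ closure Ω := (hγ.mem_frontier 0).1
    obtain ⟨y, hy, hyη⟩ := hconn.intermediate_value h0 hx hd.1.abs
      ⟨by rw [(hfr _ (hγ.mem_frontier 0)).1, abs_zero]; positivity, hge⟩
    exact hne y hy hyη
  rw [dist_comm, Real.dist_eq, sub_zero]
  exact hlt.trans_le (min_le_right _ _)
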